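/- Let π ∈ ℤ[i] be a primary prime with p = π·π̄ (and assume p > 5 in the case p ≡ 5 (mod 16)). Then the elliptic Gauss sum is expressible as G_π(χ_π, f) = α_π·π̃³, where the coefficient α_π = π̃^{−3}·G_π(χ_π, f) is an algebraic integer lying in ℤ[i] if p ≡ 5 (mod 8), and in ζ₈·ℤ[i] if p ≡ 1 (mod 8). Moreover α_π ≡ 1 (mod (1+i)) if p ≡ 5 (mod 8). -/

import Mathlib

open Complex BigOperators

noncomputable section

/-- The ring of Gaussian integers `ℤ[i]`, realized as a subring of `ℂ`. -/
def O4 : Subring ℂ := Subring.closure {Complex.I}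

/-- `ζ₈ = e^{2πi/8}`, a primitive eighth root of unity. -/
def zeta8 : ℂ := Complex.exp (2 * Real.pi * Complex.I / 8)

/-- The ring `ℤ[ζ₈]`, realized as a subring of `ℂ`. -/
def O8 : Subring ℂ := Subring.closure {zeta8}

/-- The congruence `a ≡ b (mod c)` in `ℤ[i]`. -/
def GCong (a b c : ℂ) : Prop := ∃ d ∈ O4, a - b = c * d

/-- `a` and `b` are coprime in `ℤ[i]`. -/
def GCoprime (a b : ℂ) : Prop := ∃ u ∈ O4, ∃ v ∈ O4, u * a + v * b = 1

/-- The real period `ϖ = 2∫₀¹ (1−x⁴)^{−1/2} dx`. -/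
def varpi : ℝ := 2 * ∫ x in (0:ℝ)..(1:ℝ), (1 - x ^ 4) ^ (-(1:ℝ)/2)

/-- The points of the period lattice `ϖ·ℤ[i]`. -/
def ω4 (m : ℤ × ℤ) : ℂ := (varpi : ℂ) * ((m.1 : ℂ) + (m.2 : ℂ) * Complex.I)

/-- The Weierstrass `℘`-function of the period lattice `ϖ·ℤ[i]`
(so that `℘′² = 4℘³ − 4℘`). -/
def wp4 (u : ℂ) : ℂ :=
  (u ^ 2)⁻¹ + ∑' m : ℤ × ℤ, if m = 0 then 0 else (((u - ω4 m) ^ 2)⁻¹ - ((ω4 m) ^ 2)⁻¹)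

/-- The derivative `℘′` of the Weierstrass `℘`-function of `ϖ·ℤ[i]`. -/
def wp4' (u : ℂ) : ℂ := ∑' m : ℤ × ℤ, (-2) * ((u - ω4 m) ^ 3)⁻¹

/-- The Weierstrass `ζ`-function of the period lattice `ϖ·ℤ[i]`. -/
def wzeta4 (u : ℂ) : ℂ :=
  u⁻¹ + ∑' m : ℤ × ℤ, if m = 0 then 0 else ((u - ω4 m)⁻¹ + (ω4 m)⁻¹ + u * ((ω4 m) ^ 2)⁻¹)

/-- The non-analytic doubly periodic function `Z(u) = ζ(ϖu) − (π/ϖ)·ū`. -/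
def Z4 (u : ℂ) : ℂ :=
  wzeta4 ((varpi : ℂ) * u) - ((Real.pi / varpi : ℝ) : ℂ) * (starRingEnd ℂ) u

/-- The lemniscatic sine `φ(u) = sl((1−i)ϖu) = −2(1−i)·℘(ϖu)/℘′(ϖu)`,
of period lattice `ℤ[i]`. -/
def phi4 (u : ℂ) : ℂ :=
  -2 * (1 - Complex.I) * wp4 ((varpi : ℂ) * u) / wp4' ((varpi : ℂ) * u)

/-- The lemniscatic cosine `ψ(u) = cl((1−i)ϖu) = (℘(ϖu)+i)/(℘(ϖu)−i)`,
of period lattice `ℤ[i]`. -/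
def psi4 (u : ℂ) : ℂ :=
  (wp4 ((varpi : ℂ) * u) + Complex.I) / (wp4 ((varpi : ℂ) * u) - Complex.I)

/-- A residue class character modulo `β` on `ℤ[i]`. -/
structure IsResChar4 (β : ℂ) (χ : ℂ → ℂ) : Prop where
  periodic : ∀ a ∈ O4, ∀ b ∈ O4, GCong a b β → χ a = χ b
  map_mul : ∀ a ∈ O4, ∀ b ∈ O4, χ (a * b) = χ a * χ b
  map_one : χ 1 = 1
  vanish : ∀ a ∈ O4, ¬ GCoprime a β → χ a = 0

/-- The quartic residue character `χ_π = (·/π)₄` modulo a prime `π` with `p = π·π̄`: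
`χ_π(ν)⁴ = 1` and `χ_π(ν) ≡ ν^{(p−1)/4} (mod π)`. -/
structure IsQuarticChar (π : ℂ) (p : ℕ) (χ : ℂ → ℂ) : Prop where
  resChar : IsResChar4 π χ
  quart : ∀ ν ∈ O4, GCoprime ν π → χ ν ^ 4 = 1
  euler : ∀ ν ∈ O4, GCoprime ν π → GCong (χ ν) (ν ^ ((p - 1) / 4)) π

/-- The elliptic Gauss sum `G_π(χ, f) = (1/4)·Σ_{ν ∈ (ℤ[i]/(π))^×} χ(ν)·f(ν/π)`,
computed via the integer representatives `1, …, p−1` of `(ℤ[i]/(π))^× ≅ (ℤ/p)^×`. -/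
def EGS4 (p : ℕ) (χ f : ℂ → ℂ) (π : ℂ) : ℂ :=
  (1/4 : ℂ) * ∑ r ∈ Finset.Icc 1 (p - 1), χ (r : ℂ) * f ((r : ℂ) / π)

/-- `S` is a quarter set of `(ℤ[i]/(π))^×`, i.e. `(ℤ[i]/(π))^× = S ∪ −S ∪ iS ∪ −iS`. -/
def IsQuarterSet (π : ℂ) (S : Finset ℂ) : Prop :=
  (∀ ν ∈ S, ν ∈ O4 ∧ GCoprime ν π) ∧
  (∀ a ∈ O4, GCoprime a π →
    ∃ ν ∈ S, ∃ ε ∈ ({1, -1, Complex.I, -Complex.I} : Set ℂ), GCong a (ε * ν) π) ∧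
  (∀ ν ∈ S, ∀ μ ∈ S, ∀ ε ∈ ({1, -1, Complex.I, -Complex.I} : Set ℂ),
    ∀ ε' ∈ ({1, -1, Complex.I, -Complex.I} : Set ℂ),
      GCong (ε * ν) (ε' * μ) π → ν = μ ∧ ε = ε')

/-- `γ(S)`: if `p ≡ 5 (mod 8)`, the fourth root of unity with
`γ(S) ≡ ∏_{ν∈S} ν (mod π)`; if `p ≡ 1 (mod 8)`, the fourth root of `−1` with
`γ(S) ≡ ∏_{ν∈S} ν (mod Π)` for a fixed prime `Π` of `ℤ[ζ₈]` with `π = Π·Π′`. -/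
def IsGamma4 (π : ℂ) (p : ℕ) (S : Finset ℂ) (γ : ℂ) : Prop :=
  (p % 8 = 5 → γ ^ 4 = 1 ∧ GCong γ (∏ ν ∈ S, ν) π) ∧
  (p % 8 = 1 → γ ^ 4 = -1 ∧
    ∃ P : O8, Prime P ∧ (∃ Q : O8, π = (P : ℂ) * (Q : ℂ)) ∧
      ∃ d ∈ O8, γ - ∏ ν ∈ S, ν = (P : ℂ) * d)

/-- `L` is the value at `s = 1` of the analytic continuation of the Hecke `L`-series
`L(s, χ̃) = Σ_𝔞 χ̃(𝔞)·N𝔞^{−s} = (1/4)·Σ_{ν ∈ ℤ[i]} χ₁(ν)·ν̄·|ν|^{−2s}` attached to the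
weight-one Hecke character `χ̃((ν)) = χ₁(ν)·ν̄` of `ℚ(i)`. -/
def IsLValue4 (χ₁ : ℂ → ℂ) (L : ℂ) : Prop :=
  ∃ F : ℂ → ℂ, DifferentiableOn ℂ F {s : ℂ | 0 < s.re} ∧
    (∀ s : ℂ, 3/2 < s.re →
      F s = (1/4 : ℂ) *
        ∑' ν : O4, χ₁ (ν : ℂ) * (starRingEnd ℂ) (ν : ℂ) *
          ((Complex.normSq (ν : ℂ) : ℂ) ^ (-s))) ∧
    F 1 = L

/-- `T` is a complete residue system modulo `β` in `ℤ[i]`. -/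
def IsCRS4 (β : ℂ) (T : Finset ℂ) : Prop :=
  (∀ a ∈ T, a ∈ O4) ∧ (∀ a ∈ T, ∀ b ∈ T, GCong a b β → a = b) ∧
  (∀ z ∈ O4, ∃ a ∈ T, GCong z a β)

/-- `e^{2πi·Re(z)}`. -/
def eRe4 (z : ℂ) : ℂ := Complex.exp (2 * Real.pi * Complex.I * (z.re : ℂ))

/-- `χ₀`: the character mod `(1+i)³` giving the natural isomorphism
`(ℤ[i]/(1+i)³)^× ≅ W`, i.e. `χ₀(ν) = ε` for `ν ≡ ε (mod (1+i)³)`, `ε ∈ W = {±1, ±i}`. -/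
def IsChi0₄ (χ₀ : ℂ → ℂ) : Prop :=
  IsResChar4 ((1 + Complex.I) ^ 3) χ₀ ∧
    ∀ ε ∈ ({1, -1, Complex.I, -Complex.I} : Set ℂ), χ₀ ε = ε

/-- `χ₀′`: the character mod `(1+i)² = 2i` giving `(ℤ[i]/(2))^× ≅ {±1}`, i.e.
`χ₀′(ν) = δ²` for `ν ≡ δ (mod (1+i)²)`, `δ ∈ {1, i}`. -/
def IsChi0'₄ (χ₀' : ℂ → ℂ) : Prop :=
  IsResChar4 2 χ₀' ∧ χ₀' Complex.I = -1

/-- The classical quartic Gauss sum `G₄(π) = Σ_{r=1}^{p−1} (r/π)₄·e^{2πir/p}`. -/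
def G4sum (p : ℕ) (χ : ℂ → ℂ) : ℂ :=
  ∑ r ∈ Finset.Icc 1 (p - 1), χ (r : ℂ) * Complex.exp (2 * Real.pi * Complex.I * (r : ℂ) / (p : ℂ))

open Filter Topology

namespace PeriodPair
variable (L : PeriodPair)

lemma countable_lattice : (L.lattice : Set ℂ).Countable := by
  have : (L.lattice : Set ℂ) = Set.range fun m : ℤ × ℤ => (m.1 * L.ω₁ + m.2 * L.ω₂ : ℂ) := by
    ext x
    simp [mem_lattice]
  rw [this]
  exact Set.countable_range _

lemma isOpen_compl_lattice : IsOpen (L.lattice : Set ℂ)ᶜ := L.isClosed_lattice.isOpen_compl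

lemma isPreconnected_compl_of_countable {s : Set ℂ} (hs : s.Countable) : IsPreconnected sᶜ :=
  (hs.isConnected_compl_of_one_lt_rank (by simp)).isPreconnected

lemma hasDerivAt_weierstrassP {z : ℂ} (hz : z ∉ L.lattice) :
    HasDerivAt L.weierstrassP (L.derivWeierstrassP z) z := by
  rw [← L.deriv_weierstrassP]
  exact (L.analyticOnNhd_weierstrassP z hz).differentiableAt.hasDerivAt

lemma eventually_notMem_lattice (z : ℂ) : ∀ᶠ w in 𝓝[≠] z, w ∉ L.lattice := by
  filter_upwards [self_mem_nhdsWithin, mem_nhdsWithin_of_mem_nhds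
    (L.compl_lattice_sdiff_singleton_mem_nhds z)] with w hw hw'
  simp_all

lemma eventually_notMem_nhds {z : ℂ} (hz : z ∉ L.lattice) : ∀ᶠ w in 𝓝 z, w ∉ L.lattice :=
  L.isOpen_compl_lattice.mem_nhds hz

lemma derivWeierstrassP_ne_zero_frequently : ∃ᶠ z in 𝓝[≠] (0 : ℂ), L.derivWeierstrassP z ≠ 0 := by
  intro h
  have hE : ContinuousAt (fun z : ℂ => z ^ 3 * L.derivWeierstrassPExcept 0 z) 0 :=
    (continuousAt_id.pow 3).mul (L.analyticAt_derivWeierstrassPExcept 0).continuousAt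
  have h1 : Tendsto (fun z : ℂ => z ^ 3 * L.derivWeierstrassPExcept 0 z) (𝓝[≠] 0) (𝓝 0) := by
    have := hE.tendsto.mono_left (nhdsWithin_le_nhds (s := {0}ᶜ))
    simpa using this
  have h2 : Tendsto (fun z : ℂ => z ^ 3 * L.derivWeierstrassPExcept 0 z) (𝓝[≠] 0) (𝓝 2) := by
    refine tendsto_const_nhds.congr' ?_
    filter_upwards [h, self_mem_nhdsWithin] with z hz hz0
    have := L.derivWeierstrassPExcept_sub 0 z
    simp only [ne_eq, not_not] at hz
    have hz0 : z ≠ 0 := hz0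
    simp [hz, sub_eq_zero] at this
    rw [this]; field_simp
  have := tendsto_nhds_unique h1 h2
  norm_num at this

lemma hasDerivAt_derivWeierstrassP {z : ℂ} (hz : z ∉ L.lattice) :
    HasDerivAt L.derivWeierstrassP (6 * L.weierstrassP z ^ 2 - L.g₂ / 2) z := by
  have key := AnalyticOnNhd.eq_zero_or_eq_zero_of_mul_eq_zero
    (U := (L.lattice : Set ℂ)ᶜ) (f := L.derivWeierstrassP)
    (g := fun z => 2 * deriv L.derivWeierstrassP z - 12 * L.weierstrassP z ^ 2 + L.g₂)
    L.analyticOnNhd_derivWeierstrassP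
    (((analyticOnNhd_const.mul L.analyticOnNhd_derivWeierstrassP.deriv).sub
      (analyticOnNhd_const.mul (L.analyticOnNhd_weierstrassP.pow 2))).add analyticOnNhd_const)
    (fun w hw => by
      have hP := L.hasDerivAt_weierstrassP hw
      have hP' := (L.analyticOnNhd_derivWeierstrassP w hw).differentiableAt.hasDerivAt
      have h1 := (((hP'.pow 2).sub ((hP.pow 3).const_mul 4)).add (hP.const_mul L.g₂)).add_const L.g₃
      have h2 : (fun w => L.derivWeierstrassP w ^ 2 - 4 * L.weierstrassP w ^ 3
          + L.g₂ * L.weierstrassP w + L.g₃) =ᶠ[𝓝 w] fun _ => 0 := by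
        filter_upwards [L.eventually_notMem_nhds hw] with v hv
        rw [L.derivWeierstrassP_sq v hv]; ring
      have h3 := h1.unique ((hasDerivAt_const w (0:ℂ)).congr_of_eventuallyEq h2)
      simp only [Nat.cast_ofNat] at h3
      linear_combination h3)
    (isPreconnected_compl_of_countable L.countable_lattice)
  have hP' := (L.analyticOnNhd_derivWeierstrassP z hz).differentiableAt.hasDerivAt
  rcases key with h | h
  · exfalso
    refine L.derivWeierstrassP_ne_zero_frequently ?_
    filter_upwards [L.eventually_notMem_lattice 0] with w hw
    simpa using h w hw
  · have h2 : 6 * L.weierstrassP z ^ 2 - L.g₂ / 2 = deriv L.derivWeierstrassP z := by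
      linear_combination (-1/2) * h z hz
    rwa [h2]

/-- Liouville's theorem for a doubly periodic function with removable singularities. -/
lemma eventually_eq_const_of_periodic {f : ℂ → ℂ}
    (hf : ∀ z, ∃ g : ℂ → ℂ, AnalyticAt ℂ g z ∧ f =ᶠ[𝓝[≠] z] g)
    (hper : ∀ z, ∀ l ∈ L.lattice, f (z + l) = f z) :
    ∃ c, ∀ z, ∀ᶠ w in 𝓝[≠] z, f w = c := by
  choose g hg hfg using hf
  let F : ℂ → ℂ := fun z => g z z
  have htend : ∀ z, Tendsto f (𝓝[≠] z) (𝓝 (F z)) := fun z =>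
    ((hg z).continuousAt.tendsto.mono_left nhdsWithin_le_nhds).congr' (hfg z).symm
  have hFg : ∀ z, F =ᶠ[𝓝 z] g z := by
    intro z
    have h1 := (eventually_eventually_nhdsWithin.2 (hfg z))
    have h2 : ∀ᶠ w in 𝓝[≠] z, F w = g z w := by
      filter_upwards [h1, self_mem_nhdsWithin,
        (hg z).eventually_analyticAt.filter_mono nhdsWithin_le_nhds] with w hw hwz hga
      have hw' : ∀ᶠ y in 𝓝[≠] w, f y = g z y := by
        have h : 𝓝[{z}ᶜ] w = 𝓝 w := isOpen_compl_singleton.nhdsWithin_eq hwz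
        rw [h] at hw
        exact hw.filter_mono nhdsWithin_le_nhds
      exact tendsto_nhds_unique (htend w)
        ((hga.continuousAt.tendsto.mono_left nhdsWithin_le_nhds).congr' (by
          filter_upwards [hw'] with y hy using hy.symm))
    rw [eventually_nhdsWithin_iff] at h2
    filter_upwards [h2] with w hw
    by_cases h : w = z
    · subst h; rfl
    · exact hw h
  have hFd : Differentiable ℂ F := fun z =>
    ((hg z).congr (hFg z).symm).differentiableAt
  have hFp : ∀ z, ∀ l ∈ L.lattice, F (z + l) = F z := by
    intro z l hl
    refine tendsto_nhds_unique ?_ (htend z)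
    have hm : Tendsto (fun w => w + l) (𝓝[≠] z) (𝓝[≠] (z + l)) := by
      refine tendsto_nhdsWithin_iff.2 ⟨?_, ?_⟩
      · exact ((continuous_add_const l).tendsto z).mono_left nhdsWithin_le_nhds
      · filter_upwards [self_mem_nhdsWithin] with w hw
        simpa using hw
    refine ((htend (z + l)).comp hm).congr fun w => hper w l hl
  have hc : ∀ z, F z = F 0 := fun z =>
    hFd.apply_eq_apply_of_bounded (IsZLattice.isCompact_range_of_periodic L.lattice _
      hFd.continuous fun z w hw => hFp z w hw).isBounded z 0
  refine ⟨F 0, fun z => ?_⟩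
  filter_upwards [hfg z, (hFg z).filter_mono nhdsWithin_le_nhds] with w h1 h2
  rw [h1, ← h2, hc]

end PeriodPair

open Filter Topology

namespace PeriodPair
variable (L : PeriodPair)

lemma eventually_eq_of_deriv_eq_zero {g : ℂ → ℂ} {z : ℂ} (hg : AnalyticAt ℂ g z)
    (h : ∀ᶠ w in 𝓝[≠] z, deriv g w = 0) : ∀ᶠ w in 𝓝 z, g w = g z := by
  have h0 : ∀ᶠ w in 𝓝 z, deriv g w = 0 :=
    hg.deriv.frequently_zero_iff_eventually_zero.1 h.frequently
  obtain ⟨r, hr, hball⟩ := Metric.eventually_nhds_iff_ball.1 (h0.and hg.eventually_analyticAt)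
  filter_upwards [Metric.ball_mem_nhds z hr] with w hw
  exact Metric.isOpen_ball.is_const_of_deriv_eq_zero (convex_ball z r).isPreconnected
    (fun y hy => (hball y hy).2.differentiableAt.differentiableWithinAt)
    (fun y hy => (hball y hy).1) hw (Metric.mem_ball_self hr)

lemma countable_union (c : ℂ) : ((L.lattice : Set ℂ) ∪ {u | c - u ∈ L.lattice}).Countable := by
  refine L.countable_lattice.union ?_
  have : {u : ℂ | c - u ∈ L.lattice} = Set.image (fun x => c - x) (L.lattice : Set ℂ) := by
    ext u; constructor
    · intro h; exact ⟨c - u, h, by ring⟩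
    · rintro ⟨x, hx, rfl⟩; simpa using hx
  rw [this]; exact L.countable_lattice.image _

/-- The addition theorem for `℘`, in polynomial form. -/
theorem weierstrassP_add_formula_sub {c : ℂ} (hc : c ∉ L.lattice) {u : ℂ} (hu : u ∉ L.lattice)
    (hv : c - u ∉ L.lattice) :
    4 * (L.weierstrassP c + L.weierstrassP u + L.weierstrassP (c - u)) *
      (L.weierstrassP u - L.weierstrassP (c - u)) ^ 2 =
      (L.derivWeierstrassP u - L.derivWeierstrassP (c - u)) ^ 2 := by
  set E := L.weierstrassPExcept 0 with hE
  set E' := L.derivWeierstrassPExcept 0 with hE'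
  have hEu : ∀ u, L.weierstrassP u = E u + 1 / u ^ 2 := fun u => by
    have := L.weierstrassPExcept_add 0 u
    simpa using this.symm
  have hEu' : ∀ u, L.derivWeierstrassP u = E' u - 2 / u ^ 3 := fun u => by
    have := L.derivWeierstrassPExcept_sub 0 u
    simpa using this.symm
  let N : ℂ → ℂ := fun u => -2 + u ^ 3 * (E' u - L.derivWeierstrassP (c - u))
  let M : ℂ → ℂ := fun u => 1 + u ^ 2 * (E u - L.weierstrassP (c - u))
  let Q : ℂ → ℂ := fun u => u * (E' u - L.derivWeierstrassP (c - u)) +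
    2 * (E u - L.weierstrassP (c - u))
  let T : ℂ → ℂ := fun u => (N u - 2 * M u) * Q u / (4 * M u ^ 2) - E u - L.weierstrassP (c - u)
  let S : ℂ → ℂ := fun u => (1/4) * ((L.derivWeierstrassP u - L.derivWeierstrassP (c - u)) /
    (L.weierstrassP u - L.weierstrassP (c - u))) ^ 2 - L.weierstrassP u - L.weierstrassP (c - u)
  have aE : AnalyticAt ℂ E 0 := L.analyticAt_weierstrassPExcept 0
  have aE' : AnalyticAt ℂ E' 0 := L.analyticAt_derivWeierstrassPExcept 0
  have acu : ∀ u, AnalyticAt ℂ (fun u : ℂ => c - u) u := fun u => by fun_prop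
  have aP : ∀ u, c - u ∉ L.lattice → AnalyticAt ℂ (fun u => L.weierstrassP (c - u)) u := by
    intro u h
    exact (L.analyticOnNhd_weierstrassP (c - u) h).comp (acu u)
  have aP' : ∀ u, c - u ∉ L.lattice → AnalyticAt ℂ (fun u => L.derivWeierstrassP (c - u)) u := by
    intro u h
    exact (L.analyticOnNhd_derivWeierstrassP (c - u) h).comp (acu u)
  have hc0 : c - 0 ∉ L.lattice := by simpa using hc
  have aP0 := aP 0 hc0
  have aP0' := aP' 0 hc0
  have aN : AnalyticAt ℂ N 0 := by fun_prop
  have aM : AnalyticAt ℂ M 0 := by fun_prop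
  have aQ : AnalyticAt ℂ Q 0 := by fun_prop
  have hM0 : M 0 = 1 := by simp [M]
  have aT : AnalyticAt ℂ T 0 :=
    (((aN.sub (analyticAt_const.mul aM)).mul aQ).div (analyticAt_const.mul (aM.pow 2))
      (by simp [hM0])).sub aE |>.sub aP0
  have hT0 : T 0 = L.weierstrassP c := by
    have : E 0 = 0 := L.weierstrassPExcept_zero 0
    simp only [T, N, M, Q, this]
    simp
    ring
  have evu : ∀ᶠ u in 𝓝 (0:ℂ), c - u ∉ L.lattice :=
    (continuous_const.sub continuous_id).continuousAt.eventually (L.eventually_notMem_nhds hc0)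
  have evM : ∀ᶠ u in 𝓝 (0:ℂ), M u ≠ 0 :=
    aM.continuousAt.eventually_ne (by simp [hM0])
  have hMP : ∀ u, u ≠ 0 → L.weierstrassP u - L.weierstrassP (c - u) = M u / u ^ 2 := by
    intro u h; rw [hEu u]; simp only [M]; field_simp; ring
  have hNP : ∀ u, u ≠ 0 → L.derivWeierstrassP u - L.derivWeierstrassP (c - u) = N u / u ^ 3 := by
    intro u h; rw [hEu' u]; simp only [N]; field_simp; ring
  have hST : ∀ u, u ≠ 0 → M u ≠ 0 → S u = T u := by
    intro u h hM
    have hQ : N u + 2 * M u = u ^ 2 * Q u := by simp only [N, M, Q]; ring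
    have hN : N u = u ^ 2 * Q u - 2 * M u := by linear_combination hQ
    simp only [S, T]
    rw [hMP u h, hNP u h, hEu u, hN]
    field_simp
    ring
  have hSd : ∀ u, u ∉ L.lattice → c - u ∉ L.lattice →
      L.weierstrassP u - L.weierstrassP (c - u) ≠ 0 → HasDerivAt S 0 u := by
    intro u hu hv hne
    have d1 := L.hasDerivAt_weierstrassP hu
    have d2 := L.hasDerivAt_derivWeierstrassP hu
    have dc : HasDerivAt (fun u : ℂ => c - u) (-1) u := by
      simpa using (hasDerivAt_id u).const_sub c
    have d3 := (L.hasDerivAt_weierstrassP hv).comp u dc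
    have d4 := (L.hasDerivAt_derivWeierstrassP hv).comp u dc
    have d5 := (((((d2.sub d4).div (d1.sub d3) hne).pow 2).const_mul (1/4)).sub d1).sub d3
    have e1 := L.derivWeierstrassP_sq u hu
    have e2 := L.derivWeierstrassP_sq _ hv
    refine d5.congr_deriv ?_
    simp only [Function.comp, Pi.div_apply, Pi.sub_apply]
    generalize L.weierstrassP u = a at *
    generalize L.weierstrassP (c - u) = b at *
    generalize L.derivWeierstrassP u = a' at *
    generalize L.derivWeierstrassP (c - u) = b' at *
    have hK : (6 * a ^ 2 - L.g₂ / 2 - (6 * b ^ 2 - L.g₂ / 2) * -1) * (a - b) -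
        (a' - b') * (a' - b' * -1) = 2 * (a - b) ^ 3 := by
      linear_combination e2 - e1
    rw [hK]
    simp only [Nat.cast_ofNat, Nat.add_one_sub_one, pow_one]
    field_simp
    ring
  have hTconst : ∀ᶠ u in 𝓝 (0:ℂ), T u = T 0 := by
    refine eventually_eq_of_deriv_eq_zero aT ?_
    filter_upwards [evu.filter_mono nhdsWithin_le_nhds, evM.filter_mono nhdsWithin_le_nhds,
      L.eventually_notMem_lattice 0, self_mem_nhdsWithin,
      (eventually_eventually_nhds.2 evM).filter_mono nhdsWithin_le_nhds] with u h1 h2 h3 h4 h5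
    have h4 : u ≠ 0 := h4
    have hS := hSd u h3 h1 (by rw [hMP u h4]; exact div_ne_zero h2 (pow_ne_zero _ h4))
    refine (hS.congr_of_eventuallyEq ?_).deriv
    filter_upwards [h5, isOpen_ne.mem_nhds h4] with w hw1 hw2
    exact (hST w hw2 hw1).symm
  let U : Set ℂ := ((L.lattice : Set ℂ) ∪ {u | c - u ∈ L.lattice})ᶜ
  let g : ℂ → ℂ := fun u => 4 * (L.weierstrassP c + L.weierstrassP u + L.weierstrassP (c - u)) *
      (L.weierstrassP u - L.weierstrassP (c - u)) ^ 2 -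
      (L.derivWeierstrassP u - L.derivWeierstrassP (c - u)) ^ 2
  have hgU : AnalyticOnNhd ℂ g U := by
    intro w hw
    simp only [U, Set.mem_compl_iff, Set.mem_union, Set.mem_ofPred_eq, not_or] at hw
    have h1 := L.analyticOnNhd_weierstrassP w hw.1
    have h2 := L.analyticOnNhd_derivWeierstrassP w hw.1
    have h3 := aP w hw.2
    have h4 := aP' w hw.2
    fun_prop
  have hev : ∀ᶠ u in 𝓝[≠] (0:ℂ), g u = 0 ∧ u ∈ U := by
    filter_upwards [evu.filter_mono nhdsWithin_le_nhds, evM.filter_mono nhdsWithin_le_nhds,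
      L.eventually_notMem_lattice 0, self_mem_nhdsWithin,
      hTconst.filter_mono nhdsWithin_le_nhds] with u h1 h2 h3 h4 h5
    have h4 : u ≠ 0 := h4
    have hne : L.weierstrassP u - L.weierstrassP (c - u) ≠ 0 := by
      rw [hMP u h4]; exact div_ne_zero h2 (pow_ne_zero _ h4)
    refine ⟨?_, ?_⟩
    · have := hST u h4 h2
      rw [h5, hT0] at this
      simp only [S] at this
      simp only [g]
      rw [← this]
      field_simp
      ring
    · simp only [U, Set.mem_compl_iff, Set.mem_union, Set.mem_ofPred_eq, not_or]
      exact ⟨h3, h1⟩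
  obtain ⟨w, hwU, hw⟩ : ∃ w ∈ U, g =ᶠ[𝓝 w] 0 := by
    have h2 := eventually_eventually_nhdsWithin.2 hev
    obtain ⟨w, ⟨hw, hw0⟩, hwU⟩ := ((h2.and self_mem_nhdsWithin).and hev).exists
    refine ⟨w, hwU.2, ?_⟩
    have h : 𝓝[{0}ᶜ] w = 𝓝 w := isOpen_compl_singleton.nhdsWithin_eq hw0
    rw [h] at hw
    exact hw.mono fun _ h => h.1
  have := hgU.eqOn_zero_of_preconnected_of_eventuallyEq_zero
    (isPreconnected_compl_of_countable (L.countable_union c)) hwU hw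
    (show u ∈ U by
      simp only [U, Set.mem_compl_iff, Set.mem_union, Set.mem_ofPred_eq, not_or]; exact ⟨hu, hv⟩)
  simpa [g, sub_eq_zero] using this

end PeriodPair

open Filter Topology

namespace PeriodPair
variable (L : PeriodPair)

/-- The slope of the chord through the points with parameters `u` and `v`
on `y² = x³ - (g₂/4) x - g₃/4`. -/
def chordSlope (u v : ℂ) : ℂ :=
  (L.derivWeierstrassP u - L.derivWeierstrassP v) / (2 * (L.weierstrassP u - L.weierstrassP v))

lemma weierstrassP_eq_except_add (z : ℂ) :
    L.weierstrassP z = L.weierstrassPExcept 0 z + 1 / z ^ 2 := by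
  simpa using (L.weierstrassPExcept_add 0 z).symm

lemma weierstrassP_sub_of_mem {u v : ℂ} (h : u + v ∈ L.lattice) :
    L.weierstrassP u = L.weierstrassP v := by
  have := L.weierstrassP_add_coe (-v) ⟨u + v, h⟩
  simpa using this

lemma derivWeierstrassP_sub_of_mem {u v : ℂ} (h : u + v ∈ L.lattice) :
    L.derivWeierstrassP u = -L.derivWeierstrassP v := by
  have := L.derivWeierstrassP_add_coe (-v) ⟨u + v, h⟩
  simpa using this

lemma weierstrassP_add_of_mem (u : ℂ) {l : ℂ} (h : l ∈ L.lattice) :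
    L.weierstrassP (u + l) = L.weierstrassP u := L.weierstrassP_add_coe u ⟨l, h⟩

lemma derivWeierstrassP_add_of_mem (u : ℂ) {l : ℂ} (h : l ∈ L.lattice) :
    L.derivWeierstrassP (u + l) = L.derivWeierstrassP u := L.derivWeierstrassP_add_coe u ⟨l, h⟩

lemma add_notMem_of_ne {u v : ℂ} (hne : L.weierstrassP u ≠ L.weierstrassP v) :
    u + v ∉ L.lattice := fun h => hne (L.weierstrassP_sub_of_mem h)

lemma weierstrassP_add {u v : ℂ} (hu : u ∉ L.lattice) (hv : v ∉ L.lattice)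
    (hne : L.weierstrassP u ≠ L.weierstrassP v) :
    L.weierstrassP (u + v) = L.chordSlope u v ^ 2 - L.weierstrassP u - L.weierstrassP v := by
  have h := L.weierstrassP_add_formula_sub (L.add_notMem_of_ne hne) hu (by simpa using hv)
  simp only [add_sub_cancel_left] at h
  have : L.weierstrassP u - L.weierstrassP v ≠ 0 := sub_ne_zero.2 hne
  rw [chordSlope]
  field_simp
  linear_combination h

lemma hasDerivAt_chordSlope {u v : ℂ} (hu : u ∉ L.lattice) (hv : v ∉ L.lattice)
    (hne : L.weierstrassP u ≠ L.weierstrassP v) :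
    HasDerivAt (fun u => L.chordSlope u v) (L.weierstrassP u - L.weierstrassP (u + v)) u := by
  have hne' : L.weierstrassP u - L.weierstrassP v ≠ 0 := sub_ne_zero.2 hne
  have d := ((L.hasDerivAt_derivWeierstrassP hu).sub_const (L.derivWeierstrassP v)).div
    (((L.hasDerivAt_weierstrassP hu).sub_const (L.weierstrassP v)).const_mul 2)
    (mul_ne_zero two_ne_zero hne')
  refine d.congr_deriv ?_
  have e1 := L.derivWeierstrassP_sq u hu
  have e2 := L.derivWeierstrassP_sq v hv
  rw [L.weierstrassP_add hu hv hne, chordSlope]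
  field_simp
  linear_combination e2 - e1

lemma derivWeierstrassP_add {u v : ℂ} (hu : u ∉ L.lattice) (hv : v ∉ L.lattice)
    (hne : L.weierstrassP u ≠ L.weierstrassP v) :
    L.derivWeierstrassP (u + v) =
      2 * L.chordSlope u v * (L.weierstrassP u - L.weierstrassP (u + v)) -
        L.derivWeierstrassP u := by
  have d1 := (L.hasDerivAt_weierstrassP (L.add_notMem_of_ne hne)).comp_add_const u v
  have d2 := (((L.hasDerivAt_chordSlope hu hv hne).pow 2).sub
    (L.hasDerivAt_weierstrassP hu)).sub_const (L.weierstrassP v)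
  have hev : (fun x => L.weierstrassP (x + v)) =ᶠ[𝓝 u]
      fun x => L.chordSlope x v ^ 2 - L.weierstrassP x - L.weierstrassP v := by
    have hcont := (L.hasDerivAt_weierstrassP hu).continuousAt.eventually_ne hne
    filter_upwards [L.eventually_notMem_nhds hu, hcont] with x h1 h2
    exact L.weierstrassP_add h1 hv h2
  have := d1.unique (d2.congr_of_eventuallyEq hev)
  simpa using this

/-- `V` is the curve `y² = x³ - (g₂/4) x - g₃/4`, assumed nonsingular. -/
structure IsModel (V : WeierstrassCurve ℂ) : Prop where
  a₁ : V.a₁ = 0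
  a₂ : V.a₂ = 0
  a₃ : V.a₃ = 0
  a₄ : V.a₄ = -L.g₂ / 4
  a₆ : V.a₆ = -L.g₃ / 4
  Δ : V.Δ ≠ 0

variable {L} {V : WeierstrassCurve ℂ}

lemma IsModel.nonsingular (h : L.IsModel V) {u : ℂ} (hu : u ∉ L.lattice) :
    V.toAffine.Nonsingular (L.weierstrassP u) (L.derivWeierstrassP u / 2) := by
  rw [← WeierstrassCurve.Affine.equation_iff_nonsingular_of_Δ_ne_zero h.Δ,
    WeierstrassCurve.Affine.equation_iff, h.a₁, h.a₂, h.a₃, h.a₄, h.a₆]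
  linear_combination (1/4) * L.derivWeierstrassP_sq u hu

open Classical in
/-- The parametrization of the curve by `(℘, ℘′/2)`. -/
def IsModel.toPoint (h : L.IsModel V) (u : ℂ) : V.toAffine.Point :=
  if hu : u ∈ L.lattice then 0 else .some _ _ (h.nonsingular hu)

namespace IsModel

lemma toPoint_of_mem (h : L.IsModel V) {u : ℂ} (hu : u ∈ L.lattice) : h.toPoint u = 0 :=
  dif_pos hu

lemma toPoint_of_notMem (h : L.IsModel V) {u : ℂ} (hu : u ∉ L.lattice) :
    h.toPoint u = .some _ _ (h.nonsingular hu) := dif_neg hu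

lemma toPoint_eq_zero (h : L.IsModel V) {u : ℂ} : h.toPoint u = 0 ↔ u ∈ L.lattice := by
  by_cases hu : u ∈ L.lattice
  · simp [h.toPoint_of_mem hu, hu]
  · simp [h.toPoint_of_notMem hu, hu]

lemma toPoint_add_of_mem (h : L.IsModel V) (u : ℂ) {l : ℂ} (hl : l ∈ L.lattice) :
    h.toPoint (u + l) = h.toPoint u := by
  by_cases hu : u ∈ L.lattice
  · rw [h.toPoint_of_mem hu, h.toPoint_of_mem (add_mem hu hl)]
  · have : u + l ∉ L.lattice := by rwa [Submodule.add_mem_iff_left _ hl]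
    rw [h.toPoint_of_notMem hu, h.toPoint_of_notMem this]
    simp [L.weierstrassP_add_of_mem u hl, L.derivWeierstrassP_add_of_mem u hl]

lemma toPoint_neg (h : L.IsModel V) (u : ℂ) : h.toPoint (-u) = -h.toPoint u := by
  by_cases hu : u ∈ L.lattice
  · rw [h.toPoint_of_mem hu, h.toPoint_of_mem (neg_mem hu), neg_zero]
  · have : -u ∉ L.lattice := by rwa [neg_mem_iff]
    rw [h.toPoint_of_notMem hu, h.toPoint_of_notMem this, WeierstrassCurve.Affine.Point.neg_some]
    simp [WeierstrassCurve.Affine.negY, h.a₁, h.a₃, neg_div]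

lemma toPoint_add_of_ne (h : L.IsModel V) {u v : ℂ} (hu : u ∉ L.lattice) (hv : v ∉ L.lattice)
    (hne : L.weierstrassP u ≠ L.weierstrassP v) :
    h.toPoint (u + v) = h.toPoint u + h.toPoint v := by
  have hne' : L.weierstrassP u - L.weierstrassP v ≠ 0 := sub_ne_zero.2 hne
  rw [h.toPoint_of_notMem hu, h.toPoint_of_notMem hv,
    h.toPoint_of_notMem (L.add_notMem_of_ne hne), WeierstrassCurve.Affine.Point.add_of_X_ne hne]
  have hs : V.toAffine.slope (L.weierstrassP u) (L.weierstrassP v) (L.derivWeierstrassP u / 2)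
      (L.derivWeierstrassP v / 2) = L.chordSlope u v := by
    rw [WeierstrassCurve.Affine.slope_of_X_ne hne, chordSlope]
    field_simp
  have hX : V.toAffine.addX (L.weierstrassP u) (L.weierstrassP v) (L.chordSlope u v) =
      L.weierstrassP (u + v) := by
    rw [L.weierstrassP_add hu hv hne, WeierstrassCurve.Affine.addX, h.a₁, h.a₂]
    ring
  simp only [WeierstrassCurve.Affine.Point.some.injEq]
  rw [hs]
  refine ⟨hX.symm, ?_⟩
  rw [WeierstrassCurve.Affine.addY, WeierstrassCurve.Affine.negAddY, hX,
    L.derivWeierstrassP_add hu hv hne, WeierstrassCurve.Affine.negY, h.a₁, h.a₃]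
  ring

end IsModel

variable (L)

lemma derivWeierstrassP_eventually_ne {u : ℂ} (hu : u ∉ L.lattice) :
    ∀ᶠ w in 𝓝[≠] u, L.derivWeierstrassP w ≠ 0 := by
  rcases (L.analyticOnNhd_derivWeierstrassP u hu).eventually_eq_zero_or_eventually_ne_zero
    with h | h
  · exfalso
    have := L.analyticOnNhd_derivWeierstrassP.eqOn_zero_of_preconnected_of_eventuallyEq_zero
      (isPreconnected_compl_of_countable L.countable_lattice) hu h
    refine L.derivWeierstrassP_ne_zero_frequently ?_
    filter_upwards [L.eventually_notMem_lattice 0] with w hw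
    simpa using this hw
  · exact h

lemma weierstrassP_eventually_ne {u : ℂ} (hu : u ∉ L.lattice) (a : ℂ) :
    ∀ᶠ w in 𝓝[≠] u, L.weierstrassP w ≠ a := by
  rcases ((L.analyticOnNhd_weierstrassP u hu).sub
    (analyticAt_const (v := a))).eventually_eq_zero_or_eventually_ne_zero with h | h
  · exfalso
    have h1 : ∀ᶠ w in 𝓝 u, L.derivWeierstrassP w = 0 := by
      filter_upwards [eventually_eventually_nhds.2 h, L.eventually_notMem_nhds hu] with w hw hwl
      have : L.weierstrassP =ᶠ[𝓝 w] fun _ => a := by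
        filter_upwards [hw] with y hy
        simpa [sub_eq_zero] using hy
      exact (L.hasDerivAt_weierstrassP hwl).unique
        ((hasDerivAt_const w a).congr_of_eventuallyEq this)
    obtain ⟨w, h1, h2⟩ := ((h1.filter_mono nhdsWithin_le_nhds).and
      (L.derivWeierstrassP_eventually_ne hu)).exists
    exact h2 h1
  · filter_upwards [h] with w hw
    simpa [sub_ne_zero] using hw

lemma tendsto_sq_mul_weierstrassP :
    Tendsto (fun z => z ^ 2 * L.weierstrassP z) (𝓝[≠] 0) (𝓝 1) := by
  have hE : ContinuousAt (fun z : ℂ => z ^ 2 * L.weierstrassPExcept 0 z + 1) 0 :=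
    ((continuousAt_id.pow 2).mul (L.analyticAt_weierstrassPExcept 0).continuousAt).add
      continuousAt_const
  have h1 := hE.tendsto.mono_left (nhdsWithin_le_nhds (s := {0}ᶜ))
  norm_num at h1
  refine h1.congr' ?_
  filter_upwards [self_mem_nhdsWithin] with z hz
  have hz : z ≠ 0 := hz
  rw [L.weierstrassP_eq_except_add]
  field_simp

/-- `℘` has a pole at the origin, so it eventually differs from any function continuous there. -/
lemma weierstrassP_eventually_ne_of_continuousAt {g : ℂ → ℂ} (hg : ContinuousAt g 0) :
    ∀ᶠ z in 𝓝[≠] (0 : ℂ), L.weierstrassP z ≠ g z := by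
  have h1 : Tendsto (fun z => z ^ 2 * g z) (𝓝[≠] 0) (𝓝 0) := by
    have h0 : ContinuousAt (fun z => z ^ 2 * g z) 0 := (continuousAt_id.pow 2).mul hg
    simpa using h0.tendsto.mono_left (nhdsWithin_le_nhds (s := {(0:ℂ)}ᶜ))
  have h2 := L.tendsto_sq_mul_weierstrassP.sub h1
  simp only [sub_zero] at h2
  filter_upwards [h2.eventually_ne one_ne_zero] with z hz h
  simp [h] at hz

namespace IsModel
variable {L}

theorem toPoint_add (h : L.IsModel V) (u v : ℂ) :
    h.toPoint (u + v) = h.toPoint u + h.toPoint v := by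
  by_cases hu : u ∈ L.lattice
  · rw [add_comm u, h.toPoint_add_of_mem v hu, h.toPoint_of_mem hu, zero_add]
  by_cases hv : v ∈ L.lattice
  · rw [h.toPoint_add_of_mem u hv, h.toPoint_of_mem hv, add_zero]
  by_cases huv : u + v ∈ L.lattice
  · have := h.toPoint_add_of_mem (-v) huv
    rw [neg_add_cancel_comm_assoc, h.toPoint_neg] at this
    rw [h.toPoint_of_mem huv, this, neg_add_cancel]
  by_cases hne : L.weierstrassP u ≠ L.weierstrassP v
  · exact h.toPoint_add_of_ne hu hv hne
  push Not at hne
  have c1 : ContinuousAt (fun e => L.weierstrassP (u + v - e)) 0 := by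
    refine ContinuousAt.comp (g := L.weierstrassP) ?_ (by fun_prop)
    simpa using (L.hasDerivAt_weierstrassP huv).continuousAt
  have hmap : Tendsto (fun e : ℂ => u - e) (𝓝[≠] 0) (𝓝[≠] u) := by
    refine tendsto_nhdsWithin_iff.2 ⟨?_, ?_⟩
    · have : ContinuousAt (fun e : ℂ => u - e) 0 := by fun_prop
      simpa using this.tendsto.mono_left nhdsWithin_le_nhds
    · filter_upwards [self_mem_nhdsWithin] with e he
      simpa using he
  have hmap2 : Tendsto (fun e : ℂ => u + v - e) (𝓝[≠] 0) (𝓝 (u + v)) := by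
    have : ContinuousAt (fun e : ℂ => u + v - e) 0 := by fun_prop
    simpa using this.tendsto.mono_left nhdsWithin_le_nhds
  obtain ⟨e, he1, he2, he3, he4, he5⟩ := ((L.eventually_notMem_lattice 0).and
    ((L.weierstrassP_eventually_ne_of_continuousAt c1).and
    ((hmap.eventually (L.weierstrassP_eventually_ne hu (L.weierstrassP u))).and
    ((hmap.eventually (L.eventually_notMem_lattice u)).and
    (hmap2.eventually (L.eventually_notMem_nhds huv)))))).exists
  have s1 := h.toPoint_add_of_ne he1 he5 he2
  have he4' : -(u - e) ∉ L.lattice := by rwa [neg_mem_iff]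
  have s2 := h.toPoint_add_of_ne hu he4' (by rw [L.weierstrassP_neg]; exact he3.symm)
  have s3 := h.toPoint_add_of_ne hv he4 (by rw [← hne]; exact he3.symm)
  rw [add_sub_cancel] at s1
  rw [neg_sub, add_sub_cancel] at s2
  rw [s1, s2, show u + v - e = v + (u - e) by ring, s3, ← neg_sub u e, h.toPoint_neg]
  abel

/-- The parametrization as a group homomorphism. -/
def hom (h : L.IsModel V) : ℂ →+ V.toAffine.Point where
  toFun := h.toPoint
  map_zero' := h.toPoint_of_mem (zero_mem _)
  map_add' := h.toPoint_add

lemma hom_apply (h : L.IsModel V) {u : ℂ} (hu : u ∉ L.lattice) :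
    h.hom u = .some _ _ (h.nonsingular hu) := dif_neg hu

lemma hom_eq_zero (h : L.IsModel V) {u : ℂ} : h.hom u = 0 ↔ u ∈ L.lattice := h.toPoint_eq_zero

end IsModel

theorem exists_weierstrassP_eq (a : ℂ) : ∃ u ∉ L.lattice, L.weierstrassP u = a := by
  by_contra! hcon
  obtain ⟨c, hc⟩ := L.eventually_eq_const_of_periodic (f := fun z => (L.weierstrassP z - a)⁻¹)
    (by
      intro z
      by_cases hz : z ∈ L.lattice
      · let E := L.weierstrassPExcept 0
        have aE : AnalyticAt ℂ E (z - z) := by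
          rw [sub_self]; exact L.analyticAt_weierstrassPExcept 0
        have aEz : AnalyticAt ℂ (fun w => E (w - z)) z :=
          aE.comp (f := fun w => w - z) (by fun_prop)
        refine ⟨fun w => (w - z) ^ 2 / (1 + (w - z) ^ 2 * (E (w - z) - a)), ?_, ?_⟩
        · exact AnalyticAt.div (by fun_prop) (by fun_prop) (by simp)
        · filter_upwards [self_mem_nhdsWithin] with w hw
          have hw : w - z ≠ 0 := sub_ne_zero.2 hw
          have h1 := L.weierstrassP_add_of_mem (w - z) hz
          rw [sub_add_cancel] at h1
          rw [h1, L.weierstrassP_eq_except_add, inv_eq_one_div, show L.weierstrassPExcept 0 (w - z) = E (w - z) from rfl]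
          rw [show E (w - z) + 1 / (w - z) ^ 2 - a =
            (1 + (w - z) ^ 2 * (E (w - z) - a)) / (w - z) ^ 2 by field_simp; ring]
          rw [one_div_div]
      · exact ⟨_, ((L.analyticOnNhd_weierstrassP z hz).sub analyticAt_const).inv
          (sub_ne_zero.2 (hcon z hz)), EventuallyEq.rfl⟩)
    (fun z l hl => by simp only [L.weierstrassP_add_of_mem z hl])
  obtain ⟨w, hw⟩ : ∃ w, w ∉ L.lattice := (L.eventually_notMem_lattice 0).exists
  obtain ⟨y, hy1, hy2, hy3⟩ := ((hc w).and ((L.weierstrassP_eventually_ne hw (c⁻¹ + a)).and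
    ((L.eventually_notMem_nhds hw).filter_mono nhdsWithin_le_nhds))).exists
  rw [← hy1] at hy2
  simp at hy2

theorem IsModel.exists_hom_eq {L : PeriodPair} (h : L.IsModel V) {x y : ℂ}
    (hxy : V.toAffine.Nonsingular x y) : ∃ u ∉ L.lattice, L.weierstrassP u = x ∧
      L.derivWeierstrassP u = 2 * y := by
  obtain ⟨u, hu, rfl⟩ := L.exists_weierstrassP_eq x
  have h1 := hxy.1
  rw [WeierstrassCurve.Affine.equation_iff, h.a₁, h.a₂, h.a₃, h.a₄, h.a₆] at h1
  have h2 := L.derivWeierstrassP_sq u hu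
  have h3 : (L.derivWeierstrassP u - 2 * y) * (L.derivWeierstrassP u + 2 * y) = 0 := by
    linear_combination h2 - 4 * h1
  rcases mul_eq_zero.1 h3 with h4 | h4
  · exact ⟨u, hu, rfl, sub_eq_zero.1 h4⟩
  · refine ⟨-u, by rwa [neg_mem_iff], L.weierstrassP_neg u, ?_⟩
    rw [L.derivWeierstrassP_neg]
    linear_combination -h4

end PeriodPair

lemma integrableOn_lemniscate :
    IntervalIntegrable (fun x : ℝ => (1 - x ^ 4) ^ (-(1:ℝ)/2)) MeasureTheory.volume 0 1 := by
  have h1 : IntervalIntegrable (fun x : ℝ => (1 - x) ^ (-(1:ℝ)/2)) MeasureTheory.volume 0 1 := by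
    have := (intervalIntegral.intervalIntegrable_rpow' (a := 1) (b := 0) (r := -(1:ℝ)/2)
      (by norm_num)).comp_sub_left 1
    simpa using this
  refine h1.mono_fun ?_ ?_
  · refine Measurable.aestronglyMeasurable ?_
    fun_prop
  · rw [Filter.EventuallyLE, MeasureTheory.ae_restrict_iff' measurableSet_uIoc]
    have h2 : ∀ᵐ x : ℝ, x ≠ 1 := MeasureTheory.Measure.ae_ne _ _
    filter_upwards [h2] with x hx1 hx
    rw [Set.uIoc_of_le zero_le_one] at hx
    have hx0 := hx.1
    have hx2 : x < 1 := lt_of_le_of_ne hx.2 hx1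
    have h4 : x ^ 4 ≤ x := by
      calc x ^ 4 ≤ x ^ 1 := pow_le_pow_of_le_one hx0.le hx2.le (by norm_num)
        _ = x := pow_one x
    rw [Real.norm_of_nonneg (Real.rpow_nonneg (by linarith) _),
      Real.norm_of_nonneg (Real.rpow_nonneg (by linarith) _)]
    exact Real.rpow_le_rpow_of_nonpos (by linarith) (by linarith) (by norm_num)

lemma varpi_pos : 0 < varpi := by
  refine mul_pos two_pos ?_
  refine intervalIntegral.intervalIntegral_pos_of_pos_on integrableOn_lemniscate ?_ one_pos
  intro x hx
  refine Real.rpow_pos_of_pos ?_ _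
  have : x ^ 4 < 1 := pow_lt_one₀ hx.1.le hx.2 (by norm_num)
  linarith

lemma varpi_ne_zero : (varpi : ℂ) ≠ 0 := by exact_mod_cast varpi_pos.ne'

/-- The square lattice `ϖ·ℤ[i]`. -/
def lemn : PeriodPair where
  ω₁ := varpi
  ω₂ := varpi * I
  indep := by
    rw [LinearIndependent.pair_iff]
    intro s t h
    have h1 := congrArg Complex.re h
    have h2 := congrArg Complex.im h
    simp [varpi_pos.ne'] at h1 h2
    exact ⟨h1, h2⟩

lemma mem_lemn {z : ℂ} : z ∈ lemn.lattice ↔ ∃ a b : ℤ, z = varpi * (a + b * I) := by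
  rw [PeriodPair.mem_lattice]
  constructor
  · rintro ⟨a, b, h⟩
    exact ⟨a, b, by rw [← h]; simp only [lemn]; ring⟩
  · rintro ⟨a, b, h⟩
    exact ⟨a, b, by rw [h]; simp only [lemn]; ring⟩

lemma I_mul_mem_lemn {z : ℂ} (h : z ∈ lemn.lattice) : I * z ∈ lemn.lattice := by
  obtain ⟨a, b, rfl⟩ := mem_lemn.1 h
  refine mem_lemn.2 ⟨-b, a, ?_⟩
  push_cast
  linear_combination (varpi * b : ℂ) * I_sq

lemma I_mul_mem_lemn_iff {z : ℂ} : I * z ∈ lemn.lattice ↔ z ∈ lemn.lattice := by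
  refine ⟨fun h => ?_, I_mul_mem_lemn⟩
  have := neg_mem (I_mul_mem_lemn h)
  rwa [← mul_assoc, I_mul_I, neg_one_mul, neg_neg] at this

lemma conj_mem_lemn {z : ℂ} (h : z ∈ lemn.lattice) : (starRingEnd ℂ) z ∈ lemn.lattice := by
  obtain ⟨a, b, rfl⟩ := mem_lemn.1 h
  refine mem_lemn.2 ⟨a, -b, ?_⟩
  simp

/-- Multiplication by `i` on the lattice. -/
def lemnMulI : lemn.lattice ≃ lemn.lattice where
  toFun l := ⟨I * l, I_mul_mem_lemn l.2⟩
  invFun l := ⟨-(I * l), neg_mem (I_mul_mem_lemn l.2)⟩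
  left_inv l := by ext; simp [← mul_assoc]
  right_inv l := by ext; simp [← mul_assoc]

/-- Complex conjugation on the lattice. -/
def lemnConj : lemn.lattice ≃ lemn.lattice where
  toFun l := ⟨(starRingEnd ℂ) l, conj_mem_lemn l.2⟩
  invFun l := ⟨(starRingEnd ℂ) l, conj_mem_lemn l.2⟩
  left_inv l := by ext; simp
  right_inv l := by ext; simp

/-- The Weierstrass function of `ϖ·ℤ[i]`. -/
abbrev lemP : ℂ → ℂ := lemn.weierstrassP
/-- The derivative of the Weierstrass function of `ϖ·ℤ[i]`. -/
abbrev lemP' : ℂ → ℂ := lemn.derivWeierstrassP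

lemma latticeEquivProd_symm_lemn (m : ℤ × ℤ) : ((lemn.latticeEquivProd.symm m : lemn.lattice) : ℂ) = ω4 m := by
  rw [PeriodPair.latticeEquiv_symm_apply, ω4]
  simp only [lemn]; ring

lemma ω4_eq_zero {m : ℤ × ℤ} : ω4 m = 0 ↔ m = 0 := by
  rw [← latticeEquivProd_symm_lemn]
  simp

lemma tsum_lemn (f : ℂ → ℂ) : ∑' l : lemn.lattice, f l = ∑' m : ℤ × ℤ, f (ω4 m) := by
  rw [← lemn.latticeEquivProd.symm.toEquiv.tsum_eq]
  refine tsum_congr fun m => ?_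
  rw [← latticeEquivProd_symm_lemn]
  rfl

lemma wp4_eq (u : ℂ) : wp4 u = lemP u := by
  rw [lemP, PeriodPair.weierstrassP_eq_except_add, PeriodPair.weierstrassPExcept, wp4]
  have := tsum_lemn fun l => if l = 0 then 0 else (1 / (u - l) ^ 2 - 1 / l ^ 2)
  rw [this]
  simp only [ω4_eq_zero, one_div]
  ring

lemma wp4'_eq (u : ℂ) : wp4' u = lemP' u := by
  rw [lemP', PeriodPair.derivWeierstrassP, wp4', ← tsum_neg]
  have := tsum_lemn fun l => -(2 / (u - l) ^ 3)
  rw [this]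
  refine tsum_congr fun m => ?_
  ring

lemma lemP_I_mul (z : ℂ) : lemP (I * z) = -lemP z := by
  rw [lemP, PeriodPair.weierstrassP, ← lemnMulI.tsum_eq, PeriodPair.weierstrassP, ← tsum_neg]
  refine tsum_congr fun l => ?_
  simp only [lemnMulI, Equiv.coe_fn_mk]
  rw [← mul_sub, mul_pow, mul_pow, I_sq]
  simp only [one_div, neg_one_mul, inv_neg]
  ring

lemma lemP'_I_mul (z : ℂ) : lemP' (I * z) = I * lemP' z := by
  rw [lemP', PeriodPair.derivWeierstrassP, ← lemnMulI.tsum_eq, PeriodPair.derivWeierstrassP,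
    mul_neg, ← tsum_mul_left]
  congr 1
  refine tsum_congr fun l => ?_
  simp only [lemnMulI, Equiv.coe_fn_mk]
  rw [← mul_sub, mul_pow, I_pow_three]
  simp only [div_eq_mul_inv, mul_inv, inv_neg, inv_I]
  ring

lemma lemP_conj (z : ℂ) : lemP ((starRingEnd ℂ) z) = (starRingEnd ℂ) (lemP z) := by
  rw [lemP, PeriodPair.weierstrassP, ← lemnConj.tsum_eq, PeriodPair.weierstrassP,
    Complex.conj_tsum]
  refine tsum_congr fun l => ?_
  simp [lemnConj]

lemma lemP'_conj (z : ℂ) : lemP' ((starRingEnd ℂ) z) = (starRingEnd ℂ) (lemP' z) := by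
  rw [lemP', PeriodPair.derivWeierstrassP, ← lemnConj.tsum_eq, PeriodPair.derivWeierstrassP,
    map_neg, Complex.conj_tsum]
  congr 1
  refine tsum_congr fun l => ?_
  simp only [lemnConj, Equiv.coe_fn_mk, map_div₀, map_pow, map_sub, map_ofNat]

lemma lemn_g₃ : lemn.g₃ = 0 := by
  have h : lemn.G 6 = -lemn.G 6 := by
    conv_lhs => rw [PeriodPair.G, ← lemnMulI.tsum_eq]
    rw [PeriodPair.G, ← tsum_neg]
    refine tsum_congr fun l => ?_
    simp only [lemnMulI, Equiv.coe_fn_mk]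
    rw [mul_pow, show I ^ 6 = -1 by rw [show (6:ℕ) = 2 * 3 by rfl, pow_mul, I_sq]; norm_num]
    rw [neg_one_mul, inv_neg]
  have : lemn.G 6 = 0 := by linear_combination (1/2) * h
  rw [PeriodPair.g₃, this, mul_zero]

/-- The half period `ϖ(1+i)/2`. -/
def lemH : ℂ := varpi * (1 + I) / 2

lemma int_of_half {a b : ℤ} {x y : ℝ} (h : (varpi : ℂ) * (x + y * I) = varpi * (a + b * I)) :
    x = a ∧ y = b := by
  have h := mul_left_cancel₀ varpi_ne_zero h
  have h1 := congrArg Complex.re h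
  have h2 := congrArg Complex.im h
  simp at h1 h2
  exact ⟨h1, h2⟩

lemma mem_lemn_real {x y : ℝ} : (varpi : ℂ) * (x + y * I) ∈ lemn.lattice ↔
    ∃ a b : ℤ, x = a ∧ y = b := by
  rw [mem_lemn]
  constructor
  · rintro ⟨a, b, h⟩; exact ⟨a, b, int_of_half h⟩
  · rintro ⟨a, b, rfl, rfl⟩; exact ⟨a, b, by simp⟩

lemma half_ne_int (a : ℤ) : (1/2 : ℝ) ≠ a := by
  intro h
  have : (1:ℝ) = 2 * a := by linarith
  norm_cast at this
  omega

lemma lemH_notMem : lemH ∉ lemn.lattice := by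
  rw [show lemH = varpi * (((1/2 : ℝ) : ℂ) + ((1/2 : ℝ) : ℂ) * I) by simp [lemH]; ring,
    mem_lemn_real]
  rintro ⟨a, b, h, -⟩
  exact half_ne_int a h

lemma half_notMem : (varpi / 2 : ℂ) ∉ lemn.lattice := by
  rw [show (varpi / 2 : ℂ) = varpi * (((1/2 : ℝ) : ℂ) + ((0 : ℝ) : ℂ) * I) by simp; ring,
    mem_lemn_real]
  rintro ⟨a, b, h, -⟩
  exact half_ne_int a h

lemma lemP_lemH : lemP lemH = 0 := by
  have h1 := lemP_I_mul lemH
  have h2 : I * lemH + lemH ∈ lemn.lattice := mem_lemn.2 ⟨0, 1, by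
    simp only [lemH]; push_cast; linear_combination (varpi/2 : ℂ) * I_sq⟩
  have h3 := lemn.weierstrassP_sub_of_mem h2
  linear_combination (1/2) * (h1 - h3)

lemma lemP'_lemH : lemP' lemH = 0 := by
  have h := lemn.derivWeierstrassP_sub_of_mem (u := lemH) (v := lemH)
    (mem_lemn.2 ⟨1, 1, by simp only [lemH]; push_cast; ring⟩)
  linear_combination (1/2) * h

lemma lemP'_half : lemP' (varpi / 2) = 0 := by
  have h := lemn.derivWeierstrassP_sub_of_mem (u := varpi / 2) (v := varpi / 2)
    (mem_lemn.2 ⟨1, 0, by push_cast; ring⟩)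
  linear_combination (1/2) * h

open Filter Topology in
lemma lemP_half_ne_zero : lemP (varpi / 2) ≠ 0 := by
  intro h0
  have hd : (varpi / 2 - lemH : ℂ) ∉ lemn.lattice := by
    rw [show (varpi / 2 - lemH : ℂ) = -(I * (varpi / 2)) by simp only [lemH]; ring, neg_mem_iff,
      I_mul_mem_lemn_iff]
    exact half_notMem
  have hH : -lemH ∉ lemn.lattice := by rw [neg_mem_iff]; exact lemH_notMem
  have c1 : ContinuousAt (fun e => lemP (e + (varpi / 2 - lemH))) 0 := by
    refine ContinuousAt.comp (g := lemP) ?_ (by fun_prop)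
    simpa using (lemn.hasDerivAt_weierstrassP hd).continuousAt
  have hmap0 : ∀ a : ℂ, Tendsto (fun e : ℂ => e + a) (𝓝[≠] 0) (𝓝 a) := fun a => by
    have : ContinuousAt (fun e : ℂ => e + a) 0 := by fun_prop
    simpa using this.tendsto.mono_left nhdsWithin_le_nhds
  have hmap : Tendsto (fun e : ℂ => e + -lemH) (𝓝[≠] 0) (𝓝[≠] (-lemH)) := by
    refine tendsto_nhdsWithin_iff.2 ⟨hmap0 _, ?_⟩
    filter_upwards [self_mem_nhdsWithin] with e he
    simpa using he
  obtain ⟨e, h1, h2, h3, h4, h5⟩ := ((lemn.eventually_notMem_lattice 0).and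
    ((lemn.weierstrassP_eventually_ne_of_continuousAt c1).and
    ((hmap.eventually (lemn.weierstrassP_eventually_ne hH 0)).and
    (((hmap0 _).eventually (lemn.eventually_notMem_nhds hH)).and
    ((hmap0 _).eventually (lemn.eventually_notMem_nhds hd)))))).exists
  have s1 := lemn.weierstrassP_add_formula_sub h1 h4 (by simpa using lemH_notMem)
  have s2 := lemn.weierstrassP_add_formula_sub h5 h4
    (by rw [show e + (varpi / 2 - lemH : ℂ) - (e + -lemH) = varpi / 2 by ring]
        exact half_notMem)
  rw [show e - (e + -lemH) = lemH by ring, show lemn.weierstrassP lemH = 0 from lemP_lemH,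
    show lemn.derivWeierstrassP lemH = 0 from lemP'_lemH] at s1
  rw [show e + (varpi / 2 - lemH : ℂ) - (e + -lemH) = varpi / 2 by ring,
    show lemn.weierstrassP (varpi / 2) = 0 from h0,
    show lemn.derivWeierstrassP (varpi / 2) = 0 from lemP'_half, ← s1] at s2
  refine h2 ?_
  have h6 : lemn.weierstrassP (e + -lemH) ^ 2 ≠ 0 := pow_ne_zero _ h3
  refine mul_right_cancel₀ h6 ?_
  linear_combination (-1/4) * s2

lemma lemn_g₂_eq : lemn.g₂ = 4 * lemP (varpi / 2) ^ 2 := by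
  have h := lemn.derivWeierstrassP_sq _ half_notMem
  rw [show lemn.derivWeierstrassP (varpi / 2) = 0 from lemP'_half, lemn_g₃] at h
  refine mul_right_cancel₀ lemP_half_ne_zero ?_
  linear_combination h

/-- The curve parametrized by `℘` and `℘′/2`, before normalization. -/
def lemnCurve : WeierstrassCurve ℂ := ⟨0, 0, 0, -lemn.g₂ / 4, -lemn.g₃ / 4⟩

lemma lemnCurve_isModel : lemn.IsModel lemnCurve where
  a₁ := rfl
  a₂ := rfl
  a₃ := rfl
  a₄ := rfl
  a₆ := rfl
  Δ := by
    simp only [WeierstrassCurve.Δ, WeierstrassCurve.b₂, WeierstrassCurve.b₄, WeierstrassCurve.b₆,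
      WeierstrassCurve.b₈, lemnCurve, lemn_g₃, lemn_g₂_eq]
    have := lemP_half_ne_zero
    generalize lemP (varpi / 2) = e at *
    ring_nf
    exact mul_ne_zero (pow_ne_zero _ this) (by norm_num)

lemma two_mul_mem_of_lemP'_eq_zero {u : ℂ} (hu : u ∉ lemn.lattice) (h : lemP' u = 0) :
    2 * u ∈ lemn.lattice := by
  rw [← lemnCurve_isModel.hom_eq_zero, two_mul, map_add, lemnCurve_isModel.hom_apply hu]
  have hv : -u ∉ lemn.lattice := by rwa [neg_mem_iff]
  have h2 : lemnCurve_isModel.hom (-u) = lemnCurve_isModel.hom u := by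
    rw [lemnCurve_isModel.hom_apply hu, lemnCurve_isModel.hom_apply hv]
    simp only [WeierstrassCurve.Affine.Point.some.injEq]
    rw [lemn.weierstrassP_neg, lemn.derivWeierstrassP_neg,
      show lemn.derivWeierstrassP u = 0 from h]
    simp
  rw [← lemnCurve_isModel.hom_apply hu]
  nth_rewrite 2 [← h2]
  rw [map_neg, add_neg_cancel]

/-- `℘` on the real axis. -/
def lemq (s : ℝ) : ℝ := (lemP s).re
/-- `℘′` on the real axis. -/
def lemr (s : ℝ) : ℝ := (lemP' s).re

lemma lemq_coe (s : ℝ) : (lemq s : ℂ) = lemP s := by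
  have := lemP_conj (s : ℂ)
  rw [conj_ofReal] at this
  exact conj_eq_iff_re.1 this.symm

lemma lemr_coe (s : ℝ) : (lemr s : ℂ) = lemP' s := by
  have := lemP'_conj (s : ℂ)
  rw [conj_ofReal] at this
  exact conj_eq_iff_re.1 this.symm

lemma ofReal_notMem {s : ℝ} (h0 : 0 < s) (h1 : s < varpi) : (s : ℂ) ∉ lemn.lattice := by
  have hv := varpi_pos
  rw [show (s : ℂ) = varpi * (((s / varpi : ℝ) : ℂ) + ((0 : ℝ) : ℂ) * I) by
    push_cast; rw [zero_mul, add_zero, mul_div_cancel₀ _ varpi_ne_zero], mem_lemn_real]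
  rintro ⟨a, b, h, -⟩
  have h2 : 0 < s / varpi := by positivity
  have h3 : s / varpi < 1 := by rwa [div_lt_one hv]
  rw [h] at h2 h3
  norm_cast at h2 h3
  omega

lemma hasDerivAt_lemq {s : ℝ} (h0 : 0 < s) (h1 : s < varpi) : HasDerivAt lemq (lemr s) s :=
  HasDerivAt.real_of_complex (lemn.hasDerivAt_weierstrassP (ofReal_notMem h0 h1))

lemma continuousAt_lemr {s : ℝ} (h0 : 0 < s) (h1 : s < varpi) : ContinuousAt lemr s := by
  have h2 := lemn.hasDerivAt_derivWeierstrassP (ofReal_notMem h0 h1)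
  exact (HasDerivAt.real_of_complex h2).continuousAt

lemma lemr_sq {s : ℝ} (h0 : 0 < s) (h1 : s < varpi) :
    lemr s ^ 2 = 4 * lemq s * (lemq s ^ 2 - lemq (varpi / 2) ^ 2) := by
  have h := lemn.derivWeierstrassP_sq _ (ofReal_notMem h0 h1)
  have e : ((lemq (varpi / 2) : ℝ) : ℂ) = lemP (varpi / 2) := by
    rw [lemq_coe]; push_cast; rfl
  rw [lemn_g₃, lemn_g₂_eq, ← e, show lemn.derivWeierstrassP s = lemr s from (lemr_coe s).symm,
    show lemn.weierstrassP s = lemq s from (lemq_coe s).symm] at h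
  have : ((lemr s ^ 2 : ℝ) : ℂ) =
      ((4 * lemq s * (lemq s ^ 2 - lemq (varpi / 2) ^ 2) : ℝ) : ℂ) := by
    push_cast
    linear_combination h
  exact_mod_cast this

lemma lemr_ne_zero {s : ℝ} (h0 : 0 < s) (h1 : s < varpi / 2) : lemr s ≠ 0 := by
  intro h
  have hs := ofReal_notMem h0 (by linarith [varpi_pos])
  have h2 := two_mul_mem_of_lemP'_eq_zero hs (by rw [← lemr_coe, h]; simp)
  have h3 := ofReal_notMem (s := 2 * s) (by linarith) (by linarith)
  push_cast at h3
  exact h3 h2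

open Filter Topology

lemma tendsto_sq_mul_lemq : Tendsto (fun s => s ^ 2 * lemq s) (𝓝[>] 0) (𝓝 1) := by
  have hm : Tendsto (fun s : ℝ => (s : ℂ)) (𝓝[>] 0) (𝓝[≠] 0) := by
    refine tendsto_nhdsWithin_iff.2 ⟨?_, ?_⟩
    · simpa using (continuous_ofReal.tendsto (0:ℝ)).mono_left nhdsWithin_le_nhds
    · filter_upwards [self_mem_nhdsWithin] with s hs
      have hs : 0 < s := hs
      simpa using hs.ne'
  have h := (continuous_re.tendsto (1:ℂ)).comp (lemn.tendsto_sq_mul_weierstrassP.comp hm)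
  rw [one_re] at h
  refine h.congr fun s => ?_
  simp only [Function.comp]
  rw [show lemn.weierstrassP (s : ℂ) = (lemq s : ℂ) from (lemq_coe s).symm]
  norm_cast

lemma tendsto_lemq_zero : Tendsto lemq (𝓝[>] 0) atTop := by
  have h1 : Tendsto (fun s : ℝ => (s ^ 2)⁻¹) (𝓝[>] 0) atTop := by
    refine tendsto_inv_nhdsGT_zero.comp ?_
    refine tendsto_nhdsWithin_iff.2 ⟨?_, ?_⟩
    · have : ContinuousAt (fun s : ℝ => s ^ 2) 0 := by fun_prop
      simpa using this.tendsto.mono_left nhdsWithin_le_nhds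
    · filter_upwards [self_mem_nhdsWithin] with s hs
      have hs : 0 < s := hs
      exact Set.mem_Ioi.2 (by positivity)
  refine (h1.atTop_mul_pos one_pos tendsto_sq_mul_lemq).congr' ?_
  filter_upwards [self_mem_nhdsWithin] with s hs
  have hs : 0 < s := hs
  field_simp

lemma lemr_neg {s : ℝ} (h0 : 0 < s) (h1 : s < varpi / 2) : lemr s < 0 := by
  by_contra hcon
  have hv := varpi_pos
  have hpos : ∀ t ∈ Set.Ioo 0 (varpi / 2), 0 < lemr t := by
    intro t ht
    by_contra hn
    have hc : ContinuousOn lemr (Set.Ioo 0 (varpi / 2)) := fun x hx =>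
      (continuousAt_lemr hx.1 (by linarith [hx.2])).continuousWithinAt
    obtain ⟨x, hx, hx0⟩ := isPreconnected_Ioo.intermediate_value ht ⟨h0, h1⟩ hc
      ⟨not_lt.1 hn, not_lt.1 hcon⟩
    exact lemr_ne_zero hx.1 hx.2 hx0
  have hmono : StrictMonoOn lemq (Set.Ioo 0 (varpi / 2)) := by
    refine strictMonoOn_of_hasDerivWithinAt_pos (f' := lemr) (convex_Ioo _ _)
      (fun x hx => (hasDerivAt_lemq hx.1 (by linarith [hx.2])).continuousAt.continuousWithinAt)
      ?_ ?_
    · intro x hx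
      rw [interior_Ioo] at hx
      exact (hasDerivAt_lemq hx.1 (by linarith [hx.2])).hasDerivWithinAt
    · intro x hx
      rw [interior_Ioo] at hx
      exact hpos x hx
  obtain ⟨t, ht1, ht2, ht3⟩ := ((tendsto_lemq_zero.eventually_gt_atTop (lemq s)).and
    ((Ioo_mem_nhdsGT h0))).exists
  have := hmono ⟨ht2, by linarith⟩ ⟨h0, h1⟩ ht3
  linarith

lemma lemq_strictAntiOn : StrictAntiOn lemq (Set.Ioc 0 (varpi / 2)) := by
  have hv := varpi_pos
  refine strictAntiOn_of_hasDerivWithinAt_neg (f' := lemr) (convex_Ioc _ _)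
    (fun x hx => (hasDerivAt_lemq hx.1 (by linarith [hx.2])).continuousAt.continuousWithinAt)
    ?_ ?_
  · intro x hx
    rw [interior_Ioc] at hx
    exact (hasDerivAt_lemq hx.1 (by linarith [hx.2])).hasDerivWithinAt
  · intro x hx
    rw [interior_Ioc] at hx
    exact lemr_neg hx.1 hx.2

lemma lemq_half_lt {s : ℝ} (h0 : 0 < s) (h1 : s < varpi / 2) : lemq (varpi / 2) < lemq s :=
  lemq_strictAntiOn ⟨h0, h1.le⟩ ⟨by linarith, le_rfl⟩ h1

lemma lemq_half_pos : 0 < lemq (varpi / 2) := by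
  have hv := varpi_pos
  have hne : lemq (varpi / 2) ≠ 0 := by
    intro h
    refine lemP_half_ne_zero ?_
    have := lemq_coe (varpi / 2)
    rw [h] at this
    push_cast at this
    exact this.symm
  by_contra hcon
  have hneg : lemq (varpi / 2) < 0 := lt_of_le_of_ne (not_lt.1 hcon) hne
  obtain ⟨t, ht1, ht2, ht3⟩ := ((tendsto_lemq_zero.eventually_gt_atTop 0).and
    ((Ioo_mem_nhdsGT (show (0:ℝ) < varpi / 2 by linarith)))).exists
  have hc : ContinuousOn lemq (Set.Icc t (varpi / 2)) := fun x hx =>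
    (hasDerivAt_lemq (by linarith [hx.1]) (by linarith [hx.2])).continuousAt.continuousWithinAt
  obtain ⟨x, hx, hx0⟩ := intermediate_value_Icc' ht3.le hc ⟨hneg.le, ht1.le⟩
  have hx2 : x < varpi / 2 := lt_of_le_of_ne hx.2 (by rintro rfl; exact hne hx0)
  have := lemr_sq (by linarith [hx.1] : 0 < x) (by linarith)
  rw [hx0] at this
  simp at this
  exact lemr_ne_zero (by linarith [hx.1]) hx2 this

open Filter Topology

/-- The real function `√(℘(ϖ/2)/℘(s))`, which turns out to be the lemniscatic sine. -/
def lemy (s : ℝ) : ℝ := √(lemq (varpi / 2)) * (√(lemq s))⁻¹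

lemma lemy_zero : lemy 0 = 0 := by
  have h : lemq 0 = 0 := by
    rw [lemq, ofReal_zero, lemP, PeriodPair.weierstrassP_eq_except_add]
    have := lemn.weierstrassPExcept_zero 0
    simp [this]
  simp [lemy, h]

lemma lemy_half : lemy (varpi / 2) = 1 :=
  mul_inv_cancel₀ (Real.sqrt_pos.2 lemq_half_pos).ne'

lemma lemq_pos {s : ℝ} (h0 : 0 < s) (h1 : s ≤ varpi / 2) : 0 < lemq s := by
  rcases h1.lt_or_eq with h | rfl
  · exact lemq_half_pos.trans (lemq_half_lt h0 h)
  · exact lemq_half_pos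

lemma lemy_pos {s : ℝ} (h0 : 0 < s) (h1 : s ≤ varpi / 2) : 0 < lemy s :=
  mul_pos (Real.sqrt_pos.2 lemq_half_pos) (inv_pos.2 (Real.sqrt_pos.2 (lemq_pos h0 h1)))

lemma lemy_lt_one {s : ℝ} (h0 : 0 < s) (h1 : s < varpi / 2) : lemy s < 1 := by
  rw [lemy, ← div_eq_mul_inv, div_lt_one (Real.sqrt_pos.2 (lemq_pos h0 h1.le))]
  exact Real.sqrt_lt_sqrt lemq_half_pos.le (lemq_half_lt h0 h1)

lemma lemy_mem_Icc {s : ℝ} (hs : s ∈ Set.Icc 0 (varpi / 2)) : lemy s ∈ Set.Icc (0:ℝ) 1 := by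
  rcases hs.1.eq_or_lt with rfl | h0
  · simp [lemy_zero]
  rcases hs.2.eq_or_lt with rfl | h1
  · simp [lemy_half]
  · exact ⟨(lemy_pos h0 h1.le).le, (lemy_lt_one h0 h1).le⟩

lemma hasDerivAt_lemy {s : ℝ} (h0 : 0 < s) (h1 : s ≤ varpi / 2) :
    HasDerivAt lemy (√(lemq (varpi / 2)) * (-(lemr s / (2 * √(lemq s))) / √(lemq s) ^ 2)) s := by
  have hq := lemq_pos h0 h1
  exact (((hasDerivAt_lemq h0 (by linarith [varpi_pos])).sqrt hq.ne').fun_inv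
    (Real.sqrt_pos.2 hq).ne').const_mul _

lemma continuousOn_lemy : ContinuousOn lemy (Set.Icc 0 (varpi / 2)) := by
  intro s hs
  rcases hs.1.eq_or_lt with rfl | h0
  · have h1 : Tendsto lemy (𝓝[>] 0) (𝓝 0) := by
      have := (Real.tendsto_sqrt_atTop.comp tendsto_lemq_zero).inv_tendsto_atTop.const_mul
        (√(lemq (varpi / 2)))
      rw [mul_zero] at this
      exact this
    have h2 : ContinuousWithinAt lemy (Set.Ioi 0) 0 := by
      rw [ContinuousWithinAt, lemy_zero]; exact h1
    exact (continuousWithinAt_Ioi_iff_Ici.1 h2).mono Set.Icc_subset_Ici_self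
  · exact (hasDerivAt_lemy h0 hs.2).continuousAt.continuousWithinAt

lemma lemr_eq {s : ℝ} (h0 : 0 < s) (h1 : s < varpi / 2) :
    lemr s = -(2 * √(lemq s) ^ 3 * √(1 - lemy s ^ 4)) := by
  have hq := lemq_pos h0 h1.le
  have hm := Real.sqrt_pos.2 hq
  have hy : lemy s ^ 4 * lemq s ^ 2 = lemq (varpi / 2) ^ 2 := by
    have e1 := Real.sq_sqrt hq.le
    have e2 := Real.sq_sqrt lemq_half_pos.le
    rw [lemy]
    nth_rewrite 2 [← e1]
    nth_rewrite 2 [← e2]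
    field_simp
  have hw : 0 ≤ 1 - lemy s ^ 4 := by
    have := pow_lt_one₀ (lemy_pos h0 h1.le).le (lemy_lt_one h0 h1) (by norm_num : 4 ≠ 0)
    linarith
  have hsq : (-lemr s) ^ 2 = (2 * √(lemq s) ^ 3 * √(1 - lemy s ^ 4)) ^ 2 := by
    rw [neg_sq, lemr_sq h0 (by linarith [varpi_pos]), mul_pow, mul_pow, Real.sq_sqrt hw, ← hy]
    rw [show (√(lemq s) ^ 3) ^ 2 = (√(lemq s) ^ 2) ^ 3 by ring, Real.sq_sqrt hq.le]
    ring
  have := (sq_eq_sq₀ (by linarith [lemr_neg h0 h1]) (by positivity)).1 hsq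
  linarith

lemma lemq_half : lemq (varpi / 2) = 1 := by
  have hv := varpi_pos
  let f : ℝ → ℝ := fun x => (1 - x ^ 4) ^ (-(1:ℝ)/2)
  let F : ℝ → ℝ := fun y => ∫ x in (0:ℝ)..y, f x
  have hFc : ContinuousOn F (Set.Icc 0 1) := by
    have := intervalIntegral.continuousOn_primitive_interval' integrableOn_lemniscate
      (Set.left_mem_uIcc)
    rwa [Set.uIcc_of_le zero_le_one] at this
  have hFd : ∀ y, 0 < y → y < 1 → HasDerivAt F (√(1 - y ^ 4))⁻¹ y := by
    intro y h0 h1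
    have hpos : 0 < 1 - y ^ 4 := by
      have := pow_lt_one₀ h0.le h1 (by norm_num : 4 ≠ 0)
      linarith
    have hfc : ContinuousAt f y := by
      refine ContinuousAt.rpow_const (by fun_prop) (Or.inl hpos.ne')
    have hm : Measurable f := by fun_prop
    have := intervalIntegral.integral_hasDerivAt_right (a := 0) (b := y) (f := f)
      (integrableOn_lemniscate.mono_set (by
        rw [Set.uIcc_of_le zero_le_one, Set.uIcc_of_le h0.le]
        exact Set.Icc_subset_Icc_right h1.le))
      (hm.stronglyMeasurable.stronglyMeasurableAtFilter) hfc
    refine HasDerivAt.congr_deriv this ?_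
    change (1 - y ^ 4) ^ (-(1:ℝ)/2) = _
    rw [neg_div, Real.rpow_neg hpos.le, Real.sqrt_eq_rpow]
  let Gf : ℝ → ℝ := fun s => F (lemy s) - √(lemq (varpi / 2)) * s
  have hGc : ContinuousOn Gf (Set.Icc 0 (varpi / 2)) :=
    (hFc.comp continuousOn_lemy fun s hs => lemy_mem_Icc hs).sub (by fun_prop)
  have hGd : ∀ s ∈ Set.Ioo 0 (varpi / 2), HasDerivAt Gf 0 s := by
    intro s hs
    have hy0 := lemy_pos hs.1 hs.2.le
    have hy1 := lemy_lt_one hs.1 hs.2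
    have hq := lemq_pos hs.1 hs.2.le
    have hm := Real.sqrt_pos.2 hq
    have hpos : 0 < √(1 - lemy s ^ 4) := by
      have := pow_lt_one₀ hy0.le hy1 (by norm_num : 4 ≠ 0)
      exact Real.sqrt_pos.2 (by linarith)
    have := ((hFd _ hy0 hy1).comp s (hasDerivAt_lemy hs.1 hs.2.le)).sub
      ((hasDerivAt_id s).const_mul (√(lemq (varpi / 2))))
    refine HasDerivAt.congr_deriv this ?_
    rw [lemr_eq hs.1 hs.2]
    field_simp
    ring
  obtain ⟨c, hc, hcd⟩ := exists_hasDerivAt_eq_slope Gf (fun _ => 0) (by linarith : (0:ℝ) < varpi / 2)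
    hGc hGd
  have hG : Gf (varpi / 2) = Gf 0 := by
    rw [eq_comm, div_eq_zero_iff] at hcd
    rcases hcd with h | h <;> linarith
  have hF1 : F 1 = varpi / 2 := by
    rw [varpi]; simp only [F, f]; ring
  have hF0 : F 0 = 0 := by simp [F]
  simp only [Gf, lemy_half, lemy_zero, hF1, hF0] at hG
  have h1 : √(lemq (varpi / 2)) = 1 := by
    have : varpi / 2 * (√(lemq (varpi / 2)) - 1) = 0 := by linarith
    rcases mul_eq_zero.1 this with h | h <;> linarith
  rw [← Real.sq_sqrt lemq_half_pos.le, h1]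
  norm_num

lemma lemP_half : lemP (varpi / 2) = 1 := by
  have := lemq_coe (varpi / 2)
  rw [lemq_half] at this
  push_cast at this
  exact this.symm

lemma lemn_g₂ : lemn.g₂ = 4 := by
  rw [lemn_g₂_eq, lemP_half]; norm_num

lemma lemP'_sq {z : ℂ} (hz : z ∉ lemn.lattice) : lemP' z ^ 2 = 4 * lemP z ^ 3 - 4 * lemP z := by
  have := lemn.derivWeierstrassP_sq z hz
  rw [lemn_g₂, lemn_g₃] at this
  simpa using this

namespace PeriodPair

variable (L : PeriodPair)

lemma weierstrassZeta_bound (r : ℝ) (hr : 0 < r) (s : ℂ) (hs : ‖s‖ < r) (l : ℂ) (h : 2 * r ≤ ‖l‖) :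
    ‖(s - l)⁻¹ + l⁻¹ + s * (l ^ 2)⁻¹‖ ≤ 2 * r ^ 2 * ‖l‖ ^ (-3 : ℝ) := by
  have h1 : 0 < ‖l‖ := by linarith
  have h2 : ‖l‖ / 2 ≤ ‖s - l‖ := by
    rw [norm_sub_rev]
    exact .trans (by linarith) (norm_sub_norm_le l s)
  have hl : l ≠ 0 := norm_pos_iff.1 h1
  have hsl : s - l ≠ 0 := norm_pos_iff.1 (by linarith)
  have e : (s - l)⁻¹ + l⁻¹ + s * (l ^ 2)⁻¹ = s ^ 2 / (l ^ 2 * (s - l)) := by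
    field_simp; ring
  rw [e, norm_div, norm_mul, norm_pow, norm_pow]
  calc ‖s‖ ^ 2 / (‖l‖ ^ 2 * ‖s - l‖) ≤ r ^ 2 / (‖l‖ ^ 2 * (‖l‖ / 2)) := by gcongr
    _ = 2 * r ^ 2 / ‖l‖ ^ 3 := by field
    _ = _ := by norm_cast

/-- The Weierstrass `ζ`-function with its pole at the origin removed. -/
def weierstrassZetaExcept (z : ℂ) : ℂ :=
  ∑' l : L.lattice, if l = 0 then 0 else ((z - l)⁻¹ + (l : ℂ)⁻¹ + z * ((l : ℂ) ^ 2)⁻¹)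

lemma hasSum_weierstrassZetaExcept (z : ℂ) :
    HasSum (fun l : L.lattice =>
      if l = 0 then 0 else ((z - l)⁻¹ + (l : ℂ)⁻¹ + z * ((l : ℂ) ^ 2)⁻¹))
      (L.weierstrassZetaExcept z) := by
  refine (L.hasSumLocallyUniformly_aux
    (f := fun l z => if l = 0 then 0 else ((z - l)⁻¹ + (l : ℂ)⁻¹ + z * ((l : ℂ) ^ 2)⁻¹))
    (u := (2 * · ^ 2 * ‖·‖ ^ (-3 : ℝ)))
    (fun _ _ ↦ (ZLattice.summable_norm_rpow _ _ (by simp; norm_num)).mul_left _) fun r hr ↦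
    Filter.eventually_atTop.mpr ⟨2 * r, ?_⟩).hasSum
  rintro _ h s hs l rfl
  split_ifs
  · simpa using! show 0 ≤ 2 * r ^ 2 * (‖(l : ℂ)‖ ^ 3)⁻¹ by positivity
  · exact weierstrassZeta_bound r hr s hs l h

lemma hasDerivAt_weierstrassZetaExcept {z : ℂ} (hz : z ∈ ((L.lattice : Set ℂ) \ {0})ᶜ) :
    HasDerivAt L.weierstrassZetaExcept (-L.weierstrassPExcept 0 z) z := by
  have h := (L.hasSumLocallyUniformly_weierstrassPExcept 0).hasSumLocallyUniformlyOn
    (s := ((L.lattice : Set ℂ) \ {0})ᶜ)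
  refine hasDerivAt_of_tendstoLocallyUniformlyOn L.isOpen_compl_lattice_sdiff
    (f := fun (s : Finset L.lattice) (z : ℂ) => ∑ l ∈ s,
      if l = 0 then 0 else ((z - l)⁻¹ + (l : ℂ)⁻¹ + z * ((l : ℂ) ^ 2)⁻¹))
    (f' := fun (s : Finset L.lattice) (z : ℂ) => - ∑ l ∈ s,
      if (l : ℂ) = 0 then 0 else (1 / (z - l) ^ 2 - 1 / (l : ℂ) ^ 2))
    (l := Filter.atTop)
    (g' := fun (z : ℂ) => -L.weierstrassPExcept 0 z) ?_ ?_ ?_ hz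
  · exact (hasSumLocallyUniformlyOn_iff_tendstoLocallyUniformlyOn.1 h).neg
  · refine .of_forall fun s z hz => ?_
    rw [← Finset.sum_neg_distrib]
    refine HasDerivAt.fun_sum fun l _ => ?_
    by_cases hl : l = 0
    · simp [hl, hasDerivAt_const]
    · have hl' : (l : ℂ) ≠ 0 := by simpa using hl
      simp only [hl, hl', if_false]
      have hzl : z - l ≠ 0 := by
        intro h0
        apply hz
        rw [sub_eq_zero.1 h0]
        exact ⟨l.2, hl'⟩
      have := (((hasDerivAt_id z).sub_const (l : ℂ)).fun_inv hzl).add_const ((l : ℂ)⁻¹) |>.add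
        ((hasDerivAt_id z).mul_const (((l : ℂ) ^ 2)⁻¹))
      refine HasDerivAt.congr_deriv this ?_
      simp
      ring
  · exact fun z _ => L.hasSum_weierstrassZetaExcept z

/-- The Weierstrass `ζ`-function. -/
def weierstrassZeta (z : ℂ) : ℂ := z⁻¹ + L.weierstrassZetaExcept z

lemma hasDerivAt_weierstrassZeta {z : ℂ} (hz : z ∉ L.lattice) :
    HasDerivAt L.weierstrassZeta (-L.weierstrassP z) z := by
  have h0 : z ≠ 0 := by rintro rfl; exact hz (zero_mem _)
  refine ((hasDerivAt_inv h0).add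
    (L.hasDerivAt_weierstrassZetaExcept fun h => hz h.1)).congr_deriv ?_
  rw [weierstrassP_eq_except_add]
  ring

lemma weierstrassZetaExcept_neg (z : ℂ) :
    L.weierstrassZetaExcept (-z) = -L.weierstrassZetaExcept z := by
  rw [weierstrassZetaExcept, weierstrassZetaExcept, ← tsum_neg, ← (Equiv.neg _).tsum_eq]
  congr! 2 with l
  by_cases hl : l = 0
  · simp [hl]
  · simp [hl]
    rw [show -z + (l : ℂ) = -(z - l) by ring, inv_neg]
    ring

lemma weierstrassZeta_neg (z : ℂ) : L.weierstrassZeta (-z) = -L.weierstrassZeta z := by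
  rw [weierstrassZeta, weierstrassZeta, weierstrassZetaExcept_neg, inv_neg]
  ring

end PeriodPair

/-- The Weierstrass `ζ`-function of `ϖℤ[i]`. -/
abbrev lemZ : ℂ → ℂ := lemn.weierstrassZeta

lemma wzeta4_eq (u : ℂ) : wzeta4 u = lemZ u := by
  rw [wzeta4, lemZ, PeriodPair.weierstrassZeta, PeriodPair.weierstrassZetaExcept]
  have := tsum_lemn (fun l => if l = 0 then 0 else ((u - l)⁻¹ + l⁻¹ + u * (l ^ 2)⁻¹))
  simp only [ω4_eq_zero, ZeroMemClass.coe_eq_zero] at this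
  rw [this]

lemma lemZ_I_mul (z : ℂ) : lemZ (I * z) = -I * lemZ z := by
  rw [lemZ, PeriodPair.weierstrassZeta, PeriodPair.weierstrassZeta,
    PeriodPair.weierstrassZetaExcept, PeriodPair.weierstrassZetaExcept, mul_add, ← tsum_mul_left,
    ← lemnMulI.tsum_eq]
  congr 1
  · rw [mul_inv, inv_I]
  refine tsum_congr fun l => ?_
  by_cases hl : l = 0
  · have : lemnMulI 0 = 0 := by ext; simp [lemnMulI]
    simp [hl, this]
  · have hl' : lemnMulI l ≠ 0 := by
      intro h
      have : I * (l : ℂ) = 0 := congrArg Subtype.val h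
      simp at this
      exact hl this
    rw [if_neg hl, if_neg hl']
    simp only [lemnMulI, Equiv.coe_fn_mk]
    rw [← mul_sub, mul_inv, mul_inv, mul_pow, I_sq, inv_I, neg_one_mul, inv_neg]
    ring

/-- The quasi-period of `ζ` along `ϖ`. -/
def lemEta : ℂ := lemZ (varpi * I / 2 + varpi) - lemZ (varpi * I / 2)

lemma varpi_mem_lemn : (varpi : ℂ) ∈ lemn.lattice := mem_lemn.2 ⟨1, 0, by simp⟩

lemma lemn_const_of_hasDerivAt_zero {f : ℂ → ℂ} {s : Set ℂ} (ho : IsOpen s) (hs : sᶜ.Countable)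
    (hf : ∀ z ∈ s, HasDerivAt f 0 z) {z w : ℂ} (hz : z ∈ s) (hw : w ∈ s) : f z = f w := by
  have hp : IsPreconnected s := by
    have := PeriodPair.isPreconnected_compl_of_countable hs
    rwa [compl_compl] at this
  exact ho.is_const_of_deriv_eq_zero hp
    (fun z hz => (hf z hz).differentiableAt.differentiableWithinAt)
    (fun z hz => (hf z hz).deriv) hz hw

lemma lemZ_add_varpi {z : ℂ} (hz : z ∉ lemn.lattice) : lemZ (z + varpi) = lemZ z + lemEta := by
  have h1 : ((varpi : ℂ) * I / 2) ∉ lemn.lattice := by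
    have := (mem_lemn_real (x := 0) (y := 1 / 2)).not.2
      (by rintro ⟨a, b, -, h⟩; exact half_ne_int b h)
    convert this using 2
    push_cast; ring
  have h := lemn_const_of_hasDerivAt_zero (f := fun z => lemZ (z + varpi) - lemZ z)
    lemn.isOpen_compl_lattice (by rw [compl_compl]; exact lemn.countable_lattice)
    (fun w hw => ?_) (show z ∈ (lemn.lattice : Set ℂ)ᶜ from hz) h1
  · rw [lemEta, ← h]; ring
  · have hw' : w + varpi ∉ lemn.lattice := fun h =>
      hw (by simpa using sub_mem h varpi_mem_lemn)
    have := ((lemn.hasDerivAt_weierstrassZeta hw').comp_add_const w (varpi : ℂ)).sub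
      (lemn.hasDerivAt_weierstrassZeta hw)
    refine this.congr_deriv ?_
    rw [lemn.weierstrassP_add_of_mem w varpi_mem_lemn]
    ring

lemma lemZ_add_varpi_I {z : ℂ} (hz : z ∉ lemn.lattice) :
    lemZ (z + varpi * I) = lemZ z - I * lemEta := by
  have hz' : -I * z ∉ lemn.lattice := by
    intro h
    apply hz
    have := I_mul_mem_lemn h
    rwa [← mul_assoc, mul_neg, I_mul_I, neg_neg, one_mul] at this
  have h := lemZ_add_varpi hz'
  have e1 : z + varpi * I = I * (-I * z + varpi) := by linear_combination z * I_sq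
  have e2 : lemZ z = lemZ (I * (-I * z)) := by
    congr 1; linear_combination z * I_sq
  rw [e1, e2, lemZ_I_mul, lemZ_I_mul, h]
  ring

lemma integral_arctan_kernel {a : ℝ} (ha : 0 < a) :
    ∫ x in (-a)..a, (((2 * a / (a ^ 2 + x ^ 2) : ℝ)) : ℂ) = Real.pi := by
  rw [intervalIntegral.integral_ofReal]
  congr 1
  have hd : ∀ x ∈ Set.uIcc (-a) a,
      HasDerivAt (fun x => 2 * Real.arctan (x / a)) (2 * a / (a ^ 2 + x ^ 2)) x := by
    intro x _
    refine (((hasDerivAt_id x).div_const a).arctan.const_mul 2).congr_deriv ?_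
    have : 0 < a ^ 2 + x ^ 2 := by positivity
    simp only [id]
    field_simp
  have hpos : ∀ x : ℝ, a ^ 2 + x ^ 2 ≠ 0 := fun x => by positivity
  rw [intervalIntegral.integral_eq_sub_of_hasDerivAt hd
    (Continuous.intervalIntegrable (by fun_prop (disch := exact hpos _)) _ _)]
  rw [neg_div, div_self ha.ne', Real.arctan_neg, Real.arctan_one]
  ring

lemma lemEta_eq : lemEta = (Real.pi / varpi : ℝ) := by
  have hv := varpi_pos
  set a : ℝ := varpi / 2 with ha_def
  have ha : 0 < a := by positivity
  set f : ℂ → ℂ := lemn.weierstrassZetaExcept with hf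
  have hfd : DifferentiableOn ℂ f (Set.uIcc (-a) a ×ℂ Set.uIcc (-a) a) := by
    intro z hz
    refine (lemn.hasDerivAt_weierstrassZetaExcept ?_).differentiableAt.differentiableWithinAt
    rintro ⟨h1, h2⟩
    apply h2
    obtain ⟨m, n, h⟩ := mem_lemn.1 h1
    rw [mem_reProdIm, Set.uIcc_of_le (by linarith)] at hz
    have hre : z.re = varpi * m := by rw [h]; simp
    have him : z.im = varpi * n := by rw [h]; simp
    have key : ∀ k : ℤ, varpi * k ∈ Set.Icc (-a) a → k = 0 := by
      intro k hk
      have h1 : (-1 : ℝ) < k := by nlinarith [hk.1]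
      have h2 : (k : ℝ) < 1 := by nlinarith [hk.2]
      have h1' : (-1 : ℤ) < k := by exact_mod_cast h1
      have h2' : k < (1 : ℤ) := by exact_mod_cast h2
      omega
    have hm := key m (hre ▸ hz.1)
    have hn := key n (him ▸ hz.2)
    simp [h, hm, hn]
  have hc := hfd.continuousOn
  have hrect := integral_boundary_rect_eq_zero_of_differentiableOn f (-a - a * I) (a + a * I)
    (by simpa using hfd)
  simp only [sub_re, neg_re, ofReal_re, mul_re, I_re, mul_zero, ofReal_im, I_im, mul_one, sub_self,
    sub_zero, sub_im, neg_im, mul_im, zero_add, add_re, add_im, add_zero, neg_zero, zero_sub,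
    smul_eq_mul] at hrect
  have hcont : ∀ g : ℝ → ℂ, Continuous g →
      (∀ x ∈ Set.Icc (-a) a, g x ∈ Set.uIcc (-a) a ×ℂ Set.uIcc (-a) a) →
      IntervalIntegrable (fun x => f (g x)) MeasureTheory.volume (-a) a := by
    intro g hg hm
    refine ContinuousOn.intervalIntegrable (hc.comp hg.continuousOn fun x hx => ?_)
    rw [Set.uIcc_of_le (by linarith)] at hx
    exact hm x hx
  have hmem : ∀ {x y : ℝ}, x ∈ Set.Icc (-a) a → y ∈ Set.Icc (-a) a →
      (x + y * I : ℂ) ∈ Set.uIcc (-a) a ×ℂ Set.uIcc (-a) a := by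
    intro x y hx hy
    rw [mem_reProdIm, Set.uIcc_of_le (by linarith)]
    simpa using ⟨hx, hy⟩
  have hl : -a ∈ Set.Icc (-a) a := ⟨le_rfl, by linarith⟩
  have hr : a ∈ Set.Icc (-a) a := ⟨by linarith, le_rfl⟩
  have hInt : ∀ c : ℂ, IntervalIntegrable (fun _ : ℝ => c) MeasureTheory.volume (-a) a :=
    fun c => intervalIntegrable_const
  have hk : IntervalIntegrable (fun x : ℝ => (((2 * a / (a ^ 2 + x ^ 2) : ℝ)) : ℂ))
      MeasureTheory.volume (-a) a := by
    have hpos : ∀ x : ℝ, a ^ 2 + x ^ 2 ≠ 0 := fun x => by positivity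
    refine Continuous.intervalIntegrable ?_ _ _
    exact continuous_ofReal.comp (by fun_prop (disch := exact hpos _))
  have hne : ∀ k : ℤ, a ≠ varpi * k := by
    intro k hk
    exact half_ne_int k (by rw [ha_def] at hk; field_simp at hk; linarith)
  have e1 : (∫ x in (-a)..a, f (x + (-a : ℝ) * I)) - ∫ x in (-a)..a, f (x + (a : ℝ) * I)
      = I * (2 * a * lemEta - Real.pi) := by
    rw [← intervalIntegral.integral_sub
      (hcont _ (by fun_prop) fun x hx => hmem hx hl) (hcont _ (by fun_prop) fun x hx => hmem hx hr)]
    rw [show I * (2 * a * lemEta - Real.pi) = ∫ x in (-a)..a, I * (lemEta -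
      (((2 * a / (a ^ 2 + x ^ 2) : ℝ)) : ℂ)) by
        rw [intervalIntegral.integral_const_mul, intervalIntegral.integral_sub (hInt _) hk,
          integral_arctan_kernel ha]
        simp only [intervalIntegral.integral_const, real_smul]; push_cast; ring]
    refine intervalIntegral.integral_congr fun x _ => ?_
    have hz : (x + (-a : ℝ) * I : ℂ) ∉ lemn.lattice := by
      intro h
      obtain ⟨m, n, h⟩ := mem_lemn.1 h
      have := congrArg Complex.im h
      simp at this
      exact hne (-n) (by push_cast; linarith)
    have h := lemZ_add_varpi_I hz
    have e : (x + (-a : ℝ) * I + varpi * I : ℂ) = x + a * I := by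
      rw [ha_def]; push_cast; ring
    rw [e] at h
    simp only [lemZ, PeriodPair.weierstrassZeta] at h
    have hpos : (a ^ 2 + x ^ 2 : ℂ) ≠ 0 := by
      have : a ^ 2 + x ^ 2 ≠ 0 := by positivity
      exact_mod_cast this
    have hfac : (a ^ 2 + x ^ 2 : ℂ) = (x + a * I) * (x + (-a : ℝ) * I) := by
      push_cast; linear_combination ((a:ℂ)^2) * I_sq
    have n1 : (x + a * I : ℂ) ≠ 0 := fun h0 => hpos (by rw [hfac, h0, zero_mul])
    have n2 : (x + (-a : ℝ) * I : ℂ) ≠ 0 := fun h0 => hpos (by rw [hfac, h0, mul_zero])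
    have hk : (x + (-a : ℝ) * I : ℂ)⁻¹ - (x + a * I : ℂ)⁻¹ = I * (2 * a / (a ^ 2 + x ^ 2)) := by
      rw [inv_sub_inv n2 n1, ← mul_div_assoc, div_eq_div_iff (mul_ne_zero n2 n1) hpos, hfac]
      push_cast; ring
    push_cast at *
    simp only [hf]
    linear_combination -h - hk
  have e2 : (∫ x in (-a)..a, f ((a : ℝ) + x * I)) - ∫ x in (-a)..a, f ((-a : ℝ) + x * I)
      = (2 * a * lemEta - Real.pi) := by
    rw [← intervalIntegral.integral_sub
      (hcont _ (by fun_prop) fun x hx => hmem hr hx) (hcont _ (by fun_prop) fun x hx => hmem hl hx)]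
    rw [show (2 * a * lemEta - Real.pi) = ∫ x in (-a)..a, (lemEta -
      (((2 * a / (a ^ 2 + x ^ 2) : ℝ)) : ℂ)) by
        rw [intervalIntegral.integral_sub (hInt _) hk, integral_arctan_kernel ha]
        simp only [intervalIntegral.integral_const, real_smul]; push_cast; ring]
    refine intervalIntegral.integral_congr fun x _ => ?_
    have hz : ((-a : ℝ) + x * I : ℂ) ∉ lemn.lattice := by
      intro h
      obtain ⟨m, n, h⟩ := mem_lemn.1 h
      have := congrArg Complex.re h
      simp at this
      exact hne (-m) (by push_cast; linarith)
    have h := lemZ_add_varpi hz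
    have e : ((-a : ℝ) + x * I + varpi : ℂ) = a + x * I := by
      rw [ha_def]; push_cast; ring
    rw [e] at h
    simp only [lemZ, PeriodPair.weierstrassZeta] at h
    have hpos : (a ^ 2 + x ^ 2 : ℂ) ≠ 0 := by
      have : a ^ 2 + x ^ 2 ≠ 0 := by positivity
      exact_mod_cast this
    have hfac : (a ^ 2 + x ^ 2 : ℂ) = -((a + x * I) * ((-a : ℝ) + x * I)) := by
      push_cast; linear_combination ((x:ℂ)^2) * I_sq
    have n1 : (a + x * I : ℂ) ≠ 0 := fun h0 => hpos (by rw [hfac, h0]; simp)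
    have n2 : ((-a : ℝ) + x * I : ℂ) ≠ 0 := fun h0 => hpos (by rw [hfac, h0]; simp)
    have hk : (a + x * I : ℂ)⁻¹ - ((-a : ℝ) + x * I : ℂ)⁻¹ = 2 * a / (a ^ 2 + x ^ 2) := by
      rw [inv_sub_inv n1 n2, div_eq_div_iff (mul_ne_zero n1 n2) hpos, hfac]
      push_cast; ring
    push_cast at *
    simp only [hf]
    linear_combination h - hk
  have h2a : (2 * a : ℂ) = varpi := by rw [ha_def]; push_cast; ring
  have hfin : 2 * I * (varpi * lemEta - Real.pi) = 0 := by
    rw [← h2a]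
    linear_combination hrect - e1 - I * e2
  have hvne : (varpi : ℂ) ≠ 0 := by exact_mod_cast hv.ne'
  have : (varpi * lemEta - Real.pi : ℂ) = 0 := by simpa using hfin
  push_cast
  rw [eq_div_iff hvne]
  linear_combination this

lemma lemP_eq_imp {u v : ℂ} (hu : u ∉ lemn.lattice) (hv : v ∉ lemn.lattice)
    (h : lemP u = lemP v) : u + v ∈ lemn.lattice ∨ u - v ∈ lemn.lattice := by
  have h2 : (lemP' u - lemP' v) * (lemP' u + lemP' v) = 0 := by
    have := lemP'_sq hu
    rw [h, ← lemP'_sq hv] at this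
    linear_combination this
  have key : ∀ w, w ∉ lemn.lattice → lemP u = lemP w → lemP' u = lemP' w → u - w ∈ lemn.lattice := by
    intro w hw h1 h2
    rw [← lemnCurve_isModel.hom_eq_zero, map_sub, sub_eq_zero, lemnCurve_isModel.hom_apply hu,
      lemnCurve_isModel.hom_apply hw]
    simp only [WeierstrassCurve.Affine.Point.some.injEq]
    exact ⟨h1, by rw [show lemn.derivWeierstrassP u = lemn.derivWeierstrassP w from h2]⟩
  rcases mul_eq_zero.1 h2 with h3 | h3
  · exact Or.inr (key v hv h (sub_eq_zero.1 h3))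
  · left
    have hv' : -v ∉ lemn.lattice := by rwa [neg_mem_iff]
    have := key (-v) hv' (by rw [h]; exact (lemn.weierstrassP_neg v).symm)
      (by rw [show lemP' (-v) = -lemP' v from lemn.derivWeierstrassP_neg v]
          linear_combination h3)
    rwa [sub_neg_eq_add] at this

/-- Both arguments, their sum and their difference avoid the lattice. -/
structure LemGood (u v : ℂ) : Prop where
  left : u ∉ lemn.lattice
  right : v ∉ lemn.lattice
  add : u + v ∉ lemn.lattice
  sub : u - v ∉ lemn.lattice

namespace LemGood

variable {u v : ℂ}

lemma ne (h : LemGood u v) : lemP u ≠ lemP v := fun he =>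
  (lemP_eq_imp h.left h.right he).elim h.add h.sub

lemma neg_left (h : LemGood u v) : LemGood (-u) v where
  left := by rw [neg_mem_iff]; exact h.left
  right := h.right
  add := by rw [← neg_mem_iff]; convert h.sub using 2; ring
  sub := by rw [← neg_mem_iff]; convert h.add using 2; ring

lemma symm (h : LemGood u v) : LemGood v u where
  left := h.right
  right := h.left
  add := by rw [add_comm]; exact h.add
  sub := by rw [← neg_mem_iff]; convert h.sub using 2; ring

end LemGood

/-- The defect in the addition theorem for `ζ`; it vanishes by `zetaDefect_eq_zero`. -/
def zetaDefect (u v : ℂ) : ℂ := lemZ (u + v) - lemZ u - lemZ v - lemn.chordSlope u v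

lemma zetaDefect_comm (u v : ℂ) : zetaDefect u v = zetaDefect v u := by
  rw [zetaDefect, zetaDefect, PeriodPair.chordSlope, PeriodPair.chordSlope, add_comm u v,
    ← neg_sub (lemn.derivWeierstrassP v), ← neg_sub (lemn.weierstrassP v), mul_neg, neg_div_neg_eq]
  ring

lemma zetaDefect_neg_neg (u v : ℂ) : zetaDefect (-u) (-v) = -zetaDefect u v := by
  simp only [zetaDefect, PeriodPair.chordSlope, lemn.weierstrassP_neg, lemn.derivWeierstrassP_neg,
    ← neg_add, lemn.weierstrassZeta_neg, lemZ]
  ring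

lemma zetaDefect_const {u u' v : ℂ} (h : LemGood u v) (h' : LemGood u' v) :
    zetaDefect u v = zetaDefect u' v := by
  let T : Set ℂ := (lemn.lattice : Set ℂ) ∪
    ((fun z => z + v) ⁻¹' (lemn.lattice : Set ℂ) ∪ (fun z => z - v) ⁻¹' (lemn.lattice : Set ℂ))
  have hmem : ∀ {w}, LemGood w v → w ∈ Tᶜ := by
    rintro w hw (h | h | h)
    exacts [hw.left h, hw.add h, hw.sub h]
  have hmem' : ∀ {w}, w ∈ Tᶜ → LemGood w v := fun {w} hw =>
    ⟨fun h => hw (Or.inl h), h.right, fun h => hw (Or.inr (Or.inl h)),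
      fun h => hw (Or.inr (Or.inr h))⟩
  refine lemn_const_of_hasDerivAt_zero (f := fun u => zetaDefect u v) (s := Tᶜ) ?_ ?_ ?_
    (hmem h) (hmem h')
  · refine IsClosed.isOpen_compl (self := ?_)
    refine lemn.isClosed_lattice.union (IsClosed.union ?_ ?_)
    · exact lemn.isClosed_lattice.preimage (by fun_prop)
    · exact lemn.isClosed_lattice.preimage (by fun_prop)
  · rw [compl_compl]
    refine lemn.countable_lattice.union (Set.Countable.union ?_ ?_)
    · exact lemn.countable_lattice.preimage (add_left_injective v)
    · exact lemn.countable_lattice.preimage (sub_left_injective)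
  · intro w hw
    have hg := hmem' hw
    have h1 := ((((lemn.hasDerivAt_weierstrassZeta hg.add).comp_add_const w v).sub
      (lemn.hasDerivAt_weierstrassZeta hg.left)).sub_const (lemZ v)).sub
      (lemn.hasDerivAt_chordSlope hg.left hg.right hg.ne)
    refine h1.congr_deriv ?_
    ring

lemma zetaDefect_eq_zero {u v : ℂ} (h : LemGood u v) : zetaDefect u v = 0 := by
  have e1 : zetaDefect u v = zetaDefect (-u) v := zetaDefect_const h h.neg_left
  have e2 : zetaDefect v (-u) = zetaDefect (-v) (-u) :=
    zetaDefect_const h.neg_left.symm h.neg_left.symm.neg_left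
  rw [zetaDefect_comm (-u), e2, zetaDefect_neg_neg, zetaDefect_comm v] at e1
  linear_combination (1/2) * e1

lemma Z4_def' (u : ℂ) : Z4 u = lemZ (varpi * u) - lemEta * (starRingEnd ℂ) u := by
  rw [Z4, wzeta4_eq, lemEta_eq]

lemma Z4_add_one {u : ℂ} (hu : varpi * u ∉ lemn.lattice) : Z4 (u + 1) = Z4 u := by
  rw [Z4_def', Z4_def', mul_add, mul_one, lemZ_add_varpi hu, map_add, map_one]
  ring

lemma Z4_add_I {u : ℂ} (hu : varpi * u ∉ lemn.lattice) : Z4 (u + I) = Z4 u := by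
  rw [Z4_def', Z4_def', mul_add, lemZ_add_varpi_I hu, map_add, conj_I]
  ring

lemma mul_int_mem_lemn (a b : ℤ) : (varpi : ℂ) * (a + b * I) ∈ lemn.lattice := mem_lemn.2 ⟨a, b, rfl⟩

lemma notMem_add {u l : ℂ} (hl : l ∈ lemn.lattice) : u + l ∈ lemn.lattice ↔ u ∈ lemn.lattice :=
  ⟨fun h => by simpa using sub_mem h hl, fun h => add_mem h hl⟩

lemma Z4_add_int {u : ℂ} (hu : varpi * u ∉ lemn.lattice) (a b : ℤ) : Z4 (u + (a + b * I)) = Z4 u := by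
  classical
  let D : ℂ → ℂ := fun z => if varpi * z ∈ lemn.lattice then 0 else Z4 z
  have h1 : Function.Periodic D 1 := by
    intro z
    have h : varpi * (z + 1) ∈ lemn.lattice ↔ varpi * z ∈ lemn.lattice := by
      rw [mul_add, mul_one, notMem_add varpi_mem_lemn]
    by_cases hz : varpi * z ∈ lemn.lattice
    · simp only [D, h, hz, if_true]
    · simp only [D, h, hz, if_false]; exact Z4_add_one hz
  have h2 : Function.Periodic D I := by
    intro z
    have h : varpi * (z + I) ∈ lemn.lattice ↔ varpi * z ∈ lemn.lattice := by
      rw [mul_add, notMem_add (by simpa using mul_int_mem_lemn 0 1)]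
    by_cases hz : varpi * z ∈ lemn.lattice
    · simp only [D, h, hz, if_true]
    · simp only [D, h, hz, if_false]; exact Z4_add_I hz
  have h3 := ((h1.int_mul a).add_period (h2.int_mul b)) u
  have h4 : varpi * (u + (a + b * I)) ∈ lemn.lattice ↔ varpi * u ∈ lemn.lattice := by
    rw [mul_add, notMem_add (mul_int_mem_lemn a b)]
  simp only [D, hu, if_false, mul_one] at h3
  rwa [if_neg (h4.not.2 hu)] at h3

lemma Z4_I_mul (u : ℂ) : Z4 (I * u) = -I * Z4 u := by
  rw [Z4_def', Z4_def', mul_left_comm, lemZ_I_mul, map_mul, conj_I]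
  ring

lemma Z4_add {a b : ℂ} (h : LemGood (varpi * a) (varpi * b)) :
    Z4 (a + b) - Z4 a - Z4 b = lemn.chordSlope (varpi * a) (varpi * b) := by
  have := zetaDefect_eq_zero h
  rw [zetaDefect] at this
  rw [Z4_def', Z4_def', Z4_def', mul_add, map_add]
  linear_combination this

lemma Z4_add_sq {a b : ℂ} (h : LemGood (varpi * a) (varpi * b)) :
    (Z4 (a + b) - Z4 a - Z4 b) ^ 2
      = lemP (varpi * a) + lemP (varpi * b) + lemP (varpi * (a + b)) := by
  rw [Z4_add h, mul_add]
  linear_combination -lemn.weierstrassP_add h.left h.right h.ne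

lemma phi4_eq (u : ℂ) : phi4 u = -2 * (1 - I) * lemP (varpi * u) / lemP' (varpi * u) := by
  rw [phi4, wp4_eq, wp4'_eq]

lemma psi4_eq (u : ℂ) : psi4 u = (lemP (varpi * u) + I) / (lemP (varpi * u) - I) := by
  rw [psi4, wp4_eq]

section Pointwise

variable {z : ℂ}

lemma notMem_of_two_mul (h : 2 * z ∉ lemn.lattice) : z ∉ lemn.lattice := fun hz =>
  h (by rw [two_mul]; exact add_mem hz hz)

lemma notMem_one_add_I_mul (h : 2 * z ∉ lemn.lattice) : z + I * z ∉ lemn.lattice := fun hz =>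
  h (by
    have := sub_mem hz (I_mul_mem_lemn hz)
    convert this using 1
    linear_combination z * I_sq)

lemma notMem_one_sub_I_mul (h : 2 * z ∉ lemn.lattice) : z - I * z ∉ lemn.lattice := fun hz =>
  h (by
    have := add_mem hz (I_mul_mem_lemn hz)
    convert this using 1
    linear_combination z * I_sq)

lemma lemGood_I_mul (h : 2 * z ∉ lemn.lattice) : LemGood z (I * z) where
  left := notMem_of_two_mul h
  right := by rw [I_mul_mem_lemn_iff]; exact notMem_of_two_mul h
  add := notMem_one_add_I_mul h
  sub := notMem_one_sub_I_mul h

lemma lemP'_ne_zero (h : 2 * z ∉ lemn.lattice) : lemP' z ≠ 0 := fun h0 =>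
  h (two_mul_mem_of_lemP'_eq_zero (notMem_of_two_mul h) h0)

lemma lemP'_sq_factor (h : 2 * z ∉ lemn.lattice) :
    lemP' z ^ 2 = 4 * lemP z * (lemP z ^ 2 - 1) := by
  rw [lemP'_sq (notMem_of_two_mul h)]; ring

lemma lemP_ne_zero (h : 2 * z ∉ lemn.lattice) : lemP z ≠ 0 := fun h0 => by
  have := lemP'_sq_factor h
  rw [h0] at this
  exact lemP'_ne_zero h (by simpa using this)

lemma lemP_sq_sub_one_ne_zero (h : 2 * z ∉ lemn.lattice) : lemP z ^ 2 - 1 ≠ 0 := fun h0 => by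
  have := lemP'_sq_factor h
  rw [h0] at this
  exact lemP'_ne_zero h (by simpa using this)

lemma chordSlope_I_mul (h : 2 * z ∉ lemn.lattice) :
    lemn.chordSlope z (I * z) = (1 - I) * lemP' z / (4 * lemP z) := by
  have hP := lemP_ne_zero h
  rw [PeriodPair.chordSlope, show lemn.derivWeierstrassP (I * z) = I * lemP' z from lemP'_I_mul z,
    show lemn.weierstrassP (I * z) = -lemP z from lemP_I_mul z,
    show lemn.derivWeierstrassP z = lemP' z from rfl, show lemn.weierstrassP z = lemP z from rfl]
  field_simp
  ring

lemma lemP_one_add_I_mul (h : 2 * z ∉ lemn.lattice) :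
    lemP (z + I * z) = -I * (lemP z ^ 2 - 1) / (2 * lemP z) := by
  have hP := lemP_ne_zero h
  have hg := lemGood_I_mul h
  rw [show lemP (z + I * z) = _ from lemn.weierstrassP_add hg.left hg.right hg.ne,
    chordSlope_I_mul h, show lemn.weierstrassP (I * z) = -lemP z from lemP_I_mul z,
    show lemn.weierstrassP z = lemP z from rfl, div_pow, mul_pow, lemP'_sq_factor h]
  field_simp
  linear_combination (lemP z ^ 2 - 1) * 2 * I_sq

lemma lemP'_one_add_I_mul (h : 2 * z ∉ lemn.lattice) :
    lemP' (z + I * z) = -lemP' z * (1 + I) * (lemP z ^ 2 + 1) / (4 * lemP z ^ 2) := by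
  have hP := lemP_ne_zero h
  have hg := lemGood_I_mul h
  rw [show lemP' (z + I * z) = _ from lemn.derivWeierstrassP_add hg.left hg.right hg.ne,
    show lemn.weierstrassP (z + I * z) = _ from lemP_one_add_I_mul h,
    chordSlope_I_mul h,
    show lemn.derivWeierstrassP z = lemP' z from rfl, show lemn.weierstrassP z = lemP z from rfl]
  field_simp
  linear_combination lemP' z * (1 - lemP z ^ 2) * I_sq

variable {u : ℂ}

lemma phi4_ne_zero (h : 2 * (varpi * u) ∉ lemn.lattice) : phi4 u ≠ 0 := by
  rw [phi4_eq]
  have : (1 - I : ℂ) ≠ 0 := fun h => by simpa using congrArg Complex.re h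
  exact div_ne_zero (mul_ne_zero (mul_ne_zero (by norm_num) this) (lemP_ne_zero h)) (lemP'_ne_zero h)

lemma phi4_sq (h : 2 * (varpi * u) ∉ lemn.lattice) :
    phi4 u ^ 2 * (lemP (varpi * u) ^ 2 - 1) = -2 * I * lemP (varpi * u) := by
  have h1 := lemP_sq_sub_one_ne_zero h
  have h2 := lemP_ne_zero h
  rw [phi4_eq, div_pow, lemP'_sq_factor h]
  field_simp
  linear_combination 2 * I_sq

lemma phi4_I_mul (u : ℂ) : phi4 (I * u) = I * phi4 u := by
  rw [phi4_eq, phi4_eq, mul_left_comm (varpi : ℂ), lemP_I_mul, lemP'_I_mul]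
  rw [div_eq_mul_inv, div_eq_mul_inv, mul_inv, inv_I]
  ring

lemma varpi_mul_one_add_I (u : ℂ) : varpi * ((1 + I) * u) = varpi * u + I * (varpi * u) := by ring

lemma lemP_one_add_I_mul_phi4_sq (h : 2 * (varpi * u) ∉ lemn.lattice) :
    lemP (varpi * ((1 + I) * u)) * phi4 u ^ 2 = -1 := by
  have h1 := lemP_sq_sub_one_ne_zero h
  have h2 := lemP_ne_zero h
  have h3 := phi4_sq h
  rw [varpi_mul_one_add_I, lemP_one_add_I_mul h]
  rw [← eq_div_iff h1] at h3
  rw [h3]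
  field_simp
  linear_combination I_sq

lemma phi4_one_add_I_mul (h : 2 * (varpi * u) ∉ lemn.lattice)
    (h' : 2 * (varpi * ((1 + I) * u)) ∉ lemn.lattice) :
    phi4 ((1 + I) * u) ^ 2 * (1 - phi4 u ^ 4) = 2 * I * phi4 u ^ 2 := by
  have h1 := phi4_sq h'
  have h2 := lemP_one_add_I_mul_phi4_sq h
  have h3 := phi4_ne_zero h
  rw [← eq_div_iff (pow_ne_zero 2 h3)] at h2
  rw [h2] at h1
  field_simp at h1
  linear_combination h1

lemma lemP_sq_add_one_ne_zero (h : 2 * z ∉ lemn.lattice) (h' : 2 * (z + I * z) ∉ lemn.lattice) :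
    lemP z ^ 2 + 1 ≠ 0 := fun h0 => by
  have := lemP'_one_add_I_mul h
  rw [h0] at this
  exact lemP'_ne_zero h' (by simpa using this)

lemma phi4_one_add_I_mul_linear (h : 2 * (varpi * u) ∉ lemn.lattice)
    (h' : 2 * (varpi * ((1 + I) * u)) ∉ lemn.lattice) :
    phi4 ((1 + I) * u) * (lemP (varpi * u) ^ 2 + 1)
      = (1 + I) * (lemP (varpi * u) ^ 2 - 1) * phi4 u := by
  rw [varpi_mul_one_add_I] at h'
  have h1 := lemP_sq_add_one_ne_zero h h'
  have h2 := lemP_ne_zero h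
  have h3 := lemP'_ne_zero h
  have h4 : (1 + I : ℂ) ≠ 0 := fun h => by simpa using congrArg Complex.re h
  rw [phi4_eq, phi4_eq, varpi_mul_one_add_I, lemP_one_add_I_mul h, lemP'_one_add_I_mul h]
  field_simp
  ring_nf
  simp only [I_sq, I_pow_three]
  ring

lemma Z4_one_add_I_mul (h : 2 * (varpi * u) ∉ lemn.lattice) :
    Z4 ((1 + I) * u) = (1 - I) * Z4 u + I * (phi4 u)⁻¹ := by
  have hg : LemGood (varpi * u) (varpi * (I * u)) := by
    rw [mul_left_comm]; exact lemGood_I_mul h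
  have := Z4_add hg
  rw [Z4_I_mul, mul_left_comm, chordSlope_I_mul h] at this
  have h2 := lemP_ne_zero h
  have h3 := lemP'_ne_zero h
  have h4 : (1 - I : ℂ) ≠ 0 := fun h => by simpa using congrArg Complex.re h
  have e : I * (phi4 u)⁻¹ = (1 - I) * lemP' (varpi * u) / (4 * lemP (varpi * u)) := by
    rw [phi4_eq, inv_div]
    field_simp
    linear_combination (-2 : ℂ) * I_sq
  rw [e, ← this]
  ring_nf

end Pointwise

lemma mem_O4 {z : ℂ} : z ∈ O4 ↔ ∃ a b : ℤ, z = a + b * I := by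
  constructor
  · intro hz
    induction hz using Subring.closure_induction with
    | mem x hx => exact ⟨0, 1, by rw [Set.mem_singleton_iff.1 hx]; simp⟩
    | zero => exact ⟨0, 0, by simp⟩
    | one => exact ⟨1, 0, by simp⟩
    | add x y _ _ hx hy =>
      obtain ⟨a, b, rfl⟩ := hx
      obtain ⟨c, d, rfl⟩ := hy
      exact ⟨a + c, b + d, by push_cast; ring⟩
    | neg x _ hx =>
      obtain ⟨a, b, rfl⟩ := hx
      exact ⟨-a, -b, by push_cast; ring⟩
    | mul x y _ _ hx hy =>
      obtain ⟨a, b, rfl⟩ := hx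
      obtain ⟨c, d, rfl⟩ := hy
      exact ⟨a * c - b * d, a * d + b * c, by push_cast; linear_combination (b * d : ℂ) * I_sq⟩
  · rintro ⟨a, b, rfl⟩
    exact add_mem (intCast_mem _ _) (mul_mem (intCast_mem _ _) (Subring.subset_closure rfl))

lemma I_mem_O4 : I ∈ O4 := Subring.subset_closure rfl

lemma conj_mem_O4 {z : ℂ} (h : z ∈ O4) : (starRingEnd ℂ) z ∈ O4 := by
  obtain ⟨a, b, rfl⟩ := mem_O4.1 h
  exact mem_O4.2 ⟨a, -b, by simp⟩

/-- A Gaussian integer of odd prime norm `p`. -/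
structure IsGaussPrime (p : ℕ) (π : ℂ) : Prop where
  mod_four : p % 4 = 1
  mem : π ∈ O4
  norm : (p : ℂ) = π * (starRingEnd ℂ) π

/-- The image of `i` in `ℤ[i]/(π) ≅ ℤ/p`. -/
def resI (p : ℕ) (π : ℂ) : ZMod p := -((⌊π.re⌋ : ℤ) : ZMod p) * ((⌊π.im⌋ : ℤ) : ZMod p)⁻¹

/-- The reduction map `ℤ[i] → ℤ[i]/(π) ≅ ℤ/p` (only meaningful on `ℤ[i]`). -/
def resMap (p : ℕ) (π z : ℂ) : ZMod p := ((⌊z.re⌋ : ℤ) : ZMod p) + ((⌊z.im⌋ : ℤ) : ZMod p) * resI p π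

lemma resMap_apply (p : ℕ) (π : ℂ) (a b : ℤ) : resMap p π (a + b * I) = a + b * resI p π := by
  simp [resMap]

lemma resMap_natCast (p : ℕ) (π : ℂ) (a : ℕ) : resMap p π a = a := by
  have := resMap_apply p π a 0
  simpa using this

lemma resMap_I (p : ℕ) (π : ℂ) : resMap p π I = resI p π := by
  have := resMap_apply p π 0 1
  simpa using this

lemma resMap_one (p : ℕ) (π : ℂ) : resMap p π 1 = 1 := by
  have := resMap_apply p π 1 0
  simpa using this

lemma resMap_add {p : ℕ} {π a b : ℂ} (ha : a ∈ O4) (hb : b ∈ O4) :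
    resMap p π (a + b) = resMap p π a + resMap p π b := by
  obtain ⟨a, b, rfl⟩ := mem_O4.1 ha
  obtain ⟨c, d, rfl⟩ := mem_O4.1 hb
  rw [show (a + b * I + (c + d * I) : ℂ) = ((a + c : ℤ) : ℂ) + ((b + d : ℤ) : ℂ) * I by
    push_cast; ring, resMap_apply, resMap_apply, resMap_apply]
  push_cast; ring

lemma resMap_neg {p : ℕ} {π a : ℂ} (ha : a ∈ O4) : resMap p π (-a) = -resMap p π a := by
  obtain ⟨a, b, rfl⟩ := mem_O4.1 ha
  rw [show (-(a + b * I) : ℂ) = ((-a : ℤ) : ℂ) + ((-b : ℤ) : ℂ) * I by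
    push_cast; ring, resMap_apply, resMap_apply]
  push_cast; ring

lemma resMap_sub {p : ℕ} {π a b : ℂ} (ha : a ∈ O4) (hb : b ∈ O4) :
    resMap p π (a - b) = resMap p π a - resMap p π b := by
  rw [sub_eq_add_neg, resMap_add ha (neg_mem hb), resMap_neg hb, sub_eq_add_neg]

namespace IsGaussPrime

variable {p : ℕ} [Fact p.Prime] {π : ℂ} (h : IsGaussPrime p π)

include h

lemma ne_zero : π ≠ 0 := by
  rintro rfl
  have := h.norm
  simp at this
  have hp := h.mod_four
  simp [this] at hp

lemma exists_eq : ∃ a b : ℤ, π = a + b * I ∧ a ^ 2 + b ^ 2 = p ∧ (b : ZMod p) ≠ 0 ∧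
    resI p π = -a * (b : ZMod p)⁻¹ := by
  obtain ⟨a, b, hab⟩ := mem_O4.1 h.mem
  have hn : a ^ 2 + b ^ 2 = p := by
    have := h.norm
    rw [hab] at this
    simp at this
    have h2 : (p : ℂ) = ((a ^ 2 + b ^ 2 : ℤ) : ℂ) := by
      rw [this]; push_cast; linear_combination (-(b:ℂ)^2) * I_sq
    exact_mod_cast h2.symm
  refine ⟨a, b, hab, hn, ?_, by rw [resI, hab]; simp⟩
  intro hb
  have hp := Fact.out (p := p.Prime)
  have hb' : (p : ℤ) ∣ b := (ZMod.intCast_zmod_eq_zero_iff_dvd b p).1 hb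
  have hpp : Prime (p : ℤ) := Nat.prime_iff_prime_int.1 hp
  have ha' : (p : ℤ) ∣ a ^ 2 := by
    have : a ^ 2 = p - b * b := by linear_combination hn
    rw [this]
    exact dvd_sub dvd_rfl (hb'.mul_right _)
  obtain ⟨c, rfl⟩ := hpp.dvd_of_dvd_pow ha'
  obtain ⟨d, rfl⟩ := hb'
  have hp0 : (p : ℤ) ≠ 0 := hpp.ne_zero
  have : (p : ℤ) * (c ^ 2 + d ^ 2) = 1 := by
    apply mul_left_cancel₀ hp0
    linear_combination hn
  exact hpp.not_dvd_one ⟨_, this.symm⟩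

lemma resI_sq : resI p π ^ 2 = -1 := by
  obtain ⟨a, b, -, hn, hb, hj⟩ := h.exists_eq
  rw [hj]
  have hn' : (a : ZMod p) ^ 2 + (b : ZMod p) ^ 2 = 0 := by
    have := congrArg (Int.cast : ℤ → ZMod p) hn
    push_cast at this
    rw [this]; simp
  field_simp
  linear_combination hn'

lemma resMap_mul {a b : ℂ} (ha : a ∈ O4) (hb : b ∈ O4) :
    resMap p π (a * b) = resMap p π a * resMap p π b := by
  obtain ⟨a, b, rfl⟩ := mem_O4.1 ha
  obtain ⟨c, d, rfl⟩ := mem_O4.1 hb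
  rw [show ((a + b * I) * (c + d * I) : ℂ)
    = ((a * c - b * d : ℤ) : ℂ) + ((a * d + b * c : ℤ) : ℂ) * I by
    push_cast; linear_combination (b * d : ℂ) * I_sq, resMap_apply, resMap_apply, resMap_apply]
  push_cast
  linear_combination (-(b : ZMod p) * d) * h.resI_sq

lemma resMap_self : resMap p π π = 0 := by
  obtain ⟨a, b, hab, hn, hb, hj⟩ := h.exists_eq
  nth_rewrite 2 [hab]
  rw [resMap_apply, hj]
  field_simp
  ring

lemma resMap_eq_zero {ν : ℂ} (hν : ν ∈ O4) : resMap p π ν = 0 ↔ ∃ d ∈ O4, ν = π * d := by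
  constructor
  · intro h0
    obtain ⟨a, b, hab, hn, hb, hj⟩ := h.exists_eq
    obtain ⟨x, y, rfl⟩ := mem_O4.1 hν
    rw [resMap_apply, hj] at h0
    have h1 : ((x * b - y * a : ℤ) : ZMod p) = 0 := by
      push_cast
      field_simp at h0
      linear_combination h0
    have hn' : (a : ZMod p) ^ 2 + (b : ZMod p) ^ 2 = 0 := by
      have := congrArg (Int.cast : ℤ → ZMod p) hn
      push_cast at this
      rw [this]; simp
    have h2 : ((x * a + y * b : ℤ) : ZMod p) = 0 := by
      apply (mul_eq_zero.1 (_ : (b : ZMod p) * _ = 0)).resolve_left hb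
      push_cast at h1 ⊢
      linear_combination (a : ZMod p) * h1 + y * hn'
    obtain ⟨m, hm⟩ := (ZMod.intCast_zmod_eq_zero_iff_dvd _ p).1 h1
    obtain ⟨n, hn2⟩ := (ZMod.intCast_zmod_eq_zero_iff_dvd _ p).1 h2
    refine ⟨n - m * I, mem_O4.2 ⟨n, -m, by push_cast; ring⟩, ?_⟩
    have hp0 : (p : ℂ) ≠ 0 := by
      have := (Fact.out (p := p.Prime)).ne_zero
      exact_mod_cast this
    apply mul_left_cancel₀ hp0
    have hm' : (x * b - y * a : ℂ) = p * m := by exact_mod_cast hm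
    have hn2' : (x * a + y * b : ℂ) = p * n := by exact_mod_cast hn2
    have hn3 : (a ^ 2 + b ^ 2 : ℂ) = p := by exact_mod_cast hn
    rw [hab]
    calc (p : ℂ) * (x + y * I) = (a ^ 2 + b ^ 2) * (x + y * I) := by rw [hn3]
      _ = (a + b * I) * ((x * a + y * b) - (x * b - y * a) * I) := by
          linear_combination (b * (x * b - y * a) : ℂ) * I_sq
      _ = p * ((a + b * I) * (n - m * I)) := by rw [hm', hn2']; ring
  · rintro ⟨d, hd, rfl⟩
    rw [h.resMap_mul h.mem hd, h.resMap_self, zero_mul]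

lemma gcong_iff {a b : ℂ} (ha : a ∈ O4) (hb : b ∈ O4) :
    GCong a b π ↔ resMap p π a = resMap p π b := by
  rw [← sub_eq_zero, ← resMap_sub ha hb, h.resMap_eq_zero (sub_mem ha hb), GCong]

lemma gcoprime_iff {a : ℂ} (ha : a ∈ O4) : GCoprime a π ↔ resMap p π a ≠ 0 := by
  constructor
  · rintro ⟨u, hu, v, hv, huv⟩ h0
    have := congrArg (resMap p π) huv
    rw [resMap_add (mul_mem hu ha) (mul_mem hv h.mem), h.resMap_mul hu ha, h.resMap_mul hv h.mem,
      h0, h.resMap_self, resMap_one] at this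
    simp at this
  · intro h0
    let n := ((resMap p π a)⁻¹).val
    have hn : (n : ZMod p) = (resMap p π a)⁻¹ := ZMod.natCast_zmod_val _
    have hmem : (n : ℂ) * a - 1 ∈ O4 := sub_mem (mul_mem (natCast_mem _ _) ha) (one_mem _)
    have : resMap p π (n * a - 1) = 0 := by
      rw [resMap_sub (mul_mem (natCast_mem _ _) ha) (one_mem _),
        h.resMap_mul (natCast_mem _ _) ha, resMap_natCast, hn, resMap_one, inv_mul_cancel₀ h0,
        sub_self]
    obtain ⟨d, hd, hd'⟩ := (h.resMap_eq_zero hmem).1 this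
    exact ⟨n, natCast_mem _ _, -d, neg_mem hd, by linear_combination hd'⟩


lemma two_ne_zero' : (2 : ZMod p) ≠ 0 := by
  have : NeZero p := ⟨(Fact.out (p := p.Prime)).ne_zero⟩
  intro h0
  have : (p : ℕ) ∣ 2 := (ZMod.natCast_eq_zero_iff 2 p).1 (by exact_mod_cast h0)
  have := (Nat.prime_dvd_prime_iff_eq Fact.out Nat.prime_two).1 this
  have h4 := h.mod_four
  omega

lemma mem_lemn_iff {ν : ℂ} (hν : ν ∈ O4) :
    (varpi : ℂ) * (ν / π) ∈ lemn.lattice ↔ resMap p π ν = 0 := by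
  have hπ := h.ne_zero
  rw [h.resMap_eq_zero hν, mem_lemn]
  constructor
  · rintro ⟨a, b, hab⟩
    refine ⟨a + b * I, mem_O4.2 ⟨a, b, rfl⟩, ?_⟩
    have := mul_left_cancel₀ varpi_ne_zero hab
    field_simp at this
    exact this
  · rintro ⟨d, hd, rfl⟩
    obtain ⟨a, b, rfl⟩ := mem_O4.1 hd
    exact ⟨a, b, by field_simp⟩

lemma two_mul_mem_lemn_iff {ν : ℂ} (hν : ν ∈ O4) :
    2 * ((varpi : ℂ) * (ν / π)) ∈ lemn.lattice ↔ resMap p π ν = 0 := by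
  have h2 : (2 : ℂ) ∈ O4 := by exact_mod_cast natCast_mem O4 2
  rw [show 2 * ((varpi : ℂ) * (ν / π)) = varpi * ((2 * ν) / π) by ring,
    h.mem_lemn_iff (mul_mem h2 hν), h.resMap_mul h2 hν]
  have : resMap p π 2 = 2 := by exact_mod_cast resMap_natCast p π 2
  rw [this, mul_eq_zero, or_iff_right h.two_ne_zero']

lemma apply_div_eq {f : ℂ → ℂ}
    (hf : ∀ u : ℂ, (varpi : ℂ) * u ∉ lemn.lattice → ∀ a b : ℤ, f (u + (a + b * I)) = f u)
    {ν μ : ℂ} (hν : ν ∈ O4) (hμ : μ ∈ O4) (h0 : resMap p π μ ≠ 0)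
    (heq : resMap p π ν = resMap p π μ) : f (ν / π) = f (μ / π) := by
  obtain ⟨d, hd, hd'⟩ := (h.gcong_iff hν hμ).2 heq
  obtain ⟨a, b, rfl⟩ := mem_O4.1 hd
  rw [← hf (μ / π) (by rwa [h.mem_lemn_iff hμ]) a b]
  congr 1
  have := h.ne_zero
  field_simp
  linear_combination hd'

end IsGaussPrime

/-- The value of a `ℤ[i]`-periodic function at the `π`-division point indexed by `n`. -/
def divVal (p : ℕ) (π : ℂ) (f : ℂ → ℂ) (n : ZMod p) : ℂ := f ((n.val : ℂ) / π)

/-- Relations between the values of the lemniscatic functions `φ`, `℘` and `Z` at the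
`π`-division points, indexed by `ZMod p`; `j` is the residue of `i`. -/
structure LemDivision (p : ℕ) (j : ZMod p) (x P Z : ZMod p → ℂ) : Prop where
  j_sq : j ^ 2 = -1
  two_ne : (2 : ZMod p) ≠ 0
  x_ne : ∀ n, n ≠ 0 → x n ≠ 0
  x_j : ∀ n, n ≠ 0 → x (j * n) = I * x n
  P_t : ∀ n, n ≠ 0 → P ((1 + j) * n) * x n ^ 2 = -1
  x_sq : ∀ n, n ≠ 0 → x n ^ 2 * (P n ^ 2 - 1) = -2 * I * P n
  P_sq_add : ∀ n, n ≠ 0 → P n ^ 2 + 1 ≠ 0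
  x_t : ∀ n, n ≠ 0 → x ((1 + j) * n) ^ 2 * (1 - x n ^ 4) = 2 * I * x n ^ 2
  x_t_lin : ∀ n, n ≠ 0 → x ((1 + j) * n) * (P n ^ 2 + 1) = (1 + I) * (P n ^ 2 - 1) * x n
  Z_j : ∀ n, n ≠ 0 → Z (j * n) = -I * Z n
  Z_t : ∀ n, n ≠ 0 → Z ((1 + j) * n) = (1 - I) * Z n + I * (x n)⁻¹
  Z_add_sq : ∀ a b, a ≠ 0 → b ≠ 0 → a + b ≠ 0 → a - b ≠ 0 →
    (Z (a + b) - Z a - Z b) ^ 2 = P a + P b + P (a + b)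

lemma lemP_add_int (u : ℂ) (a b : ℤ) : lemP (varpi * (u + (a + b * I))) = lemP (varpi * u) := by
  rw [mul_add]; exact lemn.weierstrassP_add_of_mem _ (mul_int_mem_lemn a b)

lemma lemP'_add_int (u : ℂ) (a b : ℤ) : lemP' (varpi * (u + (a + b * I))) = lemP' (varpi * u) := by
  rw [mul_add]; exact lemn.derivWeierstrassP_add_of_mem _ (mul_int_mem_lemn a b)

lemma phi4_add_int (u : ℂ) (a b : ℤ) : phi4 (u + (a + b * I)) = phi4 u := by
  rw [phi4_eq, phi4_eq, lemP_add_int, lemP'_add_int]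

namespace IsGaussPrime

variable {p : ℕ} [Fact p.Prime] {π : ℂ} (h : IsGaussPrime p π)

include h

lemma divVal_eq {f : ℂ → ℂ}
    (hf : ∀ u : ℂ, (varpi : ℂ) * u ∉ lemn.lattice → ∀ a b : ℤ, f (u + (a + b * I)) = f u)
    {ν : ℂ} (hν : ν ∈ O4) (n : ZMod p) (hn : n ≠ 0) (hνn : resMap p π ν = n) :
    f (ν / π) = divVal p π f n := by
  have hnn : resMap p π (n.val : ℂ) = n := by rw [resMap_natCast, ZMod.natCast_zmod_val]
  exact h.apply_div_eq hf hν (natCast_mem _ _) (by rwa [hnn]) (by rw [hνn, hnn])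

lemma one_add_resI_ne_zero : (1 + resI p π) ≠ 0 := by
  intro h0
  apply h.two_ne_zero'
  have := h.resI_sq
  linear_combination (1 - resI p π) * h0 + this

lemma notMem_div {n : ZMod p} (hn : n ≠ 0) :
    2 * ((varpi : ℂ) * ((n.val : ℂ) / π)) ∉ lemn.lattice := by
  rwa [h.two_mul_mem_lemn_iff (natCast_mem _ _), resMap_natCast, ZMod.natCast_zmod_val]

lemma lemDivision : LemDivision p (resI p π) (divVal p π phi4)
    (divVal p π fun u => lemP (varpi * u)) (divVal p π Z4) := by
  have hT := h.one_add_resI_ne_zero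
  have hj0 : resI p π ≠ 0 := fun h0 => by
    have := h.resI_sq
    simp [h0] at this
  have tI : (1 + I : ℂ) ∈ O4 := add_mem (one_mem _) I_mem_O4
  have rt : ∀ n : ZMod p, resMap p π ((1 + I) * (n.val : ℂ)) = (1 + resI p π) * n := fun n => by
    rw [h.resMap_mul tI (natCast_mem _ _), resMap_add (one_mem _) I_mem_O4, resMap_one, resMap_I,
      resMap_natCast, ZMod.natCast_zmod_val]
  have ri : ∀ n : ZMod p, resMap p π (I * (n.val : ℂ)) = resI p π * n := fun n => by
    rw [h.resMap_mul I_mem_O4 (natCast_mem _ _), resMap_I, resMap_natCast, ZMod.natCast_zmod_val]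
  have et : ∀ {f : ℂ → ℂ} (_ : ∀ u : ℂ, (varpi : ℂ) * u ∉ lemn.lattice →
      ∀ a b : ℤ, f (u + (a + b * I)) = f u) (n : ZMod p) (_ : n ≠ 0),
      divVal p π f ((1 + resI p π) * n) = f ((1 + I) * ((n.val : ℂ) / π)) := fun {f} hf n hn => by
    rw [← mul_div_assoc]
    exact (h.divVal_eq hf (mul_mem tI (natCast_mem _ _)) _ (mul_ne_zero hT hn) (rt n)).symm
  have ei : ∀ {f : ℂ → ℂ} (_ : ∀ u : ℂ, (varpi : ℂ) * u ∉ lemn.lattice →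
      ∀ a b : ℤ, f (u + (a + b * I)) = f u) (n : ZMod p) (_ : n ≠ 0),
      divVal p π f (resI p π * n) = f (I * ((n.val : ℂ) / π)) := fun {f} hf n hn => by
    rw [← mul_div_assoc]
    exact (h.divVal_eq hf (mul_mem I_mem_O4 (natCast_mem _ _)) _ (mul_ne_zero hj0 hn) (ri n)).symm
  have pphi := fun (u : ℂ) (_ : (varpi : ℂ) * u ∉ lemn.lattice) => phi4_add_int u
  have pP := fun (u : ℂ) (_ : (varpi : ℂ) * u ∉ lemn.lattice) => lemP_add_int u
  have pZ := fun (u : ℂ) (hu : (varpi : ℂ) * u ∉ lemn.lattice) => Z4_add_int hu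
  have nm := fun (n : ZMod p) (hn : n ≠ 0) => h.notMem_div hn
  have nmt : ∀ n : ZMod p, n ≠ 0 →
      2 * (varpi * ((1 + I) * ((n.val : ℂ) / π))) ∉ lemn.lattice := fun n hn => by
    rw [← mul_div_assoc, h.two_mul_mem_lemn_iff (mul_mem tI (natCast_mem _ _)), rt]
    exact mul_ne_zero hT hn
  refine ⟨h.resI_sq, h.two_ne_zero', fun n hn => phi4_ne_zero (nm n hn), fun n hn => ?_,
    fun n hn => ?_, fun n hn => phi4_sq (nm n hn),
    fun n hn => ?_, fun n hn => ?_, fun n hn => ?_, fun n hn => ?_, fun n hn => ?_,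
    fun a b ha hb hab hab' => ?_⟩
  · rw [ei pphi n hn, phi4_I_mul]; rfl
  · rw [et pP n hn]; exact lemP_one_add_I_mul_phi4_sq (nm n hn)
  · exact lemP_sq_add_one_ne_zero (nm n hn) (by rw [← varpi_mul_one_add_I]; exact nmt n hn)
  · rw [et pphi n hn]; exact phi4_one_add_I_mul (nm n hn) (nmt n hn)
  · rw [et pphi n hn]; exact phi4_one_add_I_mul_linear (nm n hn) (nmt n hn)
  · rw [ei pZ n hn, Z4_I_mul]; rfl
  · rw [et pZ n hn]; exact Z4_one_add_I_mul (nm n hn)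
  · have e1 : resMap p π ((a.val : ℂ) + b.val) = a + b := by
      rw [resMap_add (natCast_mem _ _) (natCast_mem _ _), resMap_natCast, resMap_natCast,
        ZMod.natCast_zmod_val, ZMod.natCast_zmod_val]
    have e2 : resMap p π ((a.val : ℂ) - b.val) = a - b := by
      rw [resMap_sub (natCast_mem _ _) (natCast_mem _ _), resMap_natCast, resMap_natCast,
        ZMod.natCast_zmod_val, ZMod.natCast_zmod_val]
    have m1 : (a.val : ℂ) + b.val ∈ O4 := add_mem (natCast_mem _ _) (natCast_mem _ _)
    have m2 : (a.val : ℂ) - b.val ∈ O4 := sub_mem (natCast_mem _ _) (natCast_mem _ _)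
    rw [← h.divVal_eq pZ m1 _ hab e1, ← h.divVal_eq pP m1 _ hab e1, add_div]
    refine Z4_add_sq ⟨notMem_of_two_mul (nm a ha), notMem_of_two_mul (nm b hb), ?_, ?_⟩
    · rwa [← mul_add, ← add_div, h.mem_lemn_iff m1, e1]
    · rwa [← mul_sub, ← sub_div, h.mem_lemn_iff m2, e2]

end IsGaussPrime

open Filter Topology

/-- The zero `ϖ(1+i)/2` of `℘`. -/
def lemC : ℂ := varpi * (1 + I) / 2

lemma two_mul_lemC : 2 * lemC ∈ lemn.lattice := mem_lemn.2 ⟨1, 1, by rw [lemC]; push_cast; ring⟩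

lemma lemC_notMem : lemC ∉ lemn.lattice := fun h => by
  obtain ⟨a, b, hab⟩ := mem_lemn.1 h
  have h1 : (1 + I : ℂ) / 2 = a + b * I :=
    mul_left_cancel₀ varpi_ne_zero (by rw [← hab, lemC]; ring)
  have h2 := congrArg Complex.re h1
  simp at h2
  have h3 : (1 : ℤ) = 2 * a := by
    have : (1 : ℝ) = 2 * a := by linarith
    exact_mod_cast this
  omega

lemma lemP_lemC : lemP lemC = 0 := by
  have h1 := lemP_I_mul lemC
  have h2 : lemP (I * lemC) = lemP lemC := by
    have : I * lemC = lemC + (-varpi : ℂ) := by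
      rw [lemC]; linear_combination (varpi / 2 : ℂ) * I_sq
    rw [this]
    exact lemn.weierstrassP_add_of_mem _ (mem_lemn.2 ⟨-1, 0, by simp⟩)
  rw [h2] at h1
  linear_combination h1 / 2

lemma lemP'_lemC : lemP' lemC = 0 := by
  have := lemP'_sq lemC_notMem
  rw [lemP_lemC] at this
  simpa using this

lemma lemP_add_lemC {u : ℂ} (hu : u ∉ lemn.lattice) (h0 : lemP u ≠ 0) :
    lemP (u + lemC) = -(lemP u)⁻¹ := by
  rw [show lemP (u + lemC) = _ from lemn.weierstrassP_add hu lemC_notMem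
    (by rw [show lemn.weierstrassP lemC = 0 from lemP_lemC]; exact h0), PeriodPair.chordSlope,
    show lemn.weierstrassP lemC = 0 from lemP_lemC,
    show lemn.derivWeierstrassP lemC = 0 from lemP'_lemC]
  have := lemP'_sq hu
  have h0' : lemn.weierstrassP u ≠ 0 := h0
  rw [sub_zero, sub_zero, sub_zero, div_pow, this]
  field_simp
  ring

lemma sub_lemC_mem {z : ℂ} (hz : z ∉ lemn.lattice) (h : lemP z = 0) : z - lemC ∈ lemn.lattice := by
  rcases lemP_eq_imp hz lemC_notMem (h.trans lemP_lemC.symm) with h1 | h1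
  · convert sub_mem h1 two_mul_lemC using 1; ring
  · exact h1

/-- `∏ ℘(u + ϖn/π) / ℘(πu)`, which turns out to be constant. -/
def divProd (p : ℕ) [NeZero p] (π u : ℂ) : ℂ :=
  (∏ n : ZMod p, lemP (u + varpi * ((n.val : ℂ) / π))) / lemP (π * u)

namespace IsGaussPrime

variable {p : ℕ} [Fact p.Prime] {π : ℂ} (h : IsGaussPrime p π)

include h

omit [Fact p.Prime] in
lemma mul_mem_lemn {l : ℂ} (hl : l ∈ lemn.lattice) : π * l ∈ lemn.lattice := by
  obtain ⟨a, b, rfl⟩ := mem_lemn.1 hl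
  obtain ⟨c, d, hcd⟩ := mem_O4.1 (mul_mem h.mem (mem_O4.2 ⟨a, b, rfl⟩))
  exact mem_lemn.2 ⟨c, d, by rw [← hcd]; ring⟩

lemma divProd_shift (u : ℂ) {ν : ℂ} (hν : ν ∈ O4) :
    divProd p π (u + varpi * (ν / π)) = divProd p π u := by
  have hπ := h.ne_zero
  rw [divProd, divProd]
  congr 1
  · rw [← Equiv.prod_comp (Equiv.addRight (resMap p π ν))
      (fun n => lemP (u + varpi * ((n.val : ℂ) / π)))]
    refine Finset.prod_congr rfl fun n _ => ?_
    rw [Equiv.coe_addRight]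
    have m1 : ((n + resMap p π ν).val : ℂ) ∈ O4 := natCast_mem _ _
    obtain ⟨d, hd, hd'⟩ := (h.gcong_iff (add_mem (natCast_mem _ n.val) hν) m1).2
      (by rw [resMap_add (natCast_mem _ _) hν, resMap_natCast, resMap_natCast,
        ZMod.natCast_zmod_val, ZMod.natCast_zmod_val])
    obtain ⟨a, b, rfl⟩ := mem_O4.1 hd
    rw [show u + varpi * (ν / π) + varpi * ((n.val : ℂ) / π)
      = u + varpi * (((n + resMap p π ν).val : ℂ) / π) + varpi * (a + b * I) by
        field_simp; linear_combination (varpi : ℂ) * hd']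
    exact lemn.weierstrassP_add_of_mem _ (mul_int_mem_lemn a b)
  · obtain ⟨a, b, rfl⟩ := mem_O4.1 hν
    rw [show π * (u + varpi * ((a + b * I) / π)) = π * u + varpi * (a + b * I) by field_simp]
    exact lemn.weierstrassP_add_of_mem _ (mul_int_mem_lemn a b)

lemma divVal_lemP_ne_zero {n : ZMod p} (hn : n ≠ 0) : lemP (varpi * ((n.val : ℂ) / π)) ≠ 0 :=
  lemP_ne_zero (h.notMem_div hn)

lemma divProd_near_zero : ∃ g : ℂ → ℂ, AnalyticAt ℂ g 0 ∧
    g 0 = π ^ 2 * ∏ n ∈ Finset.univ.erase (0 : ZMod p), lemP (varpi * ((n.val : ℂ) / π)) ∧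
    divProd p π =ᶠ[𝓝[≠] 0] g := by
  have hπ := h.ne_zero
  let E := lemn.weierstrassPExcept 0
  have aE : AnalyticAt ℂ E 0 := lemn.analyticAt_weierstrassPExcept 0
  have aEπ : AnalyticAt ℂ (fun u => E (π * u)) 0 := by
    refine AnalyticAt.comp (g := E) ?_ (by fun_prop)
    simpa using aE
  have aP : ∀ n ∈ Finset.univ.erase (0 : ZMod p),
      AnalyticAt ℂ (fun u => lemP (u + varpi * ((n.val : ℂ) / π))) 0 := fun n hn => by
    refine AnalyticAt.comp (g := lemP) ?_ (by fun_prop)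
    rw [zero_add]
    exact lemn.analyticOnNhd_weierstrassP _ (notMem_of_two_mul (h.notMem_div (Finset.ne_of_mem_erase hn)))
  refine ⟨fun u => (∏ n ∈ Finset.univ.erase (0 : ZMod p), lemP (u + varpi * ((n.val : ℂ) / π))) *
    (π ^ 2 * (1 + u ^ 2 * E u) / (1 + π ^ 2 * u ^ 2 * E (π * u))), ?_, ?_, ?_⟩
  · exact (Finset.analyticAt_fun_prod _ aP).mul (AnalyticAt.div (by fun_prop)
      (analyticAt_const.add ((by fun_prop : AnalyticAt ℂ (fun u : ℂ => π ^ 2 * u ^ 2) 0).mul aEπ))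
      (by simp))
  · simp; ring
  · filter_upwards [self_mem_nhdsWithin] with u hu
    have hu : u ≠ 0 := hu
    rw [divProd, ← Finset.mul_prod_erase _ _ (Finset.mem_univ (0 : ZMod p)), ZMod.val_zero]
    rw [show lemP (π * u) = E (π * u) + 1 / (π * u) ^ 2 from lemn.weierstrassP_eq_except_add _,
      Nat.cast_zero, zero_div, mul_zero, add_zero,
      show lemP u = E u + 1 / u ^ 2 from lemn.weierstrassP_eq_except_add _]
    have e1 : E u + 1 / u ^ 2 = (1 + u ^ 2 * E u) / u ^ 2 := by field_simp; ring
    have e2 : E (π * u) + 1 / (π * u) ^ 2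
        = (1 + π ^ 2 * u ^ 2 * E (π * u)) / (π ^ 2 * u ^ 2) := by field_simp; ring
    rw [e1, e2, mul_comm, mul_div_assoc]
    congr 1
    rw [div_div_div_eq, ← mul_assoc, mul_comm _ (u ^ 2), mul_div_mul_left _ _ (pow_ne_zero 2 hu)]
    ring

lemma sub_one_mul_lemC : (π - 1) * lemC ∈ lemn.lattice := by
  obtain ⟨a, b, hab, hn, -, -⟩ := h.exists_eq
  have h4 := h.mod_four
  have hodd : (a + b) % 2 = 1 := by
    have h1 : (a ^ 2 + b ^ 2) % 2 = 1 := by rw [hn]; omega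
    rcases Int.even_or_odd' a with ⟨x, rfl | rfl⟩ <;> rcases Int.even_or_odd' b with ⟨y, rfl | rfl⟩ <;>
      ring_nf at h1 ⊢ <;> omega
  obtain ⟨k, hk⟩ : ∃ k, a + b = 2 * k + 1 := ⟨(a + b) / 2, by omega⟩
  refine mem_lemn.2 ⟨k - b, k, ?_⟩
  have hk' : (a : ℂ) + b = 2 * k + 1 := by exact_mod_cast hk
  rw [hab, lemC]
  push_cast
  linear_combination (varpi * (1 + I) / 2 : ℂ) * hk' + (varpi * b / 2 : ℂ) * I_sq

lemma divProd_add_lemC {u : ℂ} (hu : π * u ∉ lemn.lattice)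
    (h1 : lemP (π * u) ≠ 0) (h2 : ∀ n : ZMod p, lemP (u + varpi * ((n.val : ℂ) / π)) ≠ 0) :
    divProd p π (u + lemC) = (divProd p π u)⁻¹ := by
  have hπ := h.ne_zero
  have e1 : lemP (π * (u + lemC)) = -(lemP (π * u))⁻¹ := by
    rw [show π * (u + lemC) = π * u + lemC + (π - 1) * lemC by ring, ← lemP_add_lemC hu h1]
    exact lemn.weierstrassP_add_of_mem _ h.sub_one_mul_lemC
  have e2 : ∀ n : ZMod p, lemP (u + lemC + varpi * ((n.val : ℂ) / π))
      = (-1) * (lemP (u + varpi * ((n.val : ℂ) / π)))⁻¹ := fun n => by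
    have hm : u + varpi * ((n.val : ℂ) / π) ∉ lemn.lattice := fun hm => by
      apply hu
      have := sub_mem (h.mul_mem_lemn hm) (mul_int_mem_lemn n.val 0)
      convert this using 1
      push_cast
      field_simp
      ring
    rw [add_right_comm, lemP_add_lemC hm (h2 n)]; ring
  rw [divProd, divProd, e1, Finset.prod_congr rfl fun n _ => e2 n, Finset.prod_mul_distrib,
    Finset.prod_const, Finset.card_univ, ZMod.card, Finset.prod_inv_distrib]
  have hp : Odd p := by
    have := h.mod_four
    rw [Nat.odd_iff]; omega
  rw [hp.neg_one_pow]
  field_simp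

lemma eventually_divProd_add_lemC (z : ℂ) :
    ∀ᶠ u in 𝓝[≠] z, divProd p π (u + lemC) = (divProd p π u)⁻¹ := by
  have hπ := h.ne_zero
  have key : ∀ a b : ℂ, a ≠ 0 → ∀ᶠ u in 𝓝[≠] z, a * u + b ∉ lemn.lattice ∧ lemP (a * u + b) ≠ 0 := by
    intro a b ha
    have hmap : Tendsto (fun u : ℂ => a * u + b) (𝓝[≠] z) (𝓝[≠] (a * z + b)) := by
      refine tendsto_nhdsWithin_iff.2 ⟨?_, ?_⟩
      · have : ContinuousAt (fun u : ℂ => a * u + b) z := by fun_prop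
        exact this.tendsto.mono_left nhdsWithin_le_nhds
      · filter_upwards [self_mem_nhdsWithin] with e he
        simpa [ha] using he
    refine hmap.eventually (p := fun w => w ∉ lemn.lattice ∧ lemP w ≠ 0)
      ((lemn.eventually_notMem_lattice _).and ?_)
    by_cases hm : a * z + b ∈ lemn.lattice
    · have hs : Tendsto (fun w : ℂ => w - (a * z + b)) (𝓝[≠] (a * z + b)) (𝓝[≠] 0) := by
        refine tendsto_nhdsWithin_iff.2 ⟨?_, ?_⟩
        · have : ContinuousAt (fun w : ℂ => w - (a * z + b)) (a * z + b) := by fun_prop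
          simpa using this.tendsto.mono_left nhdsWithin_le_nhds
        · filter_upwards [self_mem_nhdsWithin] with e he
          exact sub_ne_zero.2 he
      filter_upwards [hs.eventually (lemn.weierstrassP_eventually_ne_of_continuousAt
        (continuousAt_const (y := 0)))] with w hw
      rw [← sub_add_cancel w (a * z + b)]
      rwa [show lemP (w - (a * z + b) + (a * z + b)) = _ from lemn.weierstrassP_add_of_mem _ hm]
    · exact lemn.weierstrassP_eventually_ne hm 0
  filter_upwards [key π 0 hπ, eventually_all.2 fun n : ZMod p => key 1 (varpi * ((n.val : ℂ) / π))
    one_ne_zero] with u h1 h2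
  simp only [add_zero, one_mul] at h1 h2
  exact h.divProd_add_lemC h1.1 h1.2 fun n => (h2 n).2

lemma prod_lemP_sq :
    (π ^ 2 * ∏ n ∈ Finset.univ.erase (0 : ZMod p), lemP (varpi * ((n.val : ℂ) / π))) ^ 2 = 1 := by
  have hπ := h.ne_zero
  obtain ⟨g, ag, g0, hg⟩ := h.divProd_near_zero
  have hg0 : g 0 ≠ 0 := by
    rw [g0]
    exact mul_ne_zero (pow_ne_zero 2 hπ) (Finset.prod_ne_zero_iff.2 fun n hn =>
      h.divVal_lemP_ne_zero (Finset.ne_of_mem_erase hn))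
  have sub_map : ∀ z c : ℂ, Tendsto (fun w : ℂ => w - c) (𝓝[≠] z) (𝓝[≠] (z - c)) := fun z c => by
    refine tendsto_nhdsWithin_iff.2 ⟨?_, ?_⟩
    · have : ContinuousAt (fun w : ℂ => w - c) z := by fun_prop
      simpa using this.tendsto.mono_left nhdsWithin_le_nhds
    · filter_upwards [self_mem_nhdsWithin] with e he
      simpa [sub_left_inj] using he
  have near : ∀ z, π * z ∈ lemn.lattice → ∃ g, AnalyticAt ℂ g z ∧ g z ≠ 0 ∧
      divProd p π =ᶠ[𝓝[≠] z] g := fun z hz => by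
    obtain ⟨a, b, hab⟩ := mem_lemn.1 hz
    have hz' : z = varpi * ((a + b * I) / π) := by field_simp; linear_combination hab
    refine ⟨fun w => g (w - z), ?_, by simpa using hg0, ?_⟩
    · refine AnalyticAt.comp (g := g) ?_ (by fun_prop)
      simpa using ag
    · have := sub_map z z
      rw [sub_self] at this
      filter_upwards [this.eventually hg] with w hw
      rw [← hw, ← h.divProd_shift (w - z) (mem_O4.2 ⟨a, b, rfl⟩), ← hz', sub_add_cancel]
  obtain ⟨c, hc⟩ := lemn.eventually_eq_const_of_periodic (f := divProd p π)
    (by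
      intro z
      by_cases hz : π * z ∈ lemn.lattice
      · obtain ⟨g, ag, -, hg⟩ := near z hz
        exact ⟨g, ag, hg⟩
      by_cases h0 : lemP (π * z) = 0
      · have hz' : π * (z - lemC) ∈ lemn.lattice := by
          have := sub_mem (sub_lemC_mem hz h0) h.sub_one_mul_lemC
          convert this using 1
          ring
        obtain ⟨g, ag, hg1, hg⟩ := near _ hz'
        have a1 : AnalyticAt ℂ (fun w => g (w - lemC)) z :=
          AnalyticAt.comp (g := g) ag (by fun_prop)
        refine ⟨fun w => (g (w - lemC))⁻¹, a1.inv hg1, ?_⟩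
        filter_upwards [(sub_map z lemC).eventually (hg.and (h.eventually_divProd_add_lemC _))]
          with w hw
        rw [← hw.1, ← hw.2, sub_add_cancel]
      · refine ⟨_, ?_, EventuallyEq.rfl⟩
        refine AnalyticAt.div (Finset.analyticAt_fun_prod _ fun n _ => ?_) ?_ h0
        · refine AnalyticAt.comp (g := lemP) ?_ (by fun_prop)
          refine lemn.analyticOnNhd_weierstrassP _ fun hm => hz ?_
          have := sub_mem (h.mul_mem_lemn hm) (mul_int_mem_lemn n.val 0)
          convert this using 1
          push_cast
          field_simp
          ring
        · exact AnalyticAt.comp (g := lemP) (lemn.analyticOnNhd_weierstrassP _ hz) (by fun_prop))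
    (fun z l hl => by
      obtain ⟨a, b, rfl⟩ := mem_lemn.1 hl
      rw [← h.divProd_shift z (mul_mem h.mem (mem_O4.2 ⟨a, b, rfl⟩))]
      congr 3
      field_simp)
  have hcg : c = g 0 := by
    have t1 : Tendsto g (𝓝[≠] 0) (𝓝 (g 0)) := ag.continuousAt.tendsto.mono_left nhdsWithin_le_nhds
    refine tendsto_nhds_unique (tendsto_const_nhds.congr' ?_) t1
    filter_upwards [hg, hc 0] with w h1 h2
    rw [← h1, h2]
  obtain ⟨w, h1, h2, h3⟩ := ((hc 0).and (((sub_map 0 (-lemC)).eventually (hc _)).and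
    (h.eventually_divProd_add_lemC 0))).exists
  rw [sub_neg_eq_add] at h2
  rw [h1, h2] at h3
  rw [← g0, ← hcg, sq]
  nth_rewrite 1 [h3]
  exact inv_mul_cancel₀ (by rw [hcg]; exact hg0)

theorem prod_phi4_pow_four :
    (∏ n ∈ Finset.univ.erase (0 : ZMod p), divVal p π phi4 n) ^ 4 = π ^ 4 := by
  have hd := h.lemDivision
  have hT := h.one_add_resI_ne_zero
  have h1 := h.prod_lemP_sq
  have h2 : (∏ n ∈ Finset.univ.erase (0 : ZMod p), lemP (varpi * ((n.val : ℂ) / π)))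
      = ∏ n ∈ Finset.univ.erase (0 : ZMod p),
        divVal p π (fun u => lemP (varpi * u)) ((1 + resI p π) * n) := by
    symm
    refine Finset.prod_nbij (fun n => (1 + resI p π) * n) ?_ ?_ ?_ fun _ _ => rfl
    · intro n hn
      simpa [hT] using hn
    · intro a _ b _ hab
      exact mul_left_cancel₀ hT hab
    · intro b hb
      refine ⟨(1 + resI p π)⁻¹ * b, ?_, mul_inv_cancel_left₀ hT b⟩
      simpa [hT] using hb
  have h3 : (∏ n ∈ Finset.univ.erase (0 : ZMod p), lemP (varpi * ((n.val : ℂ) / π))) ^ 2 *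
      (∏ n ∈ Finset.univ.erase (0 : ZMod p), divVal p π phi4 n) ^ 4 = 1 := by
    rw [h2, ← Finset.prod_pow, ← Finset.prod_pow, ← Finset.prod_mul_distrib]
    refine Finset.prod_eq_one fun n hn => ?_
    have := hd.P_t n (Finset.ne_of_mem_erase hn)
    linear_combination (divVal p π (fun u => lemP (varpi * u)) ((1 + resI p π) * n) *
      divVal p π phi4 n ^ 2 - 1) * this
  linear_combination π ^ 4 * h3 - (∏ n ∈ Finset.univ.erase (0 : ZMod p), divVal p π phi4 n) ^ 4 * h1

end IsGaussPrime

lemma isIntegral_of_forall_valuation_le_one {z : ℂ}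
    (h : ∀ V : ValuationSubring ℂ, V.valuation z ≤ 1) : IsIntegral ℤ z := by
  have h1 : z ∈ (⨅ V : {V : ValuationSubring ℂ // (∅ : Set ℂ) ⊆ V.toSubring}, V.1.toSubring) := by
    rw [Subring.mem_iInf]
    exact fun V => (V.1.valuation_le_one_iff z).1 (h V.1)
  rw [iInf_valuationSubring_superset] at h1
  have h2 : IsIntegral (Subring.closure (∅ : Set ℂ)) z := h1
  have h3 : Algebra.IsIntegral ℤ (Subring.closure (∅ : Set ℂ)) := ⟨fun x => by
    have hx : (x : ℂ) ∈ (⊥ : Subring ℂ) := by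
      rw [← Subring.closure_empty]; exact x.2
    obtain ⟨m, hm⟩ := Subring.mem_bot.1 hx
    have : x = (m : Subring.closure (∅ : Set ℂ)) := Subtype.ext (by simpa using hm.symm)
    rw [this]
    exact isIntegral_algebraMap (R := ℤ) (x := m)⟩
  exact isIntegral_trans (A := Subring.closure (∅ : Set ℂ)) z h2

lemma IsIntegral.valuation_le_one {z : ℂ} (h : IsIntegral ℤ z) (V : ValuationSubring ℂ) :
    V.valuation z ≤ 1 := by
  rw [V.valuation_le_one_iff]
  have h1 : IsIntegral V z := h.tower_top
  obtain ⟨y, hy⟩ := IsIntegrallyClosed.isIntegral_iff.1 h1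
  rw [← hy]; exact y.2

namespace ValuationSubring

variable (V : ValuationSubring ℂ)

lemma valuation_I : V.valuation I = 1 := by
  have h : V.valuation I ^ 4 = 1 := by rw [← map_pow, I_pow_four, map_one]
  exact (pow_eq_one_iff_of_nonneg zero_le (by norm_num)).1 h

lemma valuation_two_le : V.valuation 2 ≤ 1 := by
  exact V.valuation_le_one 2

end ValuationSubring

namespace LemDivision

variable {p : ℕ} [Fact p.Prime] {j : ZMod p} {x P Z : ZMod p → ℂ} (h : LemDivision p j x P Z)

include h

lemma one_add_j_ne_zero : 1 + j ≠ 0 := fun h0 => h.two_ne (by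
  linear_combination (1 - j) * h0 + h.j_sq)

lemma j_ne_zero : j ≠ 0 := fun h0 => by
  have := h.j_sq
  simp [h0] at this

lemma t_pow_mul_ne_zero {n : ZMod p} (hn : n ≠ 0) (k : ℕ) : (1 + j) ^ k * n ≠ 0 :=
  mul_ne_zero (pow_ne_zero _ h.one_add_j_ne_zero) hn

lemma t_pow_card_sub_one : (1 + j) ^ (p - 1) = 1 :=
  ZMod.pow_card_sub_one_eq_one h.one_add_j_ne_zero

variable (V : ValuationSubring ℂ)

lemma valuation_x_t {n : ZMod p} (hn : n ≠ 0) :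
    V.valuation (x ((1 + j) * n)) ^ 2 * V.valuation (1 - x n ^ 4)
      = V.valuation 2 * V.valuation (x n) ^ 2 := by
  have := congrArg V.valuation (h.x_t n hn)
  simpa only [map_mul, map_pow, V.valuation_I, mul_one] using this

lemma valuation_x_t_of_lt {n : ZMod p} (hn : n ≠ 0) (hlt : V.valuation (x n) < 1) :
    V.valuation (x ((1 + j) * n)) ^ 2 = V.valuation 2 * V.valuation (x n) ^ 2 := by
  have h1 := h.valuation_x_t V hn
  rwa [Valuation.map_one_sub_of_lt, mul_one] at h1
  rw [map_pow]
  exact pow_lt_one₀ zero_le hlt (by norm_num)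

lemma valuation_x_t_pow_of_lt {n : ZMod p} (hn : n ≠ 0) (hlt : V.valuation (x n) < 1) (k : ℕ) :
    V.valuation (x ((1 + j) ^ k * n)) < 1 ∧
    V.valuation (x ((1 + j) ^ k * n)) ^ 2 = V.valuation 2 ^ k * V.valuation (x n) ^ 2 := by
  induction k with
  | zero => simpa using hlt
  | succ k ih =>
    have h1 := h.valuation_x_t_of_lt V (h.t_pow_mul_ne_zero hn k) ih.1
    rw [pow_succ', mul_assoc]
    refine ⟨?_, by rw [h1, ih.2, pow_succ' (V.valuation 2), mul_assoc]⟩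
    rw [← pow_lt_one_iff_of_nonneg zero_le two_ne_zero, h1]
    exact mul_lt_one_of_nonneg_of_lt_one_right V.valuation_two_le zero_le
      (pow_lt_one₀ zero_le ih.1 two_ne_zero)

lemma valuation_two_of_lt {n : ZMod p} (hn : n ≠ 0) (hlt : V.valuation (x n) < 1) :
    V.valuation 2 = 1 := by
  have h1 := (h.valuation_x_t_pow_of_lt V hn hlt (p - 1)).2
  rw [h.t_pow_card_sub_one, one_mul] at h1
  have h0 : V.valuation (x n) ^ 2 ≠ 0 := pow_ne_zero _ ((V.valuation.ne_zero_iff).2 (h.x_ne n hn))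
  have h2 : V.valuation 2 ^ (p - 1) = 1 := by
    apply mul_right_cancel₀ h0
    rw [← h1, one_mul]
  have hp := (Fact.out (p := p.Prime)).two_le
  exact (pow_eq_one_iff_of_nonneg zero_le (by omega)).1 h2

lemma valuation_x_le_one {n : ZMod p} (hn : n ≠ 0) : V.valuation (x n) ≤ 1 := by
  by_contra! hlt
  have hx0 : V.valuation (x n) ≠ 0 := (V.valuation.ne_zero_iff).2 (h.x_ne n hn)
  have h4 : V.valuation (1 - x n ^ 4) = V.valuation (x n) ^ 4 := by
    rw [Valuation.map_sub_eq_of_lt_right, map_pow]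
    rw [map_one, map_pow]
    exact one_lt_pow₀ hlt (by norm_num)
  have h1 := h.valuation_x_t V hn
  rw [h4] at h1
  have h2 : V.valuation (x ((1 + j) * n)) ^ 2 * V.valuation (x n) ^ 2 = V.valuation 2 := by
    apply mul_right_cancel₀ (pow_ne_zero 2 hx0)
    rw [← h1, mul_assoc, ← pow_add]
  have h3 : V.valuation (x ((1 + j) * n)) < 1 := by
    by_contra! hge
    have h5 : 1 < V.valuation (x ((1 + j) * n)) ^ 2 * V.valuation (x n) ^ 2 :=
      one_lt_mul_of_le_of_lt (one_le_pow₀ hge) (one_lt_pow₀ hlt two_ne_zero)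
    rw [h2] at h5
    exact absurd V.valuation_two_le (not_le.2 h5)
  have h6 := (h.valuation_x_t_pow_of_lt V (mul_ne_zero h.one_add_j_ne_zero hn) h3 (p - 2)).1
  have hp := (Fact.out (p := p.Prime)).two_le
  rw [← mul_assoc, ← pow_succ, show p - 2 + 1 = p - 1 by omega, h.t_pow_card_sub_one, one_mul] at h6
  exact absurd hlt (not_lt.2 h6.le)

lemma valuation_x_t_eq {n : ZMod p} (hn : n ≠ 0) :
    V.valuation (x ((1 + j) * n)) = V.valuation (x n) := by
  have ht : (1 + j) * n ≠ 0 := mul_ne_zero h.one_add_j_ne_zero hn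
  rcases (h.valuation_x_le_one V hn).lt_or_eq with hlt | heq
  · have h1 := h.valuation_x_t_of_lt V hn hlt
    rw [h.valuation_two_of_lt V hn hlt, one_mul] at h1
    exact (pow_left_inj₀ zero_le zero_le two_ne_zero).1 h1
  · rcases (h.valuation_x_le_one V ht).lt_or_eq with hlt | heq'
    · have h6 := (h.valuation_x_t_pow_of_lt V ht hlt (p - 2)).1
      have hp := (Fact.out (p := p.Prime)).two_le
      rw [← mul_assoc, ← pow_succ, show p - 2 + 1 = p - 1 by omega, h.t_pow_card_sub_one,
        one_mul] at h6
      exact absurd heq h6.ne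
    · rw [heq, heq']

lemma valuation_one_sub_x_pow_four {n : ZMod p} (hn : n ≠ 0) :
    V.valuation (1 - x n ^ 4) = V.valuation 2 := by
  have h1 := h.valuation_x_t V hn
  rw [h.valuation_x_t_eq V hn, mul_comm] at h1
  exact mul_right_cancel₀ (pow_ne_zero _ ((V.valuation.ne_zero_iff).2 (h.x_ne n hn))) h1

omit V

end LemDivision

lemma exists_ringEquiv_of_isTranscendenceBasis {R K L ι κ : Type*} [CommRing R] [Field K] [Field L]
    [Algebra R K] [Algebra R L] [IsAlgClosed K] [IsAlgClosed L] {v : ι → K} {w : κ → L} (e : ι ≃ κ)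
    (hv : IsTranscendenceBasis R v) (hw : IsTranscendenceBasis R w) :
    ∃ σ : K ≃+* L, ∀ r, σ (algebraMap R K r) = algebraMap R L r := by
  have := IsAlgClosed.isAlgClosure_of_transcendence_basis v hv
  have := IsAlgClosed.isAlgClosure_of_transcendence_basis w hw
  let e' : Algebra.adjoin R (Set.range v) ≃ₐ[R] Algebra.adjoin R (Set.range w) :=
    (hv.1.aevalEquiv.symm.trans (MvPolynomial.renameEquiv R e)).trans hw.1.aevalEquiv
  refine ⟨IsAlgClosure.equivOfEquiv K L e'.toRingEquiv, fun r => ?_⟩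
  have := IsAlgClosure.equivOfEquiv_algebraMap K L e'.toRingEquiv (algebraMap R _ r)
  rw [← IsScalarTower.algebraMap_apply] at this
  rw [this]
  have h2 : e'.toRingEquiv (algebraMap R _ r) = algebraMap R _ r := e'.commutes r
  rw [h2, ← IsScalarTower.algebraMap_apply]

/-- Any two embeddings of a countable field into `ℂ` differ by an automorphism of `ℂ`. -/
lemma exists_ringHom_comp_eq {F : Type} [Field F] [Countable F] (i₁ i₂ : F →+* ℂ) :
    ∃ σ : ℂ →+* ℂ, ∀ x, σ (i₁ x) = i₂ x := by
  have key : ∀ i : F →+* ℂ, ∃ (ι : Type) (v : ι → ℂ),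
      @IsTranscendenceBasis ι F ℂ _ _ i.toAlgebra v ∧ Cardinal.mk ι = Cardinal.mk ℂ := fun i => by
    let _ : Algebra F ℂ := i.toAlgebra
    obtain ⟨s, hs⟩ := exists_isTranscendenceBasis F ℂ
    refine ⟨_, _, hs, ?_⟩
    have h := IsAlgClosed.cardinal_eq_cardinal_transcendence_basis_of_aleph0_lt _ hs
      (Cardinal.mk_le_aleph0) (by rw [Cardinal.mk_complex]; exact Cardinal.aleph0_lt_continuum)
    simpa using h.symm
  obtain ⟨ι, v, hv, hι⟩ := key i₁
  obtain ⟨κ, w, hw, hκ⟩ := key i₂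
  obtain ⟨e⟩ := Cardinal.eq.1 (hι.trans hκ.symm)
  obtain ⟨σ, hσ⟩ := @exists_ringEquiv_of_isTranscendenceBasis F ℂ ℂ ι κ _ _ _ i₁.toAlgebra i₂.toAlgebra
    _ _ v w e hv hw
  exact ⟨σ.toRingHom, hσ⟩

open IntermediateField in
lemma exists_rat_of_forall_ringHom {z : ℂ} (hz : IsAlgebraic ℚ z)
    (h : ∀ σ : ℂ →+* ℂ, σ I = I → σ z = z) : ∃ a b : ℚ, z = a + b * I := by
  have hI : IsIntegral ℚ I := ⟨Polynomial.X ^ 2 + 1, by monicity!, by simp⟩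
  have hfin : FiniteDimensional ℚ ℚ⟮I⟯ := adjoin.finiteDimensional hI
  have hzK : IsIntegral ℚ⟮I⟯ z := hz.isIntegral.tower_top
  have hfin2 : FiniteDimensional ℚ⟮I⟯ ℚ⟮I⟯⟮z⟯ := adjoin.finiteDimensional hzK
  have hfin3 : FiniteDimensional ℚ ℚ⟮I⟯⟮z⟯ := FiniteDimensional.trans ℚ ℚ⟮I⟯ _
  have hcount : Countable ℚ⟮I⟯⟮z⟯ :=
    (Module.finBasis ℚ ℚ⟮I⟯⟮z⟯).equivFun.toEquiv.injective.countable
  have hroots : ∀ y ∈ (minpoly ℚ⟮I⟯ z).aroots ℂ, y = z := fun y hy => by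
    let φ := (algHomAdjoinIntegralEquiv ℚ⟮I⟯ (K := ℂ) hzK).symm ⟨y, hy⟩
    have hφ : φ (AdjoinSimple.gen ℚ⟮I⟯ z) = y := algHomAdjoinIntegralEquiv_symm_apply_gen ℚ⟮I⟯ hzK _
    obtain ⟨σ, hσ⟩ := exists_ringHom_comp_eq (algebraMap ℚ⟮I⟯⟮z⟯ ℂ) φ.toRingHom
    have h1 : σ I = I := by
      have h2 := hσ (algebraMap ℚ⟮I⟯ _ (AdjoinSimple.gen ℚ I))
      have h3 : φ (algebraMap ℚ⟮I⟯ _ (AdjoinSimple.gen ℚ I)) = I := by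
        rw [φ.commutes]; rfl
      exact h2.trans h3
    have h2 := hσ (AdjoinSimple.gen ℚ⟮I⟯ z)
    have h3 : σ z = φ (AdjoinSimple.gen ℚ⟮I⟯ z) := h2
    rw [← hφ, ← h3, h σ h1]
  have hdeg : (minpoly ℚ⟮I⟯ z).natDegree = 1 := by
    have hsep : (minpoly ℚ⟮I⟯ z).Separable := (minpoly.irreducible hzK).separable
    have h1 := Polynomial.card_rootSet_eq_natDegree hsep
      (IsAlgClosed.splits ((minpoly ℚ⟮I⟯ z).map (algebraMap ℚ⟮I⟯ ℂ)))
    have h2 : (minpoly ℚ⟮I⟯ z).rootSet ℂ ⊆ {z} := fun y hy => by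
      rw [Polynomial.rootSet_def] at hy
      exact hroots y (by simpa using hy)
    have h3 := Set.ncard_le_ncard h2
    rw [Set.ncard_singleton, ← Nat.card_coe_set_eq, Nat.card_eq_fintype_card, h1] at h3
    exact le_antisymm h3 (minpoly.natDegree_pos hzK)
  obtain ⟨y, hy⟩ := (minpoly.natDegree_eq_one_iff).1 hdeg
  have h4 : ∀ w ∈ Algebra.adjoin ℚ {I}, ∃ a b : ℚ, w = a + b * I := fun w hw => by
    induction hw using Algebra.adjoin_induction with
    | mem w hw => exact ⟨0, 1, by rw [Set.mem_singleton_iff.1 hw]; push_cast; ring⟩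
    | algebraMap r => exact ⟨r, 0, by simp⟩
    | add w w' _ _ h h' =>
      obtain ⟨⟨a, b, rfl⟩, c, d, rfl⟩ := And.intro h h'
      exact ⟨a + c, b + d, by push_cast; ring⟩
    | mul w w' _ _ h h' =>
      obtain ⟨⟨a, b, rfl⟩, c, d, rfl⟩ := And.intro h h'
      exact ⟨a * c - b * d, a * d + b * c, by push_cast; linear_combination (b * d : ℂ) * I_sq⟩
  rw [← hy]
  refine h4 _ ?_
  rw [← adjoin_simple_toSubalgebra_of_isAlgebraic hI.isAlgebraic]
  exact y.2

/-- The lemniscatic curve over `ℚ`. -/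
def ratCurve : WeierstrassCurve ℚ := ⟨0, 0, 0, -1, 0⟩

lemma ratCurve_isModel : lemn.IsModel (ratCurve.baseChange ℂ) := by
  have h : ratCurve.baseChange ℂ = lemnCurve := by
    simp only [ratCurve, lemnCurve, lemn_g₂, lemn_g₃, WeierstrassCurve.baseChange,
      WeierstrassCurve.map]
    norm_num
  rw [h]
  exact lemnCurve_isModel

/-- `w` is the parameter of the image under `σ` of the point with parameter `z`. -/
def LemConj (σ : ℂ →+* ℂ) (z w : ℂ) : Prop :=
  WeierstrassCurve.Affine.Point.map (W' := ratCurve) σ.toRatAlgHom (ratCurve_isModel.hom z) =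
    ratCurve_isModel.hom w

namespace LemConj

variable {σ : ℂ →+* ℂ} {z w z' w' : ℂ}

lemma sub (h : LemConj σ z w) (h' : LemConj σ z' w') : LemConj σ (z - z') (w - w') := by
  rw [LemConj, map_sub, map_sub, map_sub, h, h']

lemma int_mul (h : LemConj σ z w) (n : ℤ) : LemConj σ (n * z) (n * w) := by
  rw [← zsmul_eq_mul, ← zsmul_eq_mul, LemConj, map_zsmul, map_zsmul, map_zsmul, h]

lemma mem_iff (h : LemConj σ z w) : z ∈ lemn.lattice ↔ w ∈ lemn.lattice := by
  have h' : _ = ratCurve_isModel.hom w := h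
  rw [← ratCurve_isModel.hom_eq_zero, ← ratCurve_isModel.hom_eq_zero, ← h']
  exact ((map_eq_zero_iff _
    (WeierstrassCurve.Affine.Point.map_injective (W' := ratCurve) σ.toRatAlgHom))).symm

lemma iff_of_notMem (hz : z ∉ lemn.lattice) (hw : w ∉ lemn.lattice) :
    LemConj σ z w ↔ σ (lemP z) = lemP w ∧ σ (lemP' z) = lemP' w := by
  rw [LemConj, ratCurve_isModel.hom_apply hz, ratCurve_isModel.hom_apply hw,
    WeierstrassCurve.Affine.Point.map_some, WeierstrassCurve.Affine.Point.some.injEq]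
  refine and_congr Iff.rfl ?_
  change σ (lemP' z / 2) = lemP' w / 2 ↔ _
  rw [map_div₀, map_ofNat]
  exact div_left_inj' two_ne_zero

lemma I_mul (hσ : σ I = I) (h : LemConj σ z w) : LemConj σ (I * z) (I * w) := by
  by_cases hz : z ∈ lemn.lattice
  · have hw := h.mem_iff.1 hz
    rw [LemConj, ratCurve_isModel.hom_eq_zero.2 (I_mul_mem_lemn hz),
      ratCurve_isModel.hom_eq_zero.2 (I_mul_mem_lemn hw), map_zero]
  · have hw := mt h.mem_iff.2 hz
    have h1 := (iff_of_notMem hz hw).1 h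
    rw [iff_of_notMem (mt I_mul_mem_lemn_iff.1 hz) (mt I_mul_mem_lemn_iff.1 hw)]
    rw [lemP_I_mul, lemP_I_mul, lemP'_I_mul, lemP'_I_mul, map_neg, map_mul, hσ, h1.1, h1.2]
    exact ⟨rfl, rfl⟩

lemma exists_of_notMem (σ : ℂ →+* ℂ) (hz : z ∉ lemn.lattice) :
    ∃ w, w ∉ lemn.lattice ∧ LemConj σ z w := by
  obtain ⟨w, hw, h1, h2⟩ := ratCurve_isModel.exists_hom_eq
    ((WeierstrassCurve.Affine.baseChange_nonsingular ratCurve (f := σ.toRatAlgHom) σ.toRatAlgHom.injective ..).mpr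
    (ratCurve_isModel.nonsingular hz))
  refine ⟨w, hw, (iff_of_notMem hz hw).2 ⟨h1.symm, ?_⟩⟩
  rw [lemP', h2]
  change _ = 2 * σ (lemP' z / 2)
  rw [map_div₀, map_ofNat]
  ring

end LemConj

namespace IsGaussPrime

variable {p : ℕ} [Fact p.Prime] {π : ℂ} (h : IsGaussPrime p π)

include h

/-- Galois action on the `π`-division values. -/
lemma exists_ringHom_divVal (σ : ℂ →+* ℂ) (hσ : σ I = I) :
    ∃ m : ZMod p, m ≠ 0 ∧ ∀ n ≠ 0, σ (divVal p π phi4 n) = divVal p π phi4 (m * n) := by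
  have hπ := h.ne_zero
  set c : ℂ := varpi * (1 / π) with hc_def
  have hmem : ∀ {ν : ℂ}, ν ∈ O4 → (ν * c ∈ lemn.lattice ↔ resMap p π ν = 0) := fun {ν} hν => by
    rw [← h.mem_lemn_iff hν, hc_def]
    congr! 1
    ring
  have hc : c ∉ lemn.lattice := by
    have := hmem (one_mem O4)
    rw [one_mul, resMap_one] at this
    rw [this]
    exact one_ne_zero
  obtain ⟨u, hu, hcu⟩ := LemConj.exists_of_notMem σ hc
  obtain ⟨a, b, hab, -⟩ := h.exists_eq
  set J : ℤ := ((resI p π).val : ℤ) with hJ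
  have hJ' : (J : ZMod p) = resI p π := by rw [hJ]; simp
  have h1 : (J - I) * u ∈ lemn.lattice := by
    have := (hcu.int_mul J).sub (hcu.I_mul hσ)
    rw [sub_mul, ← this.mem_iff, ← sub_mul, hmem (sub_mem (intCast_mem _ _) I_mem_O4)]
    have h2 := resMap_apply p π J (-1)
    rw [show (J - I : ℂ) = J + ((-1 : ℤ) : ℂ) * I by push_cast; ring, h2, hJ']
    push_cast; ring
  have h2 : ((a + b * J : ℤ) : ℂ) * u ∈ lemn.lattice := by
    rw [← (hcu.int_mul _).mem_iff, hmem (intCast_mem _ _)]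
    have h3 := resMap_apply p π (a + b * J) 0
    rw [Int.cast_zero, zero_mul, add_zero] at h3
    rw [h3]
    have h4 := h.resMap_self
    rw [hab, resMap_apply, ← hab] at h4
    push_cast
    rw [hJ', h4, zero_mul, add_zero]
  have h3 : π * u ∈ lemn.lattice := by
    have : π * u = ((a + b * J : ℤ) : ℂ) * u - b • ((J - I) * u) := by
      rw [zsmul_eq_mul, hab]; push_cast; ring
    rw [this]
    exact sub_mem h2 (lemn.lattice.smul_mem b h1)
  obtain ⟨d, e, hde⟩ := mem_lemn.1 h3
  set ν : ℂ := d + e * I with hν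
  have hνO : ν ∈ O4 := mem_O4.2 ⟨d, e, rfl⟩
  have hu' : u = varpi * (ν / π) := by
    field_simp
    linear_combination hde
  have hm : resMap p π ν ≠ 0 := by
    rw [Ne, ← h.mem_lemn_iff hνO, ← hu']; exact hu
  refine ⟨resMap p π ν, hm, fun n hn => ?_⟩
  have hnO : (n.val : ℂ) ∈ O4 := natCast_mem _ _
  have hn' : resMap p π n.val = n := by
    rw [resMap_natCast, ZMod.natCast_zmod_val]
  rw [← h.divVal_eq (fun u _ => phi4_add_int u) (mul_mem hνO hnO) (resMap p π ν * n) (mul_ne_zero hm hn)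
    (by rw [h.resMap_mul hνO hnO, hn']), divVal, phi4_eq, phi4_eq]
  have h4 := hcu.int_mul (n.val : ℤ)
  have h5 : ((n.val : ℤ) : ℂ) * c = varpi * (n.val / π) := by rw [hc_def]; push_cast; ring
  have h6 : ((n.val : ℤ) : ℂ) * u = varpi * (ν * n.val / π) := by rw [hu']; push_cast; ring
  rw [h5, h6] at h4
  have h7 : varpi * (n.val / π) ∉ lemn.lattice := by
    rw [h.mem_lemn_iff hnO, hn']; exact hn
  have h8 := (LemConj.iff_of_notMem h7 (mt h4.mem_iff.2 h7)).1 h4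
  rw [map_div₀, map_mul, map_mul, h8.1, h8.2, map_neg, map_sub, map_one, hσ, map_ofNat]

end IsGaussPrime

/-- A quartic character `c` of `ZMod p` sending a primitive fourth root of unity `j` to a power of
`I`, together with a set `T` of representatives modulo the powers of `j`. -/
structure QuarticSystem (p : ℕ) (j : ZMod p) (c : ZMod p → ℂ) (T : Finset (ZMod p)) : Prop where
  j_sq : j ^ 2 = -1
  two_ne : (2 : ZMod p) ≠ 0
  zero_notMem : 0 ∉ T
  exists_eq : ∀ n ≠ 0, ∃ s ∈ T, ∃ k < 4, n = j ^ k * s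
  unique : ∀ s ∈ T, ∀ s' ∈ T, ∀ k < 4, ∀ k' < 4, j ^ k * s = j ^ k' * s' → s = s' ∧ k = k'
  char_mul : ∀ m n, c (m * n) = c m * c n
  euler : ∀ n ≠ 0, ∃ k, c n = I ^ k ∧ n ^ ((p - 1) / 4) = j ^ k

lemma eq_of_pow_eq_of_sq_eq_neg_one {R : Type*} [CommRing R] [IsDomain R]
    {a : R} (ha : a ^ 2 = -1) (hR : (2 : R) ≠ 0) {k l : ℕ} (hk : k < 4) (hl : l < 4)
    (h : a ^ k = a ^ l) : k = l := by
  by_contra hne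
  apply hR
  interval_cases k <;> interval_cases l <;> first | omega | grind

lemma pow_eq_pow_of_sq_eq_neg_one {R S : Type*} [CommRing R] [CommRing S] [IsDomain R]
    {a : R} {b : S} (ha : a ^ 2 = -1) (hR : (2 : R) ≠ 0) (hb : b ^ 2 = -1)
    {k l : ℕ} (h : a ^ k = a ^ l) : b ^ k = b ^ l := by
  have ha4 : a ^ 4 = 1 := by linear_combination (a ^ 2 - 1) * ha
  have hb4 : b ^ 4 = 1 := by linear_combination (b ^ 2 - 1) * hb
  rw [pow_eq_pow_mod k ha4, pow_eq_pow_mod l ha4] at h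
  rw [pow_eq_pow_mod k hb4, pow_eq_pow_mod l hb4,
    eq_of_pow_eq_of_sq_eq_neg_one ha hR (Nat.mod_lt _ (by norm_num)) (Nat.mod_lt _ (by norm_num)) h]

namespace QuarticSystem

variable {p : ℕ} [Fact p.Prime] {j : ZMod p} {c : ZMod p → ℂ} {T : Finset (ZMod p)}
  (D : QuarticSystem p j c T)

include D

lemma ne_zero {s : ZMod p} (hs : s ∈ T) : s ≠ 0 := fun h => D.zero_notMem (h ▸ hs)

lemma j_ne_zero : j ≠ 0 := by
  rintro rfl
  have := D.j_sq
  simp at this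

@[to_additive]
lemma prod_erase_zero {M : Type*} [CommMonoid M] (f : ZMod p → M) :
    ∏ n ∈ Finset.univ.erase 0, f n = ∏ s ∈ T, ∏ k ∈ Finset.range 4, f (j ^ k * s) := by
  rw [← Finset.prod_product']
  symm
  refine Finset.prod_bij (fun a _ => j ^ a.2 * a.1) ?_ ?_ ?_ ?_
  · intro a ha
    rw [Finset.mem_product] at ha
    exact Finset.mem_erase.2 ⟨mul_ne_zero (pow_ne_zero _ D.j_ne_zero) (D.ne_zero ha.1), Finset.mem_univ _⟩
  · intro a ha b hb hab
    rw [Finset.mem_product, Finset.mem_range] at ha hb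
    have := D.unique _ ha.1 _ hb.1 _ ha.2 _ hb.2 hab
    exact Prod.ext this.1 this.2
  · intro n hn
    obtain ⟨s, hs, k, hk, rfl⟩ := D.exists_eq n (Finset.ne_of_mem_erase hn)
    exact ⟨(s, k), by simp [hs, hk], rfl⟩
  · intro a _; rfl

lemma card : T.card = (p - 1) / 4 := by
  have h := D.sum_erase_zero (fun _ => 1)
  simp [Finset.card_erase_of_mem, ZMod.card] at h
  omega

/-- Multiplication by `m` permutes the representatives up to powers of `j`. -/
lemma exists_perm {m : ZMod p} (hm : m ≠ 0) : ∃ (e : ZMod p → ZMod p) (k : ZMod p → ℕ),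
    (∀ s ∈ T, m * s = j ^ k s * e s) ∧
    ∀ {M : Type} [CommMonoid M] (f : ZMod p → M), ∏ s ∈ T, f (e s) = ∏ s ∈ T, f s := by
  have h1 : ∀ s : ZMod p, ∃ (e : ZMod p) (k : ℕ), s ∈ T → e ∈ T ∧ k < 4 ∧ m * s = j ^ k * e := by
    intro s
    by_cases hs : s ∈ T
    · obtain ⟨e, he, k, hk, h⟩ := D.exists_eq _ (mul_ne_zero hm (D.ne_zero hs))
      exact ⟨e, k, fun _ => ⟨he, hk, h⟩⟩
    · exact ⟨0, 0, fun h => absurd h hs⟩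
  choose e k he using h1
  have hinj : Set.InjOn e T := by
    intro s hs s' hs' hee
    have h1 := (he s hs).2.2
    have h2 := (he s' hs').2.2
    rw [← hee] at h2
    have h3 : m * (j ^ (k s') * s) = m * (j ^ (k s) * s') := by
      linear_combination j ^ k s' * h1 - j ^ k s * h2
    exact (D.unique s hs s' hs' _ (he s' hs').2.1 _ (he s hs).2.1 (mul_left_cancel₀ hm h3)).1
  refine ⟨e, k, fun s hs => (he s hs).2.2, fun f => ?_⟩
  refine Finset.prod_nbij e (fun s hs => (he s hs).1) hinj ?_ (fun _ _ => rfl)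
  exact Finset.surjOn_of_injOn_of_card_le e (fun s hs => (he s hs).1) hinj le_rfl

lemma map_eq {n : ZMod p} (hn : n ≠ 0) {k : ℕ} (h : n ^ ((p - 1) / 4) = j ^ k) : c n = I ^ k := by
  obtain ⟨l, hl, hl'⟩ := D.euler n hn
  rw [hl]
  exact pow_eq_pow_of_sq_eq_neg_one D.j_sq D.two_ne I_sq (hl'.symm.trans h)

lemma map_j : c j = I ^ ((p - 1) / 4) := D.map_eq D.j_ne_zero rfl

lemma map_pow_four {n : ZMod p} (hn : n ≠ 0) : c n ^ 4 = 1 := by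
  obtain ⟨l, hl, hl'⟩ := D.euler n hn
  rw [hl, ← pow_mul, mul_comm, pow_mul, I_pow_four, one_pow]

lemma map_ne_zero {n : ZMod p} (hn : n ≠ 0) : c n ≠ 0 := by
  intro h
  have := D.map_pow_four hn
  simp [h] at this

/-- Gauss's lemma for the quartic character. -/
lemma prod_mul {x : ZMod p → ℂ} (hx : ∀ n ≠ 0, x (j * n) = I * x n) {m : ZMod p} (hm : m ≠ 0) :
    ∏ s ∈ T, x (m * s) = c m * ∏ s ∈ T, x s := by
  obtain ⟨e, k, he, hprod⟩ := D.exists_perm hm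
  have hxp : ∀ k : ℕ, ∀ n ≠ 0, x (j ^ k * n) = I ^ k * x n := by
    intro k n hn
    induction k with
    | zero => simp
    | succ k ih =>
      rw [pow_succ', mul_assoc, hx _ (mul_ne_zero (pow_ne_zero _ D.j_ne_zero) hn), ih]
      ring
  have hene : ∀ s ∈ T, e s ≠ 0 := fun s hs h0 => by
    have := he s hs
    rw [h0, mul_zero] at this
    exact mul_ne_zero hm (D.ne_zero hs) this
  have h1 : m ^ ((p - 1) / 4) = j ^ (∑ s ∈ T, k s) := by
    have h2 : ∏ s ∈ T, (m * s) = ∏ s ∈ T, (j ^ k s * e s) := Finset.prod_congr rfl he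
    rw [Finset.prod_mul_distrib, Finset.prod_mul_distrib, Finset.prod_const, D.card,
      Finset.prod_pow_eq_pow_sum, hprod fun s => s] at h2
    exact mul_right_cancel₀ (Finset.prod_ne_zero_iff.2 fun s hs => D.ne_zero hs) h2
  rw [D.map_eq hm h1, ← Finset.prod_pow_eq_pow_sum, ← hprod x, ← Finset.prod_mul_distrib]
  exact Finset.prod_congr rfl fun s hs => by rw [he s hs, hxp _ _ (hene s hs)]

lemma sum_mul {F : ZMod p → ℂ} (hF : ∀ n ≠ 0, F (j * n) = F n) {m : ZMod p} (hm : m ≠ 0) :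
    ∑ s ∈ T, F (m * s) = ∑ s ∈ T, F s := by
  obtain ⟨e, k, he, hprod⟩ := D.exists_perm hm
  have hFp : ∀ k : ℕ, ∀ n ≠ 0, F (j ^ k * n) = F n := by
    intro k n hn
    induction k with
    | zero => simp
    | succ k ih =>
      rw [pow_succ', mul_assoc, hF _ (mul_ne_zero (pow_ne_zero _ D.j_ne_zero) hn), ih]
  have hene : ∀ s ∈ T, e s ≠ 0 := fun s hs h0 => by
    have := he s hs
    rw [h0, mul_zero] at this
    exact mul_ne_zero hm (D.ne_zero hs) this
  have := hprod (M := Multiplicative ℂ) (fun s => Multiplicative.ofAdd (F s))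
  rw [← ofAdd_sum, ← ofAdd_sum] at this
  rw [← Multiplicative.ofAdd.injective this]
  exact Finset.sum_congr rfl fun s hs => by rw [he s hs, hFp _ _ (hene s hs)]

end QuarticSystem

/-- `z` is fixed by every ring endomorphism of `ℂ` fixing `I`. -/
def FixedOverI (z : ℂ) : Prop := ∀ σ : ℂ →+* ℂ, σ I = I → σ z = z

namespace FixedOverI

variable {z w : ℂ}

lemma mul (hz : FixedOverI z) (hw : FixedOverI w) : FixedOverI (z * w) := fun σ h => by
  rw [map_mul, hz σ h, hw σ h]

lemma div (hz : FixedOverI z) (hw : FixedOverI w) : FixedOverI (z / w) := fun σ h => by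
  rw [map_div₀, hz σ h, hw σ h]

lemma of_mem_O4 (hz : z ∈ O4) : FixedOverI z := fun σ h => by
  obtain ⟨a, b, rfl⟩ := mem_O4.1 hz
  rw [map_add, map_mul, h, map_intCast, map_intCast]

end FixedOverI

lemma isIntegral_of_mem_O4 {z : ℂ} (hz : z ∈ O4) : IsIntegral ℤ z := by
  obtain ⟨a, b, rfl⟩ := mem_O4.1 hz
  have hI : IsIntegral ℤ I := ⟨Polynomial.X ^ 2 + 1, by monicity!, by simp⟩
  exact (isIntegral_algebraMap (x := a)).add ((isIntegral_algebraMap (x := b)).mul hI)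

lemma valuation_le_one_of_mem_O4 {z : ℂ} (hz : z ∈ O4) (V : ValuationSubring ℂ) :
    V.valuation z ≤ 1 := (isIntegral_of_mem_O4 hz).valuation_le_one V

lemma FixedOverI.mem_O4 {z : ℂ} (hz : FixedOverI z) (hi : IsIntegral ℤ z) : z ∈ O4 := by
  obtain ⟨a, b, rfl⟩ := exists_rat_of_forall_ringHom
    ((hi.tower_top (A := ℚ)).isAlgebraic) hz
  have hI : IsIntegral ℤ I := isIntegral_of_mem_O4 I_mem_O4
  have hc : IsIntegral ℤ ((a : ℂ) - b * I) := by
    have := hi.map (starRingEnd ℂ).toIntAlgHom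
    simpa [sub_eq_add_neg] using this
  have hInt : ∀ q : ℚ, IsIntegral ℤ (q : ℂ) → ∃ n : ℤ, q = n := fun q hq => by
    have : IsIntegral ℤ q := (isIntegral_algHom_iff (algebraMap ℚ ℂ).toIntAlgHom
      (algebraMap ℚ ℂ).injective).1 hq
    obtain ⟨n, hn⟩ := IsIntegrallyClosed.isIntegral_iff.1 this
    exact ⟨n, hn.symm⟩
  obtain ⟨m, hm⟩ := hInt (2 * a) (by
    rw [show ((2 * a : ℚ) : ℂ) = (a + b * I) + (a - b * I) by push_cast; ring]
    exact hi.add hc)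
  obtain ⟨n, hn⟩ := hInt (2 * b) (by
    rw [show ((2 * b : ℚ) : ℂ) = ((a + b * I) - (a - b * I)) * -I by
      push_cast; linear_combination (2 * b : ℂ) * I_sq]
    exact (hi.sub hc).mul hI.neg)
  obtain ⟨k, hk⟩ := hInt (a ^ 2 + b ^ 2) (by
    rw [show ((a ^ 2 + b ^ 2 : ℚ) : ℂ) = (a + b * I) * (a - b * I) by
      push_cast; linear_combination (b ^ 2 : ℂ) * I_sq]
    exact hi.mul hc)
  have h4 : m ^ 2 + n ^ 2 = 4 * k := by
    have : (m : ℚ) ^ 2 + n ^ 2 = 4 * k := by rw [← hm, ← hn, ← hk]; ring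
    exact_mod_cast this
  have hev : Even m ∧ Even n := by
    rcases Int.even_or_odd' m with ⟨m', rfl | rfl⟩ <;> rcases Int.even_or_odd' n with ⟨n', rfl | rfl⟩
    · simp
    all_goals exfalso; ring_nf at h4; omega
  obtain ⟨⟨m', rfl⟩, n', rfl⟩ := hev
  refine _root_.mem_O4.2 ⟨m', n', ?_⟩
  have h1 : a = m' := by push_cast at hm; linarith
  have h2 : b = n' := by push_cast at hn; linarith
  rw [h1, h2]; simp

lemma FixedOverI.mem_O4_of_valuation {z : ℂ} (hz : FixedOverI z)
    (hV : ∀ V : ValuationSubring ℂ, V.valuation z ≤ 1) : z ∈ O4 :=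
  hz.mem_O4 (isIntegral_of_forall_valuation_le_one hV)

/-- Reduction of Gaussian integers modulo `1 + I`. -/
def gaussPar (z : ℂ) : ZMod 2 := resMap 2 (1 + I) z

lemma gaussPar_apply (a b : ℤ) : gaussPar (a + b * I) = a + b := by
  have : resI 2 (1 + I) = 1 := by
    simp [resI]
  rw [gaussPar, resMap_apply, this, mul_one]

lemma gaussPar_sub {a b : ℂ} (ha : a ∈ O4) (hb : b ∈ O4) :
    gaussPar (a - b) = gaussPar a - gaussPar b := resMap_sub ha hb

lemma gaussPar_natCast (n : ℕ) : gaussPar n = n := resMap_natCast _ _ _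

lemma gaussPar_one : gaussPar 1 = 1 := resMap_one _ _

lemma gaussPar_mul {a b : ℂ} (ha : a ∈ O4) (hb : b ∈ O4) :
    gaussPar (a * b) = gaussPar a * gaussPar b := by
  obtain ⟨a, b, rfl⟩ := mem_O4.1 ha
  obtain ⟨c, d, rfl⟩ := mem_O4.1 hb
  rw [show ((a + b * I) * (c + d * I) : ℂ)
    = ((a * c - b * d : ℤ) : ℂ) + ((a * d + b * c : ℤ) : ℂ) * I by
    push_cast; linear_combination (b * d : ℂ) * I_sq, gaussPar_apply, gaussPar_apply, gaussPar_apply]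
  push_cast
  linear_combination (-(b : ZMod 2) * d) * (by decide : (2 : ZMod 2) = 0)

lemma gaussPar_pow {a : ℂ} (ha : a ∈ O4) (n : ℕ) : gaussPar (a ^ n) = gaussPar a ^ n := by
  induction n with
  | zero => simp [gaussPar_one]
  | succ n ih => rw [pow_succ, gaussPar_mul (pow_mem ha _) ha, ih, pow_succ]

lemma gaussPar_eq_zero_iff {a : ℂ} (ha : a ∈ O4) : gaussPar a = 0 ↔ ∃ d ∈ O4, a = (1 + I) * d := by
  have h1I : (1 + I) ∈ O4 := add_mem (one_mem _) I_mem_O4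
  constructor
  · obtain ⟨a, b, rfl⟩ := mem_O4.1 ha
    intro h
    rw [gaussPar_apply] at h
    have h2 : ((a + b : ℤ) : ZMod 2) = 0 := by push_cast; exact h
    obtain ⟨k, hk⟩ := (ZMod.intCast_zmod_eq_zero_iff_dvd _ 2).1 h2
    have hk' : (a : ℂ) + b = 2 * k := by exact_mod_cast hk
    refine ⟨k + (b - k : ℤ) * I, mem_O4.2 ⟨_, _, rfl⟩, ?_⟩
    push_cast
    linear_combination hk' - (b - k : ℂ) * I_sq
  · rintro ⟨d, hd, rfl⟩
    have : gaussPar (1 + I) = 0 := by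
      have := gaussPar_apply 1 1
      rw [Int.cast_one, one_mul] at this
      rw [this]; decide
    rw [gaussPar_mul h1I hd, this, zero_mul]

lemma gcong_one_iff {a : ℂ} (ha : a ∈ O4) : GCong a 1 (1 + I) ↔ gaussPar a = 1 := by
  rw [GCong, ← gaussPar_eq_zero_iff (sub_mem ha (one_mem _)), gaussPar_sub ha (one_mem _),
    gaussPar_one, sub_eq_zero]

lemma zmod_two_eq (a : ZMod 2) : a = 0 ∨ a = 1 := by
  revert a; decide

lemma gaussPar_eq_zero_of_two {a : ℂ} (ha : a ∈ O4)
    (hV : ∀ V : ValuationSubring ℂ, V.valuation a ≤ V.valuation 2) : gaussPar a = 0 := by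
  have h2 : (2 : ℂ) ∈ O4 := by exact_mod_cast natCast_mem O4 2
  have h : a / 2 ∈ O4 := by
    refine ((FixedOverI.of_mem_O4 ha).div (.of_mem_O4 h2)).mem_O4_of_valuation fun V => ?_
    rw [map_div₀]
    exact div_le_one_of_le₀ (hV V) zero_le
  have h3 : gaussPar 2 = 0 := by
    have := gaussPar_natCast 2
    push_cast at this
    rw [this]; decide
  rw [show a = 2 * (a / 2) by ring, gaussPar_mul h2 h, h3, zero_mul]

lemma pow_four_eq_one_iff {u : ℂ} : u ^ 4 = 1 ↔ u = 1 ∨ u = -1 ∨ u = I ∨ u = -I := by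
  constructor
  · intro h
    have : (u - 1) * ((u + 1) * ((u - I) * (u + I))) = 0 := by
      linear_combination h - (u ^ 2 - 1) * I_sq
    rcases mul_eq_zero.1 this with h | h
    · exact .inl (by linear_combination h)
    rcases mul_eq_zero.1 h with h | h
    · exact .inr (.inl (by linear_combination h))
    rcases mul_eq_zero.1 h with h | h
    · exact .inr (.inr (.inl (by linear_combination h)))
    · exact .inr (.inr (.inr (by linear_combination h)))
  · rintro (rfl | rfl | rfl | rfl)
    · ring
    · ring
    · exact I_pow_four
    · rw [neg_pow, I_pow_four]; norm_num

lemma mem_O4_of_pow_four {u : ℂ} (h : u ^ 4 = 1) : u ∈ O4 := by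
  rcases pow_four_eq_one_iff.1 h with rfl | rfl | rfl | rfl
  exacts [one_mem _, neg_mem (one_mem _), I_mem_O4, neg_mem I_mem_O4]

lemma gaussPar_of_pow_four {u : ℂ} (h : u ^ 4 = 1) : gaussPar u = 1 := by
  have h1 := gaussPar_pow (mem_O4_of_pow_four h) 4
  rw [h, gaussPar_one] at h1
  rcases zmod_two_eq (gaussPar u) with h2 | h2
  · rw [h2] at h1; simp at h1
  · exact h2

namespace IsGaussPrime

variable {p : ℕ} {π : ℂ} (h : IsGaussPrime p π)

include h

lemma gaussPar_eq_one : gaussPar π = 1 := by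
  have hc := conj_mem_O4 h.mem
  have h1 := gaussPar_mul h.mem hc
  rw [← h.norm, gaussPar_natCast] at h1
  have h2 : (p : ZMod 2) = 1 := by
    have : p % 2 = 1 := by have := h.mod_four; omega
    rw [← ZMod.natCast_mod, this]; simp
  rcases zmod_two_eq (gaussPar π) with h3 | h3
  · rw [h2, h3] at h1; simp at h1
  · exact h3

variable [Fact p.Prime]

lemma resMap_pow {a : ℂ} (ha : a ∈ O4) (n : ℕ) : resMap p π (a ^ n) = resMap p π a ^ n := by
  induction n with
  | zero => simp [resMap_one]
  | succ n ih => rw [pow_succ, h.resMap_mul (pow_mem ha _) ha, ih, pow_succ]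

lemma div_mem_O4 {a : ℂ} (ha : a ∈ O4) (h0 : resMap p π a = 0) : a / π ∈ O4 := by
  obtain ⟨d, hd, rfl⟩ := (h.resMap_eq_zero ha).1 h0
  rwa [mul_div_cancel_left₀ _ h.ne_zero]

lemma resMap_eq_zero_of_div_mem {a : ℂ} (ha : a ∈ O4) (h0 : a / π ∈ O4) : resMap p π a = 0 :=
  (h.resMap_eq_zero ha).2 ⟨_, h0, by field_simp [h.ne_zero]⟩

lemma exists_valuation_lt_one : ∃ V : ValuationSubring ℂ, V.valuation π < 1 := by
  by_contra! hcon
  have h1 : 1 / π ∈ O4 := by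
    refine ((FixedOverI.of_mem_O4 (one_mem _)).div (.of_mem_O4 h.mem)).mem_O4_of_valuation fun V => ?_
    rw [map_div₀, map_one]
    exact div_le_one_of_le₀ (hcon V) zero_le
  have := h.resMap_eq_zero_of_div_mem (one_mem _) h1
  rw [resMap_one] at this
  exact one_ne_zero this

/-- An element of `ℤ[i]` which is not a unit wherever `π` is not a unit is divisible by `π`. -/
lemma resMap_eq_zero_of_valuation {a : ℂ} (ha : a ∈ O4)
    (hV : ∀ V : ValuationSubring ℂ, V.valuation π < 1 → V.valuation a < 1) : resMap p π a = 0 := by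
  by_contra h0
  obtain ⟨u, hu, v, hv, huv⟩ := (h.gcoprime_iff ha).2 h0
  obtain ⟨V, hVπ⟩ := h.exists_valuation_lt_one
  have h1 : V.valuation (u * a + v * π) < 1 := by
    refine V.valuation.map_add_lt ?_ ?_
    · rw [map_mul]
      exact (mul_le_of_le_one_left' (valuation_le_one_of_mem_O4 hu V)).trans_lt (hV V hVπ)
    · rw [map_mul]
      exact (mul_le_of_le_one_left' (valuation_le_one_of_mem_O4 hv V)).trans_lt hVπ
  rw [huv, map_one] at h1
  exact lt_irrefl _ h1

end IsGaussPrime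

lemma valuation_sum_pow_four {V : ValuationSubring ℂ} {ι : Type*} (T : Finset ι)
    {a : ι → ℂ} (h1 : ∀ s ∈ T, V.valuation (a s) ≤ 1)
    (h2 : ∀ s ∈ T, V.valuation (1 - a s ^ 4) ≤ V.valuation 2) :
    V.valuation ((∑ s ∈ T, a s) ^ 4 - T.card) ≤ V.valuation 2 := by
  classical
  induction T using Finset.induction_on with
  | empty => simp
  | insert s T hs ih =>
    rw [Finset.sum_insert hs, Finset.card_insert_of_notMem hs]
    have ih := ih (fun s hs => h1 s (Finset.mem_insert_of_mem hs))
      (fun s hs => h2 s (Finset.mem_insert_of_mem hs))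
    have ha : a s ∈ V := (V.valuation_le_one_iff _).1 (h1 s (Finset.mem_insert_self _ _))
    have hS : ∑ s ∈ T, a s ∈ V :=
      sum_mem fun s hs => (V.valuation_le_one_iff _).1 (h1 s (Finset.mem_insert_of_mem hs))
    set S := ∑ s ∈ T, a s
    have h3 : 2 * a s ^ 3 * S + 3 * a s ^ 2 * S ^ 2 + 2 * a s * S ^ 3 ∈ V := by
      have h2V : (2 : ℂ) ∈ V := by exact_mod_cast natCast_mem V 2
      have h3V : (3 : ℂ) ∈ V := by exact_mod_cast natCast_mem V 3
      exact add_mem (add_mem (mul_mem (mul_mem h2V (pow_mem ha _)) hS)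
        (mul_mem (mul_mem h3V (pow_mem ha _)) (pow_mem hS _)))
        (mul_mem (mul_mem h2V ha) (pow_mem hS _))
    have h4 : V.valuation (2 * (2 * a s ^ 3 * S + 3 * a s ^ 2 * S ^ 2 + 2 * a s * S ^ 3)) ≤
        V.valuation 2 := by
      rw [map_mul]
      exact mul_le_of_le_one_right' ((V.valuation_le_one_iff _).2 h3)
    rw [show (a s + S) ^ 4 - ((T.card + 1 : ℕ) : ℂ) = (S ^ 4 - T.card) - (1 - a s ^ 4) +
      2 * (2 * a s ^ 3 * S + 3 * a s ^ 2 * S ^ 2 + 2 * a s * S ^ 3) by push_cast; ring]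
    exact V.valuation.map_add_le
      (V.valuation.map_sub_le ih (h2 s (Finset.mem_insert_self _ _))) h4

/-- `y` is obtained from the `π`-division values of `φ` in a Galois equivariant way. -/
def DivEquivariant (p : ℕ) (π : ℂ) (y : ZMod p → ℂ) : Prop :=
  ∀ σ : ℂ →+* ℂ, σ I = I → ∀ m ≠ 0,
    (∀ n ≠ 0, σ (divVal p π phi4 n) = divVal p π phi4 (m * n)) → ∀ n ≠ 0, σ (y n) = y (m * n)

namespace QuarticSystem

variable {p : ℕ} [Fact p.Prime] {π : ℂ} {c : ZMod p → ℂ} {T : Finset (ZMod p)}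
  (D : QuarticSystem p (resI p π) c T) (h : IsGaussPrime p π)

include D h

lemma prod_phi4_pow_four :
    ∃ u : ℂ, u ^ 4 = 1 ∧ (∏ s ∈ T, divVal p π phi4 s) ^ 4 = u * π := by
  have hL := h.lemDivision
  have h1 := h.prod_phi4_pow_four
  rw [D.prod_erase_zero] at h1
  have h2 : ∀ s ∈ T, ∏ k ∈ Finset.range 4, divVal p π phi4 (resI p π ^ k * s) =
      -(divVal p π phi4 s) ^ 4 := fun s hs => by
    have hs0 := D.ne_zero hs
    have hj := D.j_ne_zero
    have e1 := hL.x_j s hs0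
    have e2 := hL.x_j _ (mul_ne_zero hj hs0)
    have e3 := hL.x_j _ (mul_ne_zero hj (mul_ne_zero hj hs0))
    rw [Finset.prod_range_succ, Finset.prod_range_succ, Finset.prod_range_succ,
      Finset.prod_range_one, pow_zero, one_mul, pow_one,
      show resI p π ^ 2 * s = resI p π * (resI p π * s) by ring,
      show resI p π ^ 3 * s = resI p π * (resI p π * (resI p π * s)) by ring, e3, e2, e1]
    linear_combination (divVal p π phi4 s) ^ 4 * (I ^ 4 - I ^ 2 + 1) * I_sq
  rw [Finset.prod_congr rfl h2, ← Finset.prod_pow] at h1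
  have h3 : ∀ s ∈ T, (-(divVal p π phi4 s) ^ 4) ^ 4 = ((divVal p π phi4 s) ^ 4) ^ 4 :=
    fun s _ => by ring
  rw [Finset.prod_congr rfl h3, Finset.prod_pow, Finset.prod_pow] at h1
  refine ⟨(∏ s ∈ T, divVal p π phi4 s) ^ 4 / π, ?_, ?_⟩
  · rw [div_pow, h1, div_self (pow_ne_zero _ h.ne_zero)]
  · field_simp [h.ne_zero]

lemma prod_phi4_ne_zero : ∏ s ∈ T, divVal p π phi4 s ≠ 0 :=
  Finset.prod_ne_zero_iff.2 fun s hs => h.lemDivision.x_ne s (D.ne_zero hs)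

lemma fixedOverI {y : ZMod p → ℂ} (hy : DivEquivariant p π y)
    (hyj : ∀ n ≠ 0, c (resI p π * n) * y (resI p π * n) = c n * y n) :
    FixedOverI ((∑ s ∈ T, c s * y s) / (∏ s ∈ T, divVal p π phi4 s) ^ 3) := fun σ hσ => by
  obtain ⟨m, hm, hx⟩ := h.exists_ringHom_divVal σ hσ
  have h1 : σ (∏ s ∈ T, divVal p π phi4 s) = c m * ∏ s ∈ T, divVal p π phi4 s := by
    rw [← D.prod_mul h.lemDivision.x_j hm, map_prod]
    exact Finset.prod_congr rfl fun s hs => hx s (D.ne_zero hs)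
  have h2 : c m * σ (∑ s ∈ T, c s * y s) = ∑ s ∈ T, c s * y s := by
    refine Eq.trans ?_ (D.sum_mul (F := fun n => c n * y n) hyj hm)
    rw [map_sum, Finset.mul_sum]
    refine Finset.sum_congr rfl fun s hs => ?_
    obtain ⟨k, hk, -⟩ := D.euler s (D.ne_zero hs)
    rw [map_mul, hy σ hσ m hm hx s (D.ne_zero hs), D.char_mul, hk, map_pow, hσ]
    ring
  have hc := D.map_ne_zero hm
  have h3 : σ (∑ s ∈ T, c s * y s) = (∑ s ∈ T, c s * y s) / c m := by
    exact eq_div_of_mul_eq hc (by rw [mul_comm]; exact h2)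
  have hX := D.prod_phi4_ne_zero h
  rw [map_div₀, map_pow, h1, h3, mul_pow]
  field_simp
  rw [D.map_pow_four hm, mul_one]

omit h in
lemma valuation_sum_le_one (V : ValuationSubring ℂ) {y : ZMod p → ℂ}
    (hyV : ∀ n ≠ 0, V.valuation (y n) ≤ 1) : V.valuation (∑ s ∈ T, c s * y s) ≤ 1 := by
  refine V.valuation.map_sum_le fun s hs => ?_
  obtain ⟨k, hk, -⟩ := D.euler s (D.ne_zero hs)
  rw [map_mul, hk]
  exact mul_le_one' (valuation_le_one_of_mem_O4 (pow_mem I_mem_O4 _) V) (hyV _ (D.ne_zero hs))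

lemma sum_div_mem_O4 {y : ZMod p → ℂ} (hy : DivEquivariant p π y)
    (hyj : ∀ n ≠ 0, c (resI p π * n) * y (resI p π * n) = c n * y n)
    (hyV : ∀ V : ValuationSubring ℂ, ∀ n ≠ 0, V.valuation (y n) ≤ 1) :
    (∑ s ∈ T, c s * y s) / (∏ s ∈ T, divVal p π phi4 s) ^ 3 ∈ O4 := by
  have hfix := D.fixedOverI h hy hyj
  have hYV := fun V => D.valuation_sum_le_one V (hyV V)
  have hX := D.prod_phi4_ne_zero h
  obtain ⟨u, hu, hXu⟩ := D.prod_phi4_pow_four h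
  set Y := ∑ s ∈ T, c s * y s
  set X := ∏ s ∈ T, divVal p π phi4 s
  have hπ := h.ne_zero
  have hu0 : u ≠ 0 := by rintro rfl; norm_num at hu
  have h1 : (Y / X ^ 3) ^ 4 * (u ^ 3 * π ^ 3) = Y ^ 4 := by
    have : X ^ 12 = u ^ 3 * π ^ 3 := by rw [← mul_pow, ← hXu]; ring
    rw [← this]; field_simp
  have h2 : (π * (Y / X ^ 3)) ^ 4 = π * (u * Y ^ 4) := by
    rw [← h1]; linear_combination (-(Y / X ^ 3) ^ 4 * π ^ 4) * hu
  have huV := fun V => valuation_le_one_of_mem_O4 (mem_O4_of_pow_four hu) V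
  have hb : π * (Y / X ^ 3) ∈ O4 := by
    refine ((FixedOverI.of_mem_O4 h.mem).mul hfix).mem_O4_of_valuation fun V => ?_
    refine (pow_le_one_iff_of_nonneg zero_le (show 4 ≠ 0 by norm_num)).1 ?_
    rw [← map_pow, h2, map_mul, map_mul, map_pow]
    exact mul_le_one' (valuation_le_one_of_mem_O4 h.mem V)
      (mul_le_one' (huV V) (pow_le_one₀ zero_le (hYV V)))
  have h3 : resMap p π (π * (Y / X ^ 3)) ^ 4 = 0 := by
    rw [← h.resMap_pow hb]
    refine h.resMap_eq_zero_of_div_mem (pow_mem hb _) ?_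
    refine ((FixedOverI.of_mem_O4 (pow_mem hb _)).div (.of_mem_O4 h.mem)).mem_O4_of_valuation
      fun V => ?_
    rw [h2, mul_div_cancel_left₀ _ hπ, map_mul, map_pow]
    exact mul_le_one' (huV V) (pow_le_one₀ zero_le (hYV V))
  have h4 := h.div_mem_O4 hb (pow_eq_zero_iff (by norm_num) |>.1 h3)
  rwa [mul_div_cancel_left₀ _ hπ] at h4

lemma gaussPar_sum_div {y : ZMod p → ℂ} (hy : DivEquivariant p π y)
    (hyj : ∀ n ≠ 0, c (resI p π * n) * y (resI p π * n) = c n * y n)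
    (hyV : ∀ V : ValuationSubring ℂ, ∀ n ≠ 0, V.valuation (y n) ≤ 1)
    (hy2 : ∀ V : ValuationSubring ℂ, ∀ n ≠ 0, V.valuation (1 - y n ^ 4) ≤ V.valuation 2) :
    gaussPar ((∑ s ∈ T, c s * y s) / (∏ s ∈ T, divVal p π phi4 s) ^ 3) = ((p - 1) / 4 : ℕ) := by
  have hB := D.sum_div_mem_O4 h hy hyj hyV
  have hX := D.prod_phi4_ne_zero h
  obtain ⟨u, hu, hXu⟩ := D.prod_phi4_pow_four h
  have hV : ∀ V : ValuationSubring ℂ,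
      V.valuation ((∑ s ∈ T, c s * y s) ^ 4 - T.card) ≤ V.valuation 2 := fun V => by
    refine valuation_sum_pow_four T (fun s hs => ?_) (fun s hs => ?_)
    · obtain ⟨k, hk, -⟩ := D.euler s (D.ne_zero hs)
      rw [map_mul, hk]
      exact mul_le_one' (valuation_le_one_of_mem_O4 (pow_mem I_mem_O4 _) V) (hyV V _ (D.ne_zero hs))
    · rw [mul_pow, D.map_pow_four (D.ne_zero hs), one_mul]
      exact hy2 V _ (D.ne_zero hs)
  set Y := ∑ s ∈ T, c s * y s
  set X := ∏ s ∈ T, divVal p π phi4 s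
  have huO := mem_O4_of_pow_four hu
  have h1 : (Y / X ^ 3) ^ 4 * (u ^ 3 * π ^ 3) = Y ^ 4 := by
    have : X ^ 12 = u ^ 3 * π ^ 3 := by rw [← mul_pow, ← hXu]; ring
    rw [← this]; field_simp
  rw [← h1] at hV
  have h2 : (Y / X ^ 3) ^ 4 * (u ^ 3 * π ^ 3) ∈ O4 :=
    mul_mem (pow_mem hB _) (mul_mem (pow_mem huO _) (pow_mem h.mem _))
  have h3 := gaussPar_eq_zero_of_two (sub_mem h2 (natCast_mem _ T.card)) hV
  rw [gaussPar_sub h2 (natCast_mem _ _), gaussPar_mul (pow_mem hB _)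
    (mul_mem (pow_mem huO _) (pow_mem h.mem _)), gaussPar_mul (pow_mem huO _) (pow_mem h.mem _),
    gaussPar_pow hB, gaussPar_pow huO, gaussPar_pow h.mem, h.gaussPar_eq_one,
    gaussPar_of_pow_four hu, gaussPar_natCast, D.card, sub_eq_zero, one_pow, one_mul,
    mul_one] at h3
  rw [← h3]
  rcases zmod_two_eq (gaussPar (Y / X ^ 3)) with h4 | h4 <;> rw [h4] <;> decide

end QuarticSystem

lemma valuation_one_sub_div_pow_four {V : ValuationSubring ℂ} {a b : ℂ} (hb : b ≠ 0)
    (hab : V.valuation (a / b) ≤ 1) (ha4 : V.valuation (1 - a ^ 4) ≤ V.valuation 2)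
    (hb4 : V.valuation (1 - b ^ 4) ≤ V.valuation 2) :
    V.valuation (1 - (a / b) ^ 4) ≤ V.valuation 2 := by
  have h2 : V.valuation 2 ≤ 1 := valuation_le_one_of_mem_O4 (by exact_mod_cast natCast_mem O4 2) V
  rcases h2.lt_or_eq with h2 | h2
  · have hb1 : V.valuation (b ^ 4) = 1 := by
      have := V.valuation.map_one_sub_of_lt (hb4.trans_lt h2)
      rwa [sub_sub_cancel] at this
    rw [show 1 - (a / b) ^ 4 = ((1 - a ^ 4) - (1 - b ^ 4)) / b ^ 4 by field_simp; ring, map_div₀,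
      hb1, div_one]
    exact V.valuation.map_sub_le ha4 hb4
  · rw [h2]
    refine V.valuation.map_sub_le V.valuation.map_one.le ?_
    rw [map_pow]
    exact pow_le_one₀ zero_le hab

lemma valuation_one_sub_mul_pow_four {V : ValuationSubring ℂ} {a b : ℂ} (ha : V.valuation a ≤ 1)
    (ha4 : V.valuation (1 - a ^ 4) ≤ V.valuation 2)
    (hb4 : V.valuation (1 - b ^ 4) ≤ V.valuation 2) :
    V.valuation (1 - (a * b) ^ 4) ≤ V.valuation 2 := by
  rw [show 1 - (a * b) ^ 4 = (1 - a ^ 4) + a ^ 4 * (1 - b ^ 4) by ring]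
  refine V.valuation.map_add_le ha4 ?_
  rw [map_mul, map_pow]
  exact (mul_le_of_le_one_left' (pow_le_one₀ zero_le ha)).trans hb4

lemma LemDivision.P_j {p : ℕ} [Fact p.Prime] {j : ZMod p} {x P Z : ZMod p → ℂ}
    (L : LemDivision p j x P Z) {n : ZMod p} (hn : n ≠ 0) : P (j * n) = -P n := by
  have ht := L.one_add_j_ne_zero
  have hn' : (1 + j)⁻¹ * n ≠ 0 := mul_ne_zero (inv_ne_zero ht) hn
  have e : (1 + j) * ((1 + j)⁻¹ * n) = n := by rw [← mul_assoc, mul_inv_cancel₀ ht, one_mul]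
  have h1 := L.P_t _ hn'
  have h2 := L.P_t _ (mul_ne_zero L.j_ne_zero hn')
  rw [L.x_j _ hn', show (1 + j) * (j * ((1 + j)⁻¹ * n)) = j * ((1 + j) * ((1 + j)⁻¹ * n)) by ring,
    e] at h2
  rw [e] at h1
  apply mul_right_cancel₀ (pow_ne_zero 2 (L.x_ne _ hn'))
  linear_combination -h2 + h1 + P (j * n) * x ((1 + j)⁻¹ * n) ^ 2 * I_sq

namespace QuarticSystem

variable {p : ℕ} [Fact p.Prime] {π : ℂ} {c : ZMod p → ℂ} {T : Finset (ZMod p)}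

section sums

variable {j : ZMod p} (D : QuarticSystem p j c T)

include D

lemma sum_erase_zero_char_mul (f : ZMod p → ℂ) :
    (1 / 4) * ∑ n ∈ Finset.univ.erase 0, c n * f n =
      ∑ s ∈ T, c s * ((1 / 4) * (f s + c j * f (j * s) + c j ^ 2 * f (j * (j * s)) +
        c j ^ 3 * f (j * (j * (j * s))))) := by
  rw [D.sum_erase_zero, Finset.mul_sum]
  refine Finset.sum_congr rfl fun s hs => ?_
  rw [Finset.sum_range_succ, Finset.sum_range_succ, Finset.sum_range_succ,
    Finset.sum_range_one, pow_zero, one_mul, pow_one,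
    show j ^ 2 * s = j * (j * s) by ring,
    show j ^ 3 * s = j * (j * (j * s)) by ring]
  simp only [D.char_mul]
  ring

lemma sum_erase_zero_of_inv (f : ZMod p → ℂ) (hf : ∀ n ≠ 0, c (j * n) * f (j * n) = c n * f n) :
    (1 / 4) * ∑ n ∈ Finset.univ.erase 0, c n * f n = ∑ s ∈ T, c s * f s := by
  rw [D.sum_erase_zero, Finset.mul_sum]
  refine Finset.sum_congr rfl fun s hs => ?_
  have hj := D.j_ne_zero
  have hs0 := D.ne_zero hs
  rw [Finset.sum_range_succ, Finset.sum_range_succ, Finset.sum_range_succ,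
    Finset.sum_range_one, pow_zero, one_mul, pow_one,
    show j ^ 2 * s = j * (j * s) by ring,
    show j ^ 3 * s = j * (j * (j * s)) by ring, hf _ (mul_ne_zero hj (mul_ne_zero hj hs0)),
    hf _ (mul_ne_zero hj hs0), hf _ hs0]
  ring

end sums

variable (D : QuarticSystem p (resI p π) c T) (h : IsGaussPrime p π)

include D h

lemma gaussSum_phi4 (hp : p % 16 = 13) :
    ((1 / 4) * ∑ n ∈ Finset.univ.erase 0, c n * divVal p π phi4 n) /
      (∏ s ∈ T, divVal p π phi4 s) ^ 3 ∈ O4 ∧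
    gaussPar (((1 / 4) * ∑ n ∈ Finset.univ.erase 0, c n * divVal p π phi4 n) /
      (∏ s ∈ T, divVal p π phi4 s) ^ 3) = 1 := by
  have L := h.lemDivision
  have hcj : c (resI p π) = I ^ 3 := by
    rw [D.map_j, pow_eq_pow_mod _ I_pow_four]
    congr 1; omega
  have hyj : ∀ n ≠ 0, c (resI p π * n) * divVal p π phi4 (resI p π * n) =
      c n * divVal p π phi4 n := fun n hn => by
    rw [L.x_j n hn, D.char_mul, hcj]
    linear_combination c n * divVal p π phi4 n * I_pow_four
  have hyV : ∀ V : ValuationSubring ℂ, ∀ n ≠ 0, V.valuation (divVal p π phi4 n) ≤ 1 :=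
    fun V n hn => L.valuation_x_le_one V hn
  have hy : DivEquivariant p π (divVal p π phi4) := fun σ _ m _ h => h
  rw [D.sum_erase_zero_of_inv _ hyj]
  refine ⟨D.sum_div_mem_O4 h hy hyj hyV, ?_⟩
  rw [D.gaussPar_sum_div h hy hyj hyV fun V n hn => (L.valuation_one_sub_x_pow_four V hn).le]
  rw [← ZMod.natCast_mod, show (p - 1) / 4 % 2 = 1 by omega, Nat.cast_one]

lemma sum_div_mem_of_even (hp : p % 8 = 1) {y : ZMod p → ℂ} (hy : DivEquivariant p π y)
    (hyj : ∀ n ≠ 0, c (resI p π * n) * y (resI p π * n) = c n * y n)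
    (hyV : ∀ V : ValuationSubring ℂ, ∀ n ≠ 0, V.valuation (y n) ≤ 1)
    (hy2 : ∀ V : ValuationSubring ℂ, ∀ n ≠ 0, V.valuation (1 - y n ^ 4) ≤ V.valuation 2) :
    (∑ s ∈ T, c s * (y s / (1 + I))) / (∏ s ∈ T, divVal p π phi4 s) ^ 3 ∈ O4 := by
  have h1 := D.gaussPar_sum_div h hy hyj hyV hy2
  rw [← ZMod.natCast_mod, show (p - 1) / 4 % 2 = 0 by omega, Nat.cast_zero,
    gaussPar_eq_zero_iff (D.sum_div_mem_O4 h hy hyj hyV)] at h1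
  obtain ⟨d, hd, hd'⟩ := h1
  have h1I : (1 + I) ≠ 0 := fun h => by simpa using congrArg Complex.re h
  have h2 : (∑ s ∈ T, c s * (y s / (1 + I))) = (∑ s ∈ T, c s * y s) / (1 + I) := by
    rw [Finset.sum_div]
    exact Finset.sum_congr rfl fun _ _ => by ring
  rw [h2, div_right_comm, hd', mul_div_cancel_left₀ _ h1I]
  exact hd

lemma gaussSum_psi4 (hp : p % 8 = 1) :
    ((1 / 4) * ∑ n ∈ Finset.univ.erase 0, c n * divVal p π psi4 n) /
      (∏ s ∈ T, divVal p π phi4 s) ^ 3 ∈ O4 := by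
  have L := h.lemDivision
  set x := divVal p π phi4
  set P := divVal p π fun u => lemP (varpi * u)
  have h1I : (1 + I) ≠ 0 := fun h => by simpa using congrArg Complex.re h
  have ht := L.one_add_j_ne_zero
  have htn : ∀ {n}, n ≠ 0 → (1 + resI p π) * n ≠ 0 := fun hn => mul_ne_zero ht hn
  have hj := D.j_ne_zero
  have hψ : ∀ n, divVal p π psi4 n = (P n + I) / (P n - I) := fun n => psi4_eq _
  have hP1 : ∀ n ≠ 0, P n + I ≠ 0 := fun n hn h0 => L.P_sq_add n hn (by
    linear_combination (P n - I) * h0 + I_sq)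
  have hP2 : ∀ n ≠ 0, P n - I ≠ 0 := fun n hn h0 => L.P_sq_add n hn (by
    linear_combination (P n + I) * h0 + I_sq)
  have hψj : ∀ n ≠ 0, divVal p π psi4 (resI p π * n) = (P n - I) / (P n + I) := fun n hn => by
    rw [hψ, L.P_j hn, ← neg_div_neg_eq]
    congr 1 <;> ring
  have hψjj : ∀ n ≠ 0, divVal p π psi4 (resI p π * (resI p π * n)) = (P n + I) / (P n - I) :=
    fun n hn => by
    rw [hψ, L.P_j (mul_ne_zero hj hn), L.P_j hn, neg_neg]
  have hxt := fun V n hn => L.valuation_x_t_eq V (n := n) hn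
  have hx2 := fun V n hn => (L.valuation_one_sub_x_pow_four V (n := n) hn).le
  rw [D.sum_erase_zero_char_mul]
  rcases (by omega : (p - 1) / 4 % 4 = 0 ∨ (p - 1) / 4 % 4 = 2) with h4 | h4
  · have hcj : c (resI p π) = 1 := by
      rw [D.map_j, pow_eq_pow_mod _ I_pow_four, h4, pow_zero]
    have key := D.sum_div_mem_of_even h hp (y := fun n => x ((1 + resI p π) * n) / x n)
      (fun σ _ m _ hσ n hn => by
        rw [map_div₀, hσ _ (htn hn), hσ _ hn]
        congr 2; ring)
      (fun n hn => by
        rw [D.char_mul, hcj, L.x_j n hn, show (1 + resI p π) * (resI p π * n) =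
          resI p π * ((1 + resI p π) * n) by ring, L.x_j _ (htn hn),
          mul_div_mul_left _ _ I_ne_zero, one_mul])
      (fun V n hn => by
        rw [map_div₀, hxt V n hn]
        exact div_self_le_one _)
      (fun V n hn => valuation_one_sub_div_pow_four (L.x_ne n hn) (by
        rw [map_div₀, hxt V n hn]
        exact div_self_le_one _) (hx2 V _ (htn hn)) (hx2 V _ hn))
    convert key using 2
    refine Finset.sum_congr rfl fun s hs => ?_
    have hs0 := D.ne_zero hs
    rw [hcj, hψ, hψj _ (mul_ne_zero hj (mul_ne_zero hj hs0)), hψjj _ hs0, hψj _ hs0,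
      L.P_j (mul_ne_zero hj hs0), L.P_j hs0, neg_neg]
    congr 1
    have h1 := hP1 s hs0
    have h2 := hP2 s hs0
    have h3 := L.x_ne s hs0
    have h5 := L.x_t_lin s hs0
    have e : (P s + I) / (P s - I) + (P s - I) / (P s + I) =
        2 * (P s ^ 2 - 1) / (P s ^ 2 + 1) := by
      rw [div_add_div _ _ h2 h1, div_eq_div_iff (mul_ne_zero h2 h1) (L.P_sq_add s hs0)]
      linear_combination 4 * P s ^ 2 * I_sq
    have e' : x ((1 + resI p π) * s) / x s / (1 + I) = (P s ^ 2 - 1) / (P s ^ 2 + 1) := by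
      rw [div_div, div_eq_div_iff (mul_ne_zero h3 h1I) (L.P_sq_add s hs0)]
      linear_combination h5
    rw [e']
    linear_combination (1 / 2 : ℂ) * e
  · have hcj : c (resI p π) = -1 := by
      rw [D.map_j, pow_eq_pow_mod _ I_pow_four, h4, I_sq]
    have key := D.sum_div_mem_of_even h hp (y := fun n => x ((1 + resI p π) * n) * x n)
      (fun σ _ m _ hσ n hn => by
        rw [map_mul, hσ _ (htn hn), hσ _ hn]
        congr 2; ring)
      (fun n hn => by
        rw [D.char_mul, hcj, L.x_j n hn, show (1 + resI p π) * (resI p π * n) =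
          resI p π * ((1 + resI p π) * n) by ring, L.x_j _ (htn hn)]
        linear_combination (-c n * x ((1 + resI p π) * n) * x n) * I_sq)
      (fun V n hn => by
        rw [map_mul]
        exact mul_le_one' (L.valuation_x_le_one V (htn hn)) (L.valuation_x_le_one V hn))
      (fun V n hn => valuation_one_sub_mul_pow_four (L.valuation_x_le_one V (htn hn))
        (hx2 V _ (htn hn)) (hx2 V _ hn))
    rw [← neg_mem_iff, ← neg_div, ← Finset.sum_neg_distrib]
    convert key using 2
    refine Finset.sum_congr rfl fun s hs => ?_
    have hs0 := D.ne_zero hs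
    rw [hcj, hψ, hψj _ (mul_ne_zero hj (mul_ne_zero hj hs0)), hψjj _ hs0, hψj _ hs0,
      L.P_j (mul_ne_zero hj hs0), L.P_j hs0, neg_neg, ← mul_neg]
    congr 1
    have h1 := hP1 s hs0
    have h2 := hP2 s hs0
    have h3 := L.x_ne s hs0
    have h5 := L.x_t_lin s hs0
    have h6 := L.x_sq s hs0
    have e : (P s + I) / (P s - I) - (P s - I) / (P s + I) = 4 * I * P s / (P s ^ 2 + 1) := by
      rw [div_sub_div _ _ h2 h1, div_eq_div_iff (mul_ne_zero h2 h1) (L.P_sq_add s hs0)]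
      linear_combination 4 * P s * I * I_sq
    have e' : x ((1 + resI p π) * s) * x s / (1 + I) = -2 * I * P s / (P s ^ 2 + 1) := by
      rw [div_eq_div_iff h1I (L.P_sq_add s hs0)]
      linear_combination x s * h5 + (1 + I) * h6
    rw [e']
    linear_combination (-1 / 2 : ℂ) * e

end QuarticSystem

lemma valuation_one_sub_pow_four_of_gaussPar {z : ℂ} (hz : z ∈ O4) (hz1 : gaussPar z = 1)
    (V : ValuationSubring ℂ) : V.valuation (1 - z ^ 4) ≤ V.valuation 2 := by
  obtain ⟨d, hd, hzd⟩ := (gaussPar_eq_zero_iff (sub_mem hz (one_mem O4))).1 (by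
    rw [gaussPar_sub hz (one_mem O4), hz1, gaussPar_one, sub_self])
  rw [show 1 - z ^ 4 = 2 * (-(((1 + I) * d + I * d ^ 2) * (1 + z ^ 2))) by
    rw [sub_eq_iff_eq_add.1 hzd]
    linear_combination (-d ^ 2 * (1 + (1 + (1 + I) * d) ^ 2)) * I_sq, map_mul]
  refine mul_le_of_le_one_right' (valuation_le_one_of_mem_O4 ?_ V)
  exact neg_mem (mul_mem (add_mem (mul_mem (add_mem (one_mem _) I_mem_O4) hd)
    (mul_mem I_mem_O4 (pow_mem hd _))) (add_mem (one_mem _) (pow_mem hz _)))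

lemma LemDivision.valuation_x_j_pow {p : ℕ} [Fact p.Prime] {j : ZMod p} {x P Z : ZMod p → ℂ}
    (L : LemDivision p j x P Z) (V : ValuationSubring ℂ) {n : ZMod p} (hn : n ≠ 0) (k : ℕ) :
    V.valuation (x (j ^ k * n)) = V.valuation (x n) := by
  induction k with
  | zero => rw [pow_zero, one_mul]
  | succ k ih =>
    rw [pow_succ', mul_assoc, L.x_j _ (mul_ne_zero (pow_ne_zero _ L.j_ne_zero) hn), map_mul,
      V.valuation_I, one_mul, ih]

lemma LemDivision.one_add_j_ne_j_pow {p : ℕ} [Fact p.Prime] {j : ZMod p} {x P Z : ZMod p → ℂ}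
    (L : LemDivision p j x P Z) (hp : p ≠ 5) (k : ℕ) : 1 + j ≠ j ^ k := fun h => by
  have h4 : j ^ 4 = 1 := by linear_combination (j ^ 2 - 1) * L.j_sq
  have h1 : (1 + j) ^ 4 = 1 := by rw [h, ← pow_mul, mul_comm, pow_mul, h4, one_pow]
  have h5 : ((5 : ℕ) : ZMod p) = 0 := by
    push_cast
    linear_combination (j ^ 2 + 4 * j + 5) * L.j_sq - h1
  rw [ZMod.natCast_eq_zero_iff, Nat.prime_dvd_prime_iff_eq Fact.out Nat.prime_five] at h5
  exact hp h5

namespace QuarticSystem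

variable {p : ℕ} [Fact p.Prime] {π : ℂ} {c : ZMod p → ℂ} {T : Finset (ZMod p)}
  (D : QuarticSystem p (resI p π) c T) (h : IsGaussPrime p π)

include D h

lemma valuation_prod_erase_lt_one (hp : p ≠ 5) {V : ValuationSubring ℂ} (hV : V.valuation π < 1)
    (s : ZMod p) : V.valuation (∏ r ∈ T.erase s, divVal p π phi4 r) < 1 := by
  have L := h.lemDivision
  obtain ⟨u, hu, hX⟩ := D.prod_phi4_pow_four h
  set x := divVal p π phi4
  have hXV : V.valuation (∏ s ∈ T, x s) < 1 := by
    refine (pow_lt_one_iff_of_nonneg zero_le (show 4 ≠ 0 by norm_num)).1 ?_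
    rw [← map_pow, hX, map_mul]
    exact (mul_le_of_le_one_left'
      (valuation_le_one_of_mem_O4 (mem_O4_of_pow_four hu) V)).trans_lt hV
  obtain ⟨s₀, hs₀, hx₀⟩ : ∃ s₀ ∈ T, V.valuation (x s₀) < 1 := by
    by_contra! hcon
    rw [map_prod, Finset.prod_eq_one fun s hs =>
      (L.valuation_x_le_one V (D.ne_zero hs)).antisymm (hcon s hs)] at hXV
    exact lt_irrefl _ hXV
  have h0 := D.ne_zero hs₀
  obtain ⟨s₁, hs₁, k, -, hk⟩ := D.exists_eq _ (mul_ne_zero L.one_add_j_ne_zero h0)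
  have hx₁ : V.valuation (x s₁) < 1 := by
    rwa [← L.valuation_x_j_pow V (D.ne_zero hs₁) k, ← hk, L.valuation_x_t_eq V h0]
  have hne : s₁ ≠ s₀ := by
    rintro rfl
    exact L.one_add_j_ne_j_pow hp k (mul_right_cancel₀ h0 hk)
  have main : ∀ r ∈ T.erase s, V.valuation (x r) < 1 →
      V.valuation (∏ r ∈ T.erase s, x r) < 1 := fun r hr hxr => by
    rw [← Finset.mul_prod_erase _ _ hr, map_mul, map_prod]
    exact (mul_le_of_le_one_right' (Finset.prod_le_one' fun q hq => L.valuation_x_le_one V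
      (D.ne_zero (Finset.mem_of_mem_erase (Finset.mem_of_mem_erase hq))))).trans_lt hxr
  by_cases hs : s₀ = s
  · exact main s₁ (Finset.mem_erase.2 ⟨hs ▸ hne, hs₁⟩) hx₁
  · exact main s₀ (Finset.mem_erase.2 ⟨hs, hs₀⟩) hx₀

lemma sum_inv_div (hp : p % 16 = 5) (hp5 : p ≠ 5) :
    (∑ s ∈ T, c s * (divVal p π phi4 s)⁻¹) / (∏ s ∈ T, divVal p π phi4 s) ^ 3 ∈ O4 ∧
    gaussPar ((∑ s ∈ T, c s * (divVal p π phi4 s)⁻¹) / (∏ s ∈ T, divVal p π phi4 s) ^ 3) = 1 := by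
  have L := h.lemDivision
  obtain ⟨u, hu, hXu⟩ := D.prod_phi4_pow_four h
  have hX0 := D.prod_phi4_ne_zero h
  have herase := fun V hV s => D.valuation_prod_erase_lt_one h hp5 (V := V) hV s
  have huO := mem_O4_of_pow_four hu
  have hu0 : u ≠ 0 := by rintro rfl; norm_num at hu
  have hcj : c (resI p π) = I := by
    rw [D.map_j, pow_eq_pow_mod _ I_pow_four, show (p - 1) / 4 % 4 = 1 by omega, pow_one]
  set x := divVal p π phi4 with hx
  set X := ∏ s ∈ T, x s with hXdef
  have hmul : ∀ s ∈ T, x s * ∏ r ∈ T.erase s, x r = X := fun s hs => Finset.mul_prod_erase _ _ hs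
  have hyV : ∀ V : ValuationSubring ℂ, ∀ n ≠ 0, V.valuation (u * π / x n) ≤ 1 := fun V n hn => by
    obtain ⟨s, hs, k, -, rfl⟩ := D.exists_eq n hn
    have hs0 := D.ne_zero hs
    rw [map_div₀, L.valuation_x_j_pow V hs0, ← map_div₀, ← hXu, ← hmul s hs,
      show (x s * ∏ r ∈ T.erase s, x r) ^ 4 / x s = x s ^ 3 * (∏ r ∈ T.erase s, x r) ^ 4 by
        field_simp [L.x_ne s hs0], map_mul, map_pow, map_pow, map_prod]
    exact mul_le_one' (pow_le_one₀ zero_le (L.valuation_x_le_one V hs0))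
      (pow_le_one₀ zero_le (Finset.prod_le_one' fun q hq => L.valuation_x_le_one V
      (D.ne_zero (Finset.mem_of_mem_erase hq))))
  have hy : DivEquivariant p π fun n => u * π / x n := fun σ hσ m _ hm n hn => by
    rw [map_div₀, hm n hn, FixedOverI.of_mem_O4 (mul_mem huO h.mem) σ hσ]
  have hyj : ∀ n ≠ 0, c (resI p π * n) * (u * π / x (resI p π * n)) = c n * (u * π / x n) :=
    fun n hn => by
    rw [D.char_mul, hcj, L.x_j n hn]
    field_simp [L.x_ne n hn]
  have hy2 : ∀ V : ValuationSubring ℂ, ∀ n ≠ 0,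
      V.valuation (1 - (u * π / x n) ^ 4) ≤ V.valuation 2 := fun V n hn =>
    valuation_one_sub_div_pow_four (L.x_ne n hn) (hyV V n hn)
      (by
        rw [mul_pow, hu, one_mul]
        exact valuation_one_sub_pow_four_of_gaussPar h.mem h.gaussPar_eq_one V)
      (L.valuation_one_sub_x_pow_four V hn).le
  have hB := D.sum_div_mem_O4 h hy hyj hyV
  have hB1 := D.gaussPar_sum_div h hy hyj hyV hy2
  rw [← ZMod.natCast_mod, show (p - 1) / 4 % 2 = 1 by omega, Nat.cast_one] at hB1
  simp only [← hx, ← hXdef] at hB hB1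
  have e : (∑ s ∈ T, c s * (u * π / x s)) / X ^ 3 = π * (u * ((∑ s ∈ T, c s * (x s)⁻¹) / X ^ 3)) := by
    rw [show ∑ s ∈ T, c s * (u * π / x s) = u * π * ∑ s ∈ T, c s * (x s)⁻¹ by
      rw [Finset.mul_sum]; exact Finset.sum_congr rfl fun _ _ => by ring]
    ring
  have e' : (∑ s ∈ T, c s * (u * π / x s)) / X ^ 3 = ∑ s ∈ T, c s * ∏ r ∈ T.erase s, x r := by
    rw [Finset.sum_div]
    refine Finset.sum_congr rfl fun s hs => ?_
    have := L.x_ne s (D.ne_zero hs)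
    rw [← hXu, mul_div_assoc, div_div]
    congr 1
    rw [div_eq_iff (mul_ne_zero this (pow_ne_zero 3 hX0))]
    linear_combination -X ^ 3 * hmul s hs
  have hres := h.resMap_eq_zero_of_valuation hB fun V hV => by
    rw [e']
    refine V.valuation.map_sum_lt one_ne_zero fun s hs => ?_
    obtain ⟨k, hk, -⟩ := D.euler s (D.ne_zero hs)
    rw [map_mul, hk]
    exact (mul_le_of_le_one_left' (valuation_le_one_of_mem_O4 (pow_mem I_mem_O4 _) V)).trans_lt
      (herase V hV s)
  have h1 := h.div_mem_O4 hB hres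
  rw [e, mul_div_cancel_left₀ _ h.ne_zero] at h1
  set B := (∑ s ∈ T, c s * (x s)⁻¹) / X ^ 3
  have h2 : B = u ^ 3 * (u * B) := by linear_combination -B * hu
  have h3 : B ∈ O4 := by rw [h2]; exact mul_mem (pow_mem huO _) h1
  refine ⟨h3, ?_⟩
  rwa [e, gaussPar_mul h.mem h1, gaussPar_mul huO h3, h.gaussPar_eq_one, gaussPar_of_pow_four hu,
    one_mul, one_mul] at hB1

end QuarticSystem

lemma LemDivision.valuation_Z_le_one {p : ℕ} [Fact p.Prime] {j : ZMod p} {x P Z : ZMod p → ℂ}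
    (L : LemDivision p j x P Z) {V : ValuationSubring ℂ} (hp : V.valuation (p : ℂ) = 1)
    (hx : ∀ n ≠ 0, V.valuation (x n) = 1) {n : ZMod p} (hn : n ≠ 0) : V.valuation (Z n) ≤ 1 := by
  have hj := L.j_ne_zero
  have ht := L.one_add_j_ne_zero
  have hI : I ∈ V := (V.valuation_le_one_iff _).1 V.valuation_I.le
  have hxi : ∀ n ≠ 0, (x n)⁻¹ ∈ V := fun n hn =>
    (V.valuation_le_one_iff _).1 (by rw [map_inv₀, hx n hn, inv_one])
  have hP : ∀ n ≠ 0, P n ∈ V := fun n hn => by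
    have hm : (1 + j)⁻¹ * n ≠ 0 := mul_ne_zero (inv_ne_zero ht) hn
    have h1 := L.P_t _ hm
    rw [← mul_assoc, mul_inv_cancel₀ ht, one_mul] at h1
    rw [eq_div_of_mul_eq (pow_ne_zero 2 (L.x_ne _ hm)) h1, neg_div, one_div, ← inv_pow]
    exact neg_mem (pow_mem (hxi _ hm) 2)
  have hZ2 : Z 2 - 2 * Z 1 ∈ V := by
    have hj' : -j ≠ 0 := neg_ne_zero.2 hj
    have h1 := L.Z_j _ hj'
    have h2 := L.Z_t _ hj'
    have h3 := L.Z_t _ (mul_ne_zero ht hj')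
    rw [show j * -j = 1 by linear_combination -L.j_sq] at h1
    rw [show (1 + j) * ((1 + j) * -j) = 2 by linear_combination -(j + 2) * L.j_sq] at h3
    have e : Z 2 - 2 * Z 1 = (1 - I) * (I * (x (-j))⁻¹) + I * (x ((1 + j) * -j))⁻¹ := by
      linear_combination h3 + (1 - I) * h2 + (-2 : ℂ) * h1 + Z (-j) * I_sq
    rw [e]
    exact add_mem (mul_mem (sub_mem (one_mem _) hI) (mul_mem hI (hxi _ hj')))
      (mul_mem hI (hxi _ (mul_ne_zero ht hj')))
  have hk0 : ∀ k : ℕ, 0 < k → k < p → (k : ZMod p) ≠ 0 := fun k h0 hk h => by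
    rw [ZMod.natCast_eq_zero_iff] at h
    exact absurd (Nat.le_of_dvd h0 h) (by omega)
  have main : ∀ k : ℕ, k + 1 < p → Z ((k + 1 : ℕ) : ZMod p) - ((k + 1 : ℕ) : ℂ) * Z 1 ∈ V := by
    intro k
    induction k with
    | zero => simp
    | succ k ih =>
      intro hk
      rcases k.eq_zero_or_pos with rfl | hk1
      · simpa using hZ2
      have ih := ih (by omega)
      have h3 := hk0 (k + 1 + 1) (by omega) hk
      have h4 := hk0 k hk1 (by omega)
      have h5 := hk0 (k + 1) (by omega) (by omega)
      rw [Nat.cast_succ (k + 1)] at h3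
      have h1 := L.Z_add_sq ((k + 1 : ℕ) : ZMod p) 1 h5 one_ne_zero h3
        (by push_cast; rwa [add_sub_cancel_right])
      have h2 : Z (((k + 1 : ℕ) : ZMod p) + 1) - Z ((k + 1 : ℕ) : ZMod p) - Z 1 ∈ V := by
        rw [← V.valuation_le_one_iff, ← pow_le_one_iff_of_nonneg zero_le (show 2 ≠ 0 by norm_num),
          ← map_pow, h1, V.valuation_le_one_iff]
        exact add_mem (add_mem (hP _ h5) (hP _ one_ne_zero)) (hP _ h3)
      rw [Nat.cast_succ (k + 1), Nat.cast_succ (k + 1)]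
      convert add_mem h2 ih using 1
      ring
  have hp2 := (Fact.out : p.Prime).two_le
  have hZ1 : Z 1 ∈ V := by
    have h1 := main (p - 2) (by omega)
    rw [show p - 2 + 1 = p - 1 by omega, Nat.cast_sub (by omega), Nat.cast_sub (by omega),
      CharP.cast_eq_zero, zero_sub, Nat.cast_one, Nat.cast_one] at h1
    have h2 := L.Z_j _ one_ne_zero
    have h3 := L.Z_j _ (mul_ne_zero hj one_ne_zero)
    rw [mul_one, ← pow_two, L.j_sq] at h3
    rw [mul_one] at h2
    rw [show Z (-1) - ((p : ℂ) - 1) * Z 1 = -(p * Z 1) by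
      linear_combination h3 - I * h2 + Z 1 * I_sq, neg_mem_iff, ← V.valuation_le_one_iff, map_mul,
      hp, one_mul] at h1
    exact (V.valuation_le_one_iff _).1 h1
  have hv : n.val ≠ 0 := by rwa [Ne, ZMod.val_eq_zero]
  have h1 := main (n.val - 1) (by have := n.val_lt; omega)
  rw [Nat.sub_add_cancel (by omega), ZMod.natCast_zmod_val] at h1
  have h2 := add_mem h1 (mul_mem (natCast_mem V n.val) hZ1)
  rw [sub_add_cancel] at h2
  exact (V.valuation_le_one_iff _).2 h2

namespace QuarticSystem

variable {p : ℕ} [Fact p.Prime] {π : ℂ} {c : ZMod p → ℂ} {T : Finset (ZMod p)}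
  (D : QuarticSystem p (resI p π) c T) (h : IsGaussPrime p π)

include D h

lemma valuation_phi4_eq_one {V : ValuationSubring ℂ} (hV : V.valuation (p : ℂ) = 1) {n : ZMod p}
    (hn : n ≠ 0) : V.valuation (divVal p π phi4 n) = 1 := by
  have L := h.lemDivision
  obtain ⟨u, hu, hX⟩ := D.prod_phi4_pow_four h
  obtain ⟨s, hs, k, -, rfl⟩ := D.exists_eq n hn
  rw [L.valuation_x_j_pow V (D.ne_zero hs)]
  have hle : ∀ s ∈ T, V.valuation (divVal p π phi4 s) ≤ 1 :=
    fun s hs => L.valuation_x_le_one V (D.ne_zero hs)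
  have hπ : V.valuation π = 1 := by
    refine (valuation_le_one_of_mem_O4 h.mem V).antisymm ?_
    rw [← hV, h.norm, map_mul]
    exact mul_le_of_le_one_right' (valuation_le_one_of_mem_O4 (conj_mem_O4 h.mem) V)
  have hu1 : V.valuation u = 1 := by
    rw [← pow_eq_one_iff_of_nonneg zero_le (show 4 ≠ 0 by norm_num), ← map_pow, hu, map_one]
  refine (hle s hs).antisymm ?_
  have hX1 : V.valuation (∏ s ∈ T, divVal p π phi4 s) = 1 := by
    rw [← pow_eq_one_iff_of_nonneg zero_le (show 4 ≠ 0 by norm_num), ← map_pow, hX, map_mul, hu1,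
      hπ, one_mul]
  rw [← hX1, ← Finset.mul_prod_erase _ _ hs, map_mul, map_prod]
  exact mul_le_of_le_one_right' (Finset.prod_le_one' fun q hq => hle q (Finset.mem_of_mem_erase hq))

lemma gaussSum_Z4 (hp : p % 16 = 5) (hp5 : p ≠ 5) :
    ((1 / 4) * ∑ n ∈ Finset.univ.erase 0, c n * divVal p π Z4 n) /
      (∏ s ∈ T, divVal p π phi4 s) ^ 3 ∈ O4 ∧
    gaussPar (((1 / 4) * ∑ n ∈ Finset.univ.erase 0, c n * divVal p π Z4 n) /
      (∏ s ∈ T, divVal p π phi4 s) ^ 3) = 1 := by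
  have L := h.lemDivision
  have hx1 := fun V hV n hn => D.valuation_phi4_eq_one h (V := V) hV (n := n) hn
  obtain ⟨hB, hB1⟩ := D.sum_inv_div h hp hp5
  have hcj : c (resI p π) = I := by
    rw [D.map_j, pow_eq_pow_mod _ I_pow_four, show (p - 1) / 4 % 4 = 1 by omega, pow_one]
  have hyj : ∀ n ≠ 0, c (resI p π * n) * divVal p π Z4 (resI p π * n) = c n * divVal p π Z4 n :=
    fun n hn => by
    rw [L.Z_j n hn, D.char_mul, hcj]
    linear_combination (-c n * divVal p π Z4 n) * I_sq
  rw [D.sum_erase_zero_of_inv _ hyj]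
  have hX0 := D.prod_phi4_ne_zero h
  set x := divVal p π phi4
  set Z := divVal p π Z4
  set X := ∏ s ∈ T, x s
  have ht := L.one_add_j_ne_zero
  set t := 1 + resI p π
  have hQ : ∑ s ∈ T, c s * Z s =
      c t * ((1 - I) * ∑ s ∈ T, c s * Z s + I * ∑ s ∈ T, c s * (x s)⁻¹) := by
    refine (D.sum_mul (F := fun n => c n * Z n) hyj ht).symm.trans ?_
    rw [Finset.mul_sum, Finset.mul_sum, ← Finset.sum_add_distrib, Finset.mul_sum]
    refine Finset.sum_congr rfl fun s hs => ?_
    rw [D.char_mul, L.Z_t s (D.ne_zero hs)]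
    ring
  have hα : (∑ s ∈ T, c s * Z s) / X ^ 3 = c t * ((1 - I) * ((∑ s ∈ T, c s * Z s) / X ^ 3) +
      I * ((∑ s ∈ T, c s * (x s)⁻¹) / X ^ 3)) := by
    conv_lhs => rw [hQ]
    ring
  have hαV : ∀ V : ValuationSubring ℂ, V.valuation (p : ℂ) = 1 →
      V.valuation ((∑ s ∈ T, c s * Z s) / X ^ 3) ≤ 1 := fun V hV => by
    have hXV : V.valuation X = 1 := by
      rw [map_prod]
      exact Finset.prod_eq_one fun s hs => hx1 V hV s (D.ne_zero hs)
    rw [map_div₀, map_pow, hXV, one_pow, div_one]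
    exact D.valuation_sum_le_one V fun n hn => L.valuation_Z_le_one hV (hx1 V hV) hn
  set B := (∑ s ∈ T, c s * (x s)⁻¹) / X ^ 3
  set α := (∑ s ∈ T, c s * Z s) / X ^ 3
  have hI := I_mem_O4
  have hgI : gaussPar I = 1 := gaussPar_of_pow_four I_pow_four
  have hn5 : ((5 : ℕ) : ℂ) ∈ O4 := natCast_mem _ _
  have hg5 : gaussPar ((5 : ℕ) : ℂ) = 1 := by rw [gaussPar_natCast]; rfl
  have hn2 : ((2 : ℕ) : ℂ) ∈ O4 := natCast_mem _ _
  have hg2 : gaussPar ((2 : ℕ) : ℂ) = 0 := by rw [gaussPar_natCast]; rfl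
  obtain ⟨v, hv, hv1, hvα⟩ : ∃ v ∈ O4, gaussPar v = 1 ∧ ((5 : ℕ) : ℂ) * α = v * B := by
    rcases pow_four_eq_one_iff.1 (D.map_pow_four ht) with hw | hw | hw | hw <;> rw [hw] at hα
    · refine ⟨(5 : ℕ), hn5, hg5, ?_⟩
      push_cast
      linear_combination (-5 * I) * hα + 5 * (α - B) * I_sq
    · refine ⟨1 - (2 : ℕ) * I, sub_mem (one_mem _) (mul_mem hn2 hI), by
        rw [gaussPar_sub (one_mem _) (mul_mem hn2 hI), gaussPar_mul hn2 hI, hg2, gaussPar_one,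
          zero_mul, sub_zero], ?_⟩
      push_cast
      linear_combination (2 + I) * hα + (α - B) * I_sq
    · refine ⟨-((5 : ℕ) * I), neg_mem (mul_mem hn5 hI), by
        rw [← zero_sub, gaussPar_sub (zero_mem _) (mul_mem hn5 hI), gaussPar_mul hn5 hI, hgI, hg5,
          show (0 : ℂ) = ((0 : ℕ) : ℂ) by simp, gaussPar_natCast]; rfl, ?_⟩
      push_cast
      linear_combination (5 * I) * hα + (5 * α * (1 - I) + 5 * I * B) * I_sq
    · refine ⟨(2 : ℕ) - I, sub_mem hn2 hI, by rw [gaussPar_sub hn2 hI, hgI, hg2]; rfl, ?_⟩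
      push_cast
      linear_combination (2 - I) * hα + (α * (3 - I) - (2 - I) * B) * I_sq
  have h5α : ((5 : ℕ) : ℂ) * α ∈ O4 := by rw [hvα]; exact mul_mem hv hB
  have hfix : FixedOverI α := by
    have := (FixedOverI.of_mem_O4 h5α).div (.of_mem_O4 hn5)
    rwa [mul_div_cancel_left₀ _ (by norm_num)] at this
  have hαO : α ∈ O4 := hfix.mem_O4_of_valuation fun V => by
    by_cases hV5 : V.valuation ((5 : ℕ) : ℂ) < 1
    · apply hαV
      obtain ⟨a, b, hab⟩ : IsCoprime ((5 : ℕ) : ℤ) (p : ℤ) := by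
        rw [Nat.isCoprime_iff_coprime, Nat.coprime_primes Nat.prime_five Fact.out]
        exact hp5.symm
      have hab' : 1 - (5 : ℕ) * (a : ℂ) = b * p := by
        have := congrArg (Int.cast : ℤ → ℂ) hab
        push_cast at this ⊢
        linear_combination -this
      have h1 := V.valuation.map_one_sub_of_lt (x := (5 : ℕ) * (a : ℂ)) (by
        rw [map_mul]
        exact (mul_le_of_le_one_right' (valuation_le_one_of_mem_O4 (intCast_mem _ _) V)).trans_lt
          hV5)
      rw [hab', map_mul] at h1
      refine (valuation_le_one_of_mem_O4 (natCast_mem _ _) V).antisymm ?_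
      rw [← h1]
      exact mul_le_of_le_one_left' (valuation_le_one_of_mem_O4 (intCast_mem _ _) V)
    · have h1 := (valuation_le_one_of_mem_O4 hn5 V).antisymm (not_lt.1 hV5)
      have h2 := valuation_le_one_of_mem_O4 h5α V
      rwa [map_mul, h1, one_mul] at h2
  refine ⟨hαO, ?_⟩
  have h1 := congrArg gaussPar hvα
  rwa [gaussPar_mul hn5 hαO, gaussPar_mul hv hB, hv1, hg5, hB1, one_mul, one_mul] at h1

end QuarticSystem

lemma mem_units_iff {ε : ℂ} : ε ∈ ({1, -1, I, -I} : Set ℂ) ↔ ∃ k < 4, ε = I ^ k := by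
  constructor
  · rintro (rfl | rfl | rfl | rfl)
    exacts [⟨0, by norm_num, by simp⟩, ⟨2, by norm_num, by simp⟩, ⟨1, by norm_num, by simp⟩,
      ⟨3, by norm_num, by rw [pow_succ, I_sq, neg_one_mul]⟩]
  · rintro ⟨k, hk, rfl⟩
    interval_cases k <;> simp [pow_succ]

lemma EGS4_eq {p : ℕ} [Fact p.Prime] (χ f : ℂ → ℂ) (π : ℂ) :
    EGS4 p χ f π = (1 / 4) * ∑ n ∈ (Finset.univ : Finset (ZMod p)).erase 0,
      χ n.val * divVal p π f n := by
  rw [EGS4]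
  congr 1
  symm
  refine Finset.sum_nbij' (fun n => n.val) (fun r => (r : ZMod p)) ?_ ?_ ?_ ?_ ?_
  · intro n hn
    have hn : n.val ≠ 0 := (ZMod.val_ne_zero n).2 (Finset.ne_of_mem_erase hn)
    have := n.val_lt
    rw [Finset.mem_Icc]
    omega
  · intro r hr
    rw [Finset.mem_Icc] at hr
    refine Finset.mem_erase.2 ⟨fun h0 => ?_, Finset.mem_univ _⟩
    rw [ZMod.natCast_eq_zero_iff] at h0
    exact absurd (Nat.le_of_dvd (by omega) h0) (by omega)
  · exact fun n _ => ZMod.natCast_zmod_val n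
  · intro r hr
    rw [Finset.mem_Icc] at hr
    exact ZMod.val_cast_of_lt (by omega)
  · exact fun n _ => rfl

section

variable {p : ℕ} [Fact p.Prime] {π : ℂ} (h : IsGaussPrime p π) {χ : ℂ → ℂ} {S : Finset ℂ}

include h

lemma IsQuarterSet.injOn_resMap (hS : IsQuarterSet π S) : Set.InjOn (resMap p π) S :=
  fun ν hν μ hμ e => by
  have h1 : (1 : ℂ) ∈ ({1, -1, I, -I} : Set ℂ) := Or.inl rfl
  refine (hS.2.2 ν hν μ hμ 1 h1 1 h1 ?_).1
  rw [one_mul, one_mul]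
  exact (h.gcong_iff (hS.1 ν hν).1 (hS.1 μ hμ).1).2 e

lemma IsQuarterSet.prod_image_phi4 (hS : IsQuarterSet π S) :
    ∏ s ∈ S.image (resMap p π), divVal p π phi4 s = ∏ ν ∈ S, phi4 (ν / π) := by
  rw [Finset.prod_image (hS.injOn_resMap h)]
  refine Finset.prod_congr rfl fun ν hν => ?_
  obtain ⟨hνO, hν⟩ := hS.1 ν hν
  exact (h.divVal_eq (fun u _ a b => phi4_add_int u a b) hνO _ ((h.gcoprime_iff hνO).1 hν) rfl).symm

lemma IsQuarticChar.quarticSystem (hχ : IsQuarticChar π p χ) (hS : IsQuarterSet π S) :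
    QuarticSystem p (resI p π) (fun n => χ n.val) (S.image (resMap p π)) := by
  have hres : ∀ n : ZMod p, resMap p π (n.val : ℂ) = n := fun n => by
    rw [resMap_natCast, ZMod.natCast_zmod_val]
  have hval : ∀ n : ZMod p, (n.val : ℂ) ∈ O4 := fun n => natCast_mem _ _
  have hI : ∀ k, I ^ k ∈ O4 := fun k => pow_mem I_mem_O4 k
  have hresI : ∀ k, resMap p π (I ^ k) = resI p π ^ k := fun k => by
    rw [h.resMap_pow I_mem_O4, resMap_I]
  have hcop : ∀ {n : ZMod p}, n ≠ 0 → GCoprime n.val π := fun {n} hn =>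
    (h.gcoprime_iff (hval n)).2 (by rwa [hres])
  refine ⟨h.resI_sq, h.two_ne_zero', fun h0 => ?_, fun n hn => ?_, fun s hs s' hs' k hk k' hk' e => ?_,
    fun m n => ?_, fun n hn => ?_⟩
  · obtain ⟨ν, hν, h0⟩ := Finset.mem_image.1 h0
    obtain ⟨hνO, hν⟩ := hS.1 ν hν
    exact (h.gcoprime_iff hνO).1 hν h0
  · obtain ⟨ν, hν, ε, hε, he⟩ := hS.2.1 n.val (hval n) (hcop hn)
    obtain ⟨k, hk, rfl⟩ := mem_units_iff.1 hε
    have hνO := (hS.1 ν hν).1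
    rw [h.gcong_iff (hval n) (mul_mem (hI k) hνO), hres, h.resMap_mul (hI k) hνO, hresI] at he
    exact ⟨_, Finset.mem_image_of_mem _ hν, k, hk, he⟩
  · obtain ⟨ν, hν, rfl⟩ := Finset.mem_image.1 hs
    obtain ⟨μ, hμ, rfl⟩ := Finset.mem_image.1 hs'
    have hνO := (hS.1 ν hν).1
    have hμO := (hS.1 μ hμ).1
    rw [← hresI, ← hresI, ← h.resMap_mul (hI k) hνO, ← h.resMap_mul (hI k') hμO,
      ← h.gcong_iff (mul_mem (hI k) hνO) (mul_mem (hI k') hμO)] at e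
    obtain ⟨rfl, e'⟩ := hS.2.2 ν hν μ hμ _ (mem_units_iff.2 ⟨k, hk, rfl⟩) _
      (mem_units_iff.2 ⟨k', hk', rfl⟩) e
    exact ⟨rfl, eq_of_pow_eq_of_sq_eq_neg_one I_sq two_ne_zero hk hk' e'⟩
  · rw [← hχ.resChar.map_mul _ (hval m) _ (hval n)]
    refine hχ.resChar.periodic _ (hval _) _ (mul_mem (hval m) (hval n)) ?_
    rw [h.gcong_iff (hval _) (mul_mem (hval m) (hval n)), h.resMap_mul (hval m) (hval n), hres, hres,
      hres]
  · obtain ⟨k, -, hk⟩ := mem_units_iff.1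
      (show χ n.val ∈ ({1, -1, I, -I} : Set ℂ) from
        pow_four_eq_one_iff.1 (hχ.quart _ (hval n) (hcop hn)))
    have he := hχ.euler _ (hval n) (hcop hn)
    rw [hk, h.gcong_iff (hI k) (pow_mem (hval n) _), h.resMap_pow (hval n), hres, hresI] at he
    exact ⟨k, hk, he.symm⟩

end

/-- **Theorem II.1.** Let `π ∈ ℤ[i]` be a primary prime with `p = π·π̄` (assuming
`p > 5` in the case `p ≡ 5 (mod 16)`). Then the elliptic Gauss sum is expressible as
`G_π(χ_π, f) = α_π·π̃³`, where the coefficient `α_π = π̃⁻³·G_π(χ_π, f)` is an algebraic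
integer lying in `ℤ[i]` if `p ≡ 5 (mod 8)`, and in `ζ₈·ℤ[i]` if `p ≡ 1 (mod 8)`.
Moreover `α_π ≡ 1 (mod (1+i))` if `p ≡ 5 (mod 8)`. -/
theorem stmt_11
    (p : ℕ) (hp : p.Prime) (hp4 : p % 4 = 1)
    (π : ℂ) (hπ : π ∈ O4) (hprimary : GCong π 1 ((1 + Complex.I) ^ 3))
    (hnorm : (p : ℂ) = π * (starRingEnd ℂ) π)
    (χ : ℂ → ℂ) (hχ : IsQuarticChar π p χ)
    (S : Finset ℂ) (hS : IsQuarterSet π S)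
    (γ : ℂ) (hγ : IsGamma4 π p S γ)
    (πt : ℂ) (hπt : πt = γ⁻¹ * ∏ ν ∈ S, phi4 (ν / π))
    (α₁₃ α₅ α₁ : ℂ)
    (hα₁₃ : α₁₃ = (πt ^ 3)⁻¹ * EGS4 p χ phi4 π)
    (hα₅ : α₅ = (πt ^ 3)⁻¹ * EGS4 p χ Z4 π)
    (hα₁ : α₁ = (πt ^ 3)⁻¹ * EGS4 p χ psi4 π) :
    (p % 16 = 13 →
      EGS4 p χ phi4 π = α₁₃ * πt ^ 3 ∧ α₁₃ ∈ O4 ∧ GCong α₁₃ 1 (1 + Complex.I)) ∧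
    (p % 16 = 5 → 5 < p →
      EGS4 p χ Z4 π = α₅ * πt ^ 3 ∧ α₅ ∈ O4 ∧ GCong α₅ 1 (1 + Complex.I)) ∧
    (p % 8 = 1 →
      EGS4 p χ psi4 π = α₁ * πt ^ 3 ∧ ∃ b ∈ O4, α₁ = zeta8 * b) := by
  have : Fact p.Prime := ⟨hp⟩
  have h : IsGaussPrime p π := ⟨hp4, hπ, hnorm⟩
  have D := hχ.quarticSystem h hS
  have hX := D.prod_phi4_ne_zero h
  have h13 := D.gaussSum_phi4 h
  have h5 := D.gaussSum_Z4 h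
  have h1 := D.gaussSum_psi4 h
  simp only [← EGS4_eq, hS.prod_image_phi4 h] at hX h13 h5 h1
  set X := ∏ ν ∈ S, phi4 (ν / π)
  have key : ∀ G α : ℂ, γ ≠ 0 → α = (πt ^ 3)⁻¹ * G → G = α * πt ^ 3 ∧ α = γ ^ 3 * (G / X ^ 3) := by
    rintro G α hγ0 rfl
    have hπt0 : πt ≠ 0 := by rw [hπt]; exact mul_ne_zero (inv_ne_zero hγ0) hX
    refine ⟨by field_simp, ?_⟩
    rw [hπt, mul_pow, mul_inv, inv_pow, inv_inv]
    ring
  have unit : ∀ G : ℂ, γ ^ 4 = 1 → G / X ^ 3 ∈ O4 → gaussPar (G / X ^ 3) = 1 →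
      ∀ α, α = (πt ^ 3)⁻¹ * G → G = α * πt ^ 3 ∧ α ∈ O4 ∧ GCong α 1 (1 + I) := by
    intro G hγ4 hG hG1 α hα
    obtain ⟨e1, e2⟩ := key G α (by rintro rfl; norm_num at hγ4) hα
    have hγ3 : (γ ^ 3) ^ 4 = 1 := by rw [← pow_mul, mul_comm, pow_mul, hγ4, one_pow]
    have hγO := mem_O4_of_pow_four hγ3
    have hαO : α ∈ O4 := by rw [e2]; exact mul_mem hγO hG
    refine ⟨e1, hαO, (gcong_one_iff hαO).2 ?_⟩
    rw [e2, gaussPar_mul hγO hG, gaussPar_of_pow_four hγ3, hG1, one_mul]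
  refine ⟨fun hp => ?_, fun hp hp5 => ?_, fun hp => ?_⟩
  · exact unit _ (hγ.1 (by omega)).1 (h13 hp).1 (h13 hp).2 _ hα₁₃
  · exact unit _ (hγ.1 (by omega)).1 (h5 hp hp5.ne').1 (h5 hp hp5.ne').2 _ hα₅
  · have hγ4 := (hγ.2 hp).1
    obtain ⟨e1, e2⟩ := key _ α₁ (by rintro rfl; norm_num at hγ4) hα₁
    have hz : zeta8 ^ 4 = -1 := by
      rw [zeta8, ← Complex.exp_nat_mul, ← Complex.exp_pi_mul_I]
      congr 1; push_cast; ring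
    have hz0 : zeta8 ≠ 0 := Complex.exp_ne_zero _
    have hu : (γ ^ 3 / zeta8) ^ 4 = 1 := by
      rw [div_pow, hz, ← pow_mul, mul_comm, pow_mul, hγ4]; norm_num
    refine ⟨e1, _, mul_mem (mem_O4_of_pow_four hu) (h1 hp), ?_⟩
    rw [e2, ← mul_assoc, mul_div_cancel₀ _ hz0]

end
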